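/- arXiv:math/0506288 — 2 statements merged into one kernel-verified Lean document; each statement's English description precedes it below -/
import Mathlib

section
/- For every ε > 0 there exists n₀ such that every typical tree T on n ≥ n₀ vertices satisfies D(T) ≤ (1 + ε) · Δ(T), where Δ(T) is the maximum degree of T. -/
namespace FODef

/-- First-order formulas in the language of graphs (equality and adjacency), with free
variables among `x_0, …, x_{n-1}`. -/
inductive GForm : ℕ → Type
  | adj {n : ℕ} (i j : Fin n) : GForm n
  | eq {n : ℕ} (i j : Fin n) : GForm n
  | neg {n : ℕ} : GForm n → GForm n
  | conj {n : ℕ} : GForm n → GForm n → GForm n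
  | disj {n : ℕ} : GForm n → GForm n → GForm n
  | ex {n : ℕ} : GForm (n + 1) → GForm n
  | fa {n : ℕ} : GForm (n + 1) → GForm n

/-- Realization of a formula in a graph under a valuation of the free variables. -/
def GForm.Realize {V : Type} (G : SimpleGraph V) : ∀ {n : ℕ}, GForm n → (Fin n → V) → Prop
  | _, .adj i j, f => G.Adj (f i) (f j)
  | _, .eq i j, f => f i = f j
  | _, .neg φ, f => ¬ GForm.Realize G φ f
  | _, .conj φ ψ, f => GForm.Realize G φ f ∧ GForm.Realize G ψ f
  | _, .disj φ ψ, f => GForm.Realize G φ f ∨ GForm.Realize G ψ f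
  | _, .ex φ, f => ∃ v : V, GForm.Realize G φ (Fin.snoc f v)
  | _, .fa φ, f => ∀ v : V, GForm.Realize G φ (Fin.snoc f v)

/-- Quantifier depth: the maximum number of nested quantifiers. -/
def GForm.depth : ∀ {n : ℕ}, GForm n → ℕ
  | _, .adj _ _ => 0
  | _, .eq _ _ => 0
  | _, .neg φ => φ.depth
  | _, .conj φ ψ => max φ.depth ψ.depth
  | _, .disj φ ψ => max φ.depth ψ.depth
  | _, .ex φ => φ.depth + 1
  | _, .fa φ => φ.depth + 1

/-- A sentence (formula with no free variables) holds in a graph. -/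
def Sat {V : Type} (G : SimpleGraph V) (φ : GForm 0) : Prop :=
  φ.Realize G ![]

/-- A sentence defines the graph `G` if `G` satisfies it and every finite graph
satisfying it is isomorphic to `G`. -/
def Defines {V : Type} (G : SimpleGraph V) (φ : GForm 0) : Prop :=
  Sat G φ ∧ ∀ (m : ℕ) (H : SimpleGraph (Fin m)), Sat H φ → Nonempty (G ≃g H)

/-- `D G`: the minimum quantifier depth of a first-order sentence defining `G`. -/
noncomputable def D {V : Type} (G : SimpleGraph V) : ℕ :=
  sInf {d | ∃ φ : GForm 0, φ.depth = d ∧ Defines G φ}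

/-- Degree of a vertex. -/
noncomputable def deg {V : Type} (G : SimpleGraph V) (v : V) : ℕ :=
  Nat.card {w // G.Adj v w}

end FODef

namespace FODef

/-- Maximum degree of a graph on a finite vertex set. -/
noncomputable def maxDeg {V : Type} [Fintype V] (G : SimpleGraph V) : ℕ :=
  Finset.univ.sup fun v => deg G v

/-- `r₀ = ⌈7 ln n⌉`. -/
noncomputable def r0 (n : ℕ) : ℕ := ⌈(7 : ℝ) * Real.log n⌉₊

/-- `p` is adjacent to a vertex of degree one. -/
def adjToLeaf {V : Type} (T : SimpleGraph V) (p : V) : Prop :=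
  ∃ w : V, T.Adj p w ∧ deg T w = 1

/-- The check of a path `P` from `v` to `w`: the sequence recording, for each vertex of
`P` in order, whether it is adjacent to a vertex of degree one. -/
def check {V : Type} (T : SimpleGraph V) {v w : V} (P : T.Walk v w) : List Prop :=
  P.support.map fun p => adjToLeaf T p

/-- A tree on `n` vertices is typical if:
(1) paths of length `r₀` sharing at most one vertex have different checks;
(2) `ln n / (2 ln ln n) ≤ Δ(T) ≤ 2 ln n / ln ln n`;
(3) every ball of radius `r₀` has at most `10^8 ln⁴ n` vertices;
(4) every ball of radius `r₀` contains at most `ln n/(ln ln n)²` vertices of degree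
greater than `(ln ln n)⁵`. -/
def Typical (n : ℕ) (T : SimpleGraph (Fin n)) : Prop :=
  (∀ (v w v' w' : Fin n) (P : T.Walk v w) (P' : T.Walk v' w'),
    P.IsPath → P'.IsPath → P.length = r0 n → P'.length = r0 n →
    (P.support.toFinset ∩ P'.support.toFinset).card ≤ 1 →
    check T P ≠ check T P') ∧
  (Real.log n / (2 * Real.log (Real.log n)) ≤ (maxDeg T : ℝ) ∧
    (maxDeg T : ℝ) ≤ 2 * Real.log n / Real.log (Real.log n)) ∧
  (∀ v : Fin n,
    (Nat.card {w : Fin n // T.dist v w ≤ r0 n} : ℝ) ≤ 10 ^ 8 * Real.log n ^ 4) ∧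
  (∀ v : Fin n,
    (Nat.card {w : Fin n // T.dist v w ≤ r0 n ∧
        (Real.log (Real.log n)) ^ 5 < (deg T w : ℝ)} : ℝ) ≤
      Real.log n / (Real.log (Real.log n)) ^ 2)

end FODef

open FODef

namespace FODef

/-- Duplicator wins the `k`-round Ehrenfeucht game on `G` and `H` from the position in which
the pairs of `S` are pebbled. -/
def EF {V W : Type} (G : SimpleGraph V) (H : SimpleGraph W) : ℕ → Set (V × W) → Prop
  | 0, S => ∀ a ∈ S, ∀ b ∈ S, (a.1 = b.1 ↔ a.2 = b.2) ∧ (G.Adj a.1 b.1 ↔ H.Adj a.2 b.2)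
  | k + 1, S => (∀ v, ∃ w, EF G H k (insert (v, w) S)) ∧ ∀ w, ∃ v, EF G H k (insert (v, w) S)

section EF

variable {V W : Type} {G : SimpleGraph V} {H : SimpleGraph W}

theorem EF.subset {k : ℕ} {S S' : Set (V × W)} (h : EF G H k S) (hS : S' ⊆ S) :
    EF G H k S' := by
  induction k generalizing S S' with
  | zero => exact fun a ha b hb => h a (hS ha) b (hS hb)
  | succ k ih =>
    refine ⟨fun v => ?_, fun w => ?_⟩
    · obtain ⟨w, hw⟩ := h.1 v
      exact ⟨w, ih hw (Set.insert_subset_insert hS)⟩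
    · obtain ⟨v, hv⟩ := h.2 w
      exact ⟨v, ih hv (Set.insert_subset_insert hS)⟩

theorem EF.pred {k : ℕ} {S : Set (V × W)} (h : EF G H (k + 1) S) : EF G H k S := by
  induction k generalizing S with
  | zero =>
    intro a ha b hb
    obtain ⟨w, hw⟩ := h.1 a.1
    exact hw a (Set.mem_insert_of_mem _ ha) b (Set.mem_insert_of_mem _ hb)
  | succ k ih =>
    refine ⟨fun v => ?_, fun w => ?_⟩
    · obtain ⟨w, hw⟩ := h.1 v
      exact ⟨w, ih hw⟩
    · obtain ⟨v, hv⟩ := h.2 w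
      exact ⟨v, ih hv⟩

theorem EF.mono {k l : ℕ} {S : Set (V × W)} (h : EF G H k S) (hl : l ≤ k) : EF G H l S := by
  induction k with
  | zero => exact (Nat.le_zero.1 hl) ▸ h
  | succ k ih =>
    rcases Nat.lt_or_ge k l with h1 | h1
    · obtain rfl : l = k + 1 := by omega
      exact h
    · exact ih h.pred h1

theorem EF.eq_iff {k : ℕ} {S : Set (V × W)} (h : EF G H k S) {a b : V} {a' b' : W}
    (ha : (a, a') ∈ S) (hb : (b, b') ∈ S) : a = b ↔ a' = b' :=
  ((h.mono (Nat.zero_le k) : EF G H 0 S) _ ha _ hb).1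

theorem EF.adj_iff {k : ℕ} {S : Set (V × W)} (h : EF G H k S) {a b : V} {a' b' : W}
    (ha : (a, a') ∈ S) (hb : (b, b') ∈ S) : G.Adj a b ↔ H.Adj a' b' :=
  ((h.mono (Nat.zero_le k) : EF G H 0 S) _ ha _ hb).2

theorem EF.ex_congr {k : ℕ} {S : Set (V × W)} (h : EF G H (k + 1) S)
    {P : V → Prop} {Q : W → Prop}
    (hPQ : ∀ v w, EF G H k (insert (v, w) S) → (P v ↔ Q w)) : (∃ v, P v) ↔ ∃ w, Q w := by
  constructor
  · rintro ⟨v, hv⟩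
    obtain ⟨w, hw⟩ := h.1 v
    exact ⟨w, (hPQ v w hw).1 hv⟩
  · rintro ⟨w, hw⟩
    obtain ⟨v, hv⟩ := h.2 w
    exact ⟨v, (hPQ v w hv).2 hw⟩

theorem EF.fa_congr {k : ℕ} {S : Set (V × W)} (h : EF G H (k + 1) S)
    {P : V → Prop} {Q : W → Prop}
    (hPQ : ∀ v w, EF G H k (insert (v, w) S) → (P v ↔ Q w)) : (∀ v, P v) ↔ ∀ w, Q w := by
  constructor
  · intro hv w
    obtain ⟨v, hw⟩ := h.2 w
    exact (hPQ v w hw).1 (hv v)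
  · intro hw v
    obtain ⟨w, hv⟩ := h.1 v
    exact (hPQ v w hv).2 (hw w)

theorem EF.pin [Nonempty W] {k : ℕ} (C : Finset V) {S : Set (V × W)} (h : EF G H (k + C.card) S) :
    ∃ g : V → W, EF G H k (S ∪ {p | p.1 ∈ C ∧ p.2 = g p.1}) := by
  classical
  induction C using Finset.induction_on generalizing S with
  | empty => exact ⟨fun _ => Classical.arbitrary W, by simpa using h⟩
  | insert c C hc ih =>
    rw [Finset.card_insert_of_notMem hc, ← add_assoc] at h
    obtain ⟨w, hw⟩ := h.1 c
    obtain ⟨g, hg⟩ := ih hw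
    refine ⟨Function.update g c w, hg.subset ?_⟩
    rintro ⟨a, b⟩ (hab | ⟨ha, hb⟩)
    · exact Or.inl (Or.inr hab)
    · simp only [Finset.mem_insert] at ha hb
      rcases eq_or_ne a c with rfl | hac
      · left; left
        simpa using hb
      · right
        rw [Function.update_of_ne hac] at hb
        exact ⟨ha.resolve_left hac, hb⟩

end EF

namespace GForm

/-- A valid formula. -/
def top : (m : ℕ) → GForm m
  | 0 => .fa (.eq 0 0)
  | _ + 1 => .eq 0 0

/-- Conjunction of a list of formulas. -/
def conjList {m : ℕ} (l : List (GForm m)) : GForm m := l.foldr .conj (top m)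

/-- Disjunction of a list of formulas. -/
def disjList {m : ℕ} (l : List (GForm m)) : GForm m := l.foldr .disj (.neg (top m))

theorem realize_top {V : Type} (G : SimpleGraph V) {m : ℕ} (a : Fin m → V) :
    (top m).Realize G a := by
  cases m <;> simp [top, Realize]

theorem realize_conjList {V : Type} (G : SimpleGraph V) {m : ℕ} (l : List (GForm m))
    (a : Fin m → V) : (conjList l).Realize G a ↔ ∀ φ ∈ l, φ.Realize G a := by
  induction l with
  | nil => simp [conjList, realize_top]
  | cons φ l ih =>
    simp only [conjList, List.foldr_cons, Realize, List.forall_mem_cons]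
    exact and_congr_right fun _ => ih

theorem realize_disjList {V : Type} (G : SimpleGraph V) {m : ℕ} (l : List (GForm m))
    (a : Fin m → V) : (disjList l).Realize G a ↔ ∃ φ ∈ l, φ.Realize G a := by
  induction l with
  | nil => simp [disjList, realize_top, Realize]
  | cons φ l ih =>
    simp only [disjList, List.foldr_cons, Realize, List.exists_mem_cons_iff]
    exact or_congr_right ih

theorem depth_conjList_le {m : ℕ} (l : List (GForm m)) {k : ℕ} (h0 : (top m).depth ≤ k)
    (h : ∀ φ ∈ l, φ.depth ≤ k) : (conjList l).depth ≤ k := by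
  induction l with
  | nil => exact h0
  | cons φ l ih =>
    simp only [List.forall_mem_cons] at h
    exact max_le h.1 (ih h.2)

theorem depth_disjList_le {m : ℕ} (l : List (GForm m)) {k : ℕ} (h0 : (top m).depth ≤ k)
    (h : ∀ φ ∈ l, φ.depth ≤ k) : (disjList l).depth ≤ k := by
  induction l with
  | nil => exact h0
  | cons φ l ih =>
    simp only [List.forall_mem_cons] at h
    exact max_le h.1 (ih h.2)

open Classical in
/-- The formula `φ` if `p` holds, and its negation otherwise. -/
noncomputable def lit {m : ℕ} (p : Prop) (φ : GForm m) : GForm m := if p then φ else .neg φ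

theorem realize_lit {V : Type} (G : SimpleGraph V) {m : ℕ} (p : Prop) (φ : GForm m)
    (a : Fin m → V) : (lit p φ).Realize G a ↔ (p ↔ φ.Realize G a) := by
  by_cases hp : p <;> simp [lit, hp, Realize]

theorem depth_lit {m : ℕ} (p : Prop) (φ : GForm m) : (lit p φ).depth = φ.depth := by
  by_cases hp : p <;> simp [lit, hp, depth]

/-- The formula describing the `k`-round game type of the tuple `a` in the finite graph `G`. -/
noncomputable def hintikka {n : ℕ} (G : SimpleGraph (Fin n)) :
    ℕ → {m : ℕ} → (Fin m → Fin n) → GForm m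
  | 0, m, a => conjList ((List.finRange m).flatMap fun i => (List.finRange m).flatMap fun j =>
      [lit (a i = a j) (.eq i j), lit (G.Adj (a i) (a j)) (.adj i j)])
  | k + 1, _, a =>
    .conj (conjList ((List.finRange n).map fun v => .ex (hintikka G k (Fin.snoc a v))))
      (.fa (disjList ((List.finRange n).map fun v => hintikka G k (Fin.snoc a v))))

theorem depth_hintikka_le {n : ℕ} (G : SimpleGraph (Fin n)) (k : ℕ) {m : ℕ}
    (a : Fin m → Fin n) (h : 0 < k ∨ 0 < m) : (hintikka G k a).depth ≤ k := by
  induction k generalizing m with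
  | zero =>
    refine depth_conjList_le _ ?_ ?_
    · cases m with
      | zero => omega
      | succ m => exact le_rfl
    · intro φ hφ
      simp only [List.mem_flatMap, List.mem_cons, List.not_mem_nil, or_false] at hφ
      obtain ⟨i, -, j, -, rfl | rfl⟩ := hφ <;> simp [depth_lit, depth]
  | succ k ih =>
    refine max_le (depth_conjList_le _ ?_ ?_) (Nat.succ_le_succ (depth_disjList_le _ ?_ ?_))
    · cases m <;> simp [top, depth]
    · intro φ hφ
      obtain ⟨v, -, rfl⟩ := List.mem_map.1 hφ
      exact Nat.succ_le_succ (ih _ (Or.inr (Nat.succ_pos m)))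
    · exact Nat.zero_le k
    · intro φ hφ
      obtain ⟨v, -, rfl⟩ := List.mem_map.1 hφ
      exact ih _ (Or.inr (Nat.succ_pos m))

theorem realize_hintikka_self {n : ℕ} (G : SimpleGraph (Fin n)) (k : ℕ) {m : ℕ}
    (a : Fin m → Fin n) : (hintikka G k a).Realize G a := by
  induction k generalizing m with
  | zero =>
    rw [hintikka, realize_conjList]
    intro φ hφ
    simp only [List.mem_flatMap, List.mem_cons, List.not_mem_nil, or_false] at hφ
    obtain ⟨i, -, j, -, rfl | rfl⟩ := hφ <;> simp [realize_lit, Realize]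
  | succ k ih =>
    simp only [hintikka, Realize, realize_conjList, realize_disjList, List.mem_map,
      List.mem_finRange, true_and, forall_exists_index, forall_apply_eq_imp_iff,
      exists_exists_eq_and]
    exact ⟨fun v => ⟨v, ih _⟩, fun v => ⟨v, ih _⟩⟩

theorem ef_of_realize_hintikka {n : ℕ} {W : Type} (G : SimpleGraph (Fin n))
    (H : SimpleGraph W) (k : ℕ) {m : ℕ} (a : Fin m → Fin n) (b : Fin m → W)
    (h : (hintikka G k a).Realize H b) : EF G H k (Set.range fun i => (a i, b i)) := by
  induction k generalizing m with
  | zero =>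
    rw [hintikka, realize_conjList] at h
    rintro _ ⟨i, rfl⟩ _ ⟨j, rfl⟩
    have h1 := h (lit (a i = a j) (.eq i j)) (by simp; exact ⟨i, j, by simp⟩)
    have h2 := h (lit (G.Adj (a i) (a j)) (.adj i j)) (by simp; exact ⟨i, j, by simp⟩)
    rw [realize_lit] at h1 h2
    exact ⟨h1, h2⟩
  | succ k ih =>
    have key : ∀ v w, insert (v, w) (Set.range fun i => (a i, b i)) ⊆
        Set.range fun i => ((Fin.snoc a v : Fin (m + 1) → Fin n) i,
          (Fin.snoc b w : Fin (m + 1) → W) i) := by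
      rintro v w p (rfl | ⟨i, rfl⟩)
      · exact ⟨Fin.last m, by simp⟩
      · exact ⟨i.castSucc, by simp⟩
    simp only [hintikka, Realize, realize_conjList, realize_disjList, List.mem_map,
      List.mem_finRange, true_and, forall_exists_index, forall_apply_eq_imp_iff,
      exists_exists_eq_and] at h
    refine ⟨fun v => ?_, fun w => ?_⟩
    · obtain ⟨w, hw⟩ := h.1 v
      exact ⟨w, (ih _ _ hw).subset (key v w)⟩
    · obtain ⟨v, hv⟩ := h.2 w
      exact ⟨v, (ih _ _ hv).subset (key v w)⟩

end GForm

theorem D_le_of_ef {n : ℕ} (G : SimpleGraph (Fin n)) {k : ℕ} (hk : 0 < k)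
    (h : ∀ (m : ℕ) (H : SimpleGraph (Fin m)), EF G H k ∅ → Nonempty (G ≃g H)) : D G ≤ k := by
  refine le_trans (Nat.sInf_le ⟨GForm.hintikka G k ![], rfl, ?_, fun m H hH => h m H ?_⟩)
    (GForm.depth_hintikka_le G k ![] (Or.inl hk))
  · exact GForm.realize_hintikka_self G k _
  · exact (GForm.ef_of_realize_hintikka G H k _ _ hH).subset (Set.empty_subset _)

section Definable

variable {V W : Type} {G : SimpleGraph V} {H : SimpleGraph W}

/-- There is a walk of length `d` from `x` to `y` whose `i`-th vertex satisfies `P i`. -/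
def Chain (G : SimpleGraph V) (P : ℕ → V → Prop) (d : ℕ) (x y : V) : Prop :=
  ∃ p : ℕ → V, p 0 = x ∧ p d = y ∧ (∀ i < d, G.Adj (p i) (p (i + 1))) ∧ ∀ i ≤ d, P i (p i)

/-- There is a walk of length `d` from `x` to `y`. -/
def Wk (G : SimpleGraph V) (d : ℕ) (x y : V) : Prop := Chain G (fun _ _ => True) d x y

theorem chain_zero {P : ℕ → V → Prop} {x y : V} : Chain G P 0 x y ↔ x = y ∧ P 0 x := by
  constructor
  · rintro ⟨p, rfl, rfl, -, h⟩
    exact ⟨rfl, h 0 le_rfl⟩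
  · rintro ⟨rfl, h⟩
    exact ⟨fun _ => x, rfl, rfl, by simp, by simpa using h⟩

theorem chain_one {P : ℕ → V → Prop} {x y : V} :
    Chain G P 1 x y ↔ G.Adj x y ∧ P 0 x ∧ P 1 y := by
  constructor
  · rintro ⟨p, rfl, rfl, h1, h⟩
    exact ⟨h1 0 one_pos, h 0 (Nat.zero_le 1), h 1 le_rfl⟩
  · rintro ⟨hxy, h0, h1⟩
    refine ⟨fun i => if i = 0 then x else y, rfl, rfl, ?_, ?_⟩
    · intro i hi
      obtain rfl : i = 0 := by omega
      simpa using hxy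
    · intro i hi
      rcases Nat.le_one_iff_eq_zero_or_eq_one.1 hi with rfl | rfl
      · simpa using h0
      · simpa using h1

theorem chain_add {P : ℕ → V → Prop} {d e : ℕ} {x y : V} :
    Chain G P (d + e) x y ↔ ∃ z, Chain G P d x z ∧ Chain G (fun i => P (d + i)) e z y := by
  constructor
  · rintro ⟨p, rfl, rfl, h1, h⟩
    refine ⟨p d, ⟨p, rfl, rfl, fun i hi => h1 i (by omega), fun i hi => h i (by omega)⟩,
      fun i => p (d + i), rfl, rfl, fun i hi => h1 (d + i) (by omega),
      fun i hi => h (d + i) (by omega)⟩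
  · rintro ⟨z, ⟨p, rfl, rfl, h1, h⟩, p', h0, rfl, h1', h'⟩
    refine ⟨fun i => if i ≤ d then p i else p' (i - d), by simp, ?_, ?_, ?_⟩
    · by_cases he : e = 0
      · subst he
        simp [h0]
      · simp [he]
    · intro i hi
      rcases lt_trichotomy i d with hid | rfl | hid
      · simpa [hid.le, Nat.succ_le_of_lt hid] using h1 i hid
      · simpa [h0] using h1' 0 (by omega)
      · have := h1' (i - d) (by omega)
        rw [show i - d + 1 = i + 1 - d by omega] at this
        simpa [not_le.2 hid, not_le.2 (hid.trans (Nat.lt_succ_self i))] using this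
    · intro i hi
      rcases le_or_gt i d with hid | hid
      · simpa [hid] using h i hid
      · have := h' (i - d) (by omega)
        simp only [show d + (i - d) = i by omega] at this
        simpa [not_le.2 hid] using this

theorem wk_zero {x y : V} : Wk G 0 x y ↔ x = y := by simp [Wk, chain_zero]

theorem wk_one {x y : V} : Wk G 1 x y ↔ G.Adj x y := by simp [Wk, chain_one]

theorem wk_add {d e : ℕ} {x y : V} :
    Wk G (d + e) x y ↔ ∃ z, Wk G d x z ∧ Wk G e z y := chain_add

theorem EF.chain_iff {j : ℕ} {P : ℕ → V → Prop} {Q : ℕ → W → Prop}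
    (hPQ : ∀ i (S : Set (V × W)), EF G H j S → ∀ v w, (v, w) ∈ S → (P i v ↔ Q i w))
    {k d : ℕ} (hd : d ≤ 2 ^ k) {S : Set (V × W)} (h : EF G H (j + k) S) {x y : V} {x' y' : W}
    (hx : (x, x') ∈ S) (hy : (y, y') ∈ S) : Chain G P d x y ↔ Chain H Q d x' y' := by
  induction k generalizing d P Q S x y x' y' with
  | zero =>
    rcases Nat.le_one_iff_eq_zero_or_eq_one.1 (by simpa using hd) with rfl | rfl
    · simp only [chain_zero]
      exact and_congr (h.eq_iff hx hy) (hPQ 0 S h _ _ hx)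
    · simp only [chain_one]
      exact and_congr (h.adj_iff hx hy) (and_congr (hPQ 0 S h _ _ hx) (hPQ 1 S h _ _ hy))
  | succ k ih =>
    rcases le_or_gt d (2 ^ k) with h1 | h1
    · exact ih hPQ h1 (h.mono (by omega)) hx hy
    · obtain ⟨e, rfl⟩ := Nat.exists_eq_add_of_le h1.le
      rw [chain_add, chain_add]
      refine EF.ex_congr h fun v w hvw => and_congr ?_ ?_
      · exact ih hPQ le_rfl hvw (Or.inr hx) (Or.inl rfl)
      · exact ih (fun i => hPQ (2 ^ k + i)) (by rw [pow_succ] at hd; omega) hvw (Or.inl rfl)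
          (Or.inr hy)

theorem EF.wk_iff {k d : ℕ} (hd : d ≤ 2 ^ k) {S : Set (V × W)} (h : EF G H k S) {x y : V}
    {x' y' : W} (hx : (x, x') ∈ S) (hy : (y, y') ∈ S) : Wk G d x y ↔ Wk H d x' y' :=
  EF.chain_iff (j := 0) (fun _ _ _ _ _ _ => Iff.rfl) hd (by simpa using h) hx hy

/-- `x` is adjacent to a vertex of degree one. -/
def NearLeaf (G : SimpleGraph V) (x : V) : Prop := ∃ w, G.Adj x w ∧ ∀ u, G.Adj w u → u = x

theorem EF.nearLeaf_iff {S : Set (V × W)} (h : EF G H 2 S) {x : V} {x' : W}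
    (hx : (x, x') ∈ S) : NearLeaf G x ↔ NearLeaf H x' :=
  h.ex_congr fun _ _ h1 => and_congr (h1.adj_iff (Or.inr hx) (Or.inl rfl)) <|
    h1.fa_congr fun _ _ h2 => imp_congr (h2.adj_iff (Or.inr (Or.inl rfl)) (Or.inl rfl))
      (h2.eq_iff (Or.inl rfl) (Or.inr (Or.inr hx)))

theorem EF.checkChain_iff {q d : ℕ} (hd : d ≤ 2 ^ q) {S : Set (V × W)} (h : EF G H (2 + q) S)
    {x y : V} {x' y' : W} (hx : (x, x') ∈ S) (hy : (y, y') ∈ S) (c : ℕ → Prop) :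
    Chain G (fun i v => NearLeaf G v ↔ c i) d x y ↔
      Chain H (fun i v => NearLeaf H v ↔ c i) d x' y' :=
  EF.chain_iff (P := fun i v => NearLeaf G v ↔ c i) (Q := fun i v => NearLeaf H v ↔ c i)
    (fun _ _ hS _ _ hvw => iff_congr (hS.nearLeaf_iff hvw) Iff.rfl) hd h hx hy

/-- `x` is the vertex at position `r` of a geodesic of length `6 * r` with check `c`. -/
def Key (G : SimpleGraph V) (r : ℕ) (c : ℕ → Prop) (x : V) : Prop :=
  ∃ u w, Chain G (fun i v => NearLeaf G v ↔ c i) r u x ∧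
    Chain G (fun i v => NearLeaf G v ↔ c (r + i)) (5 * r) x w ∧ ∀ e < 6 * r, ¬ Wk G e u w

theorem EF.key_iff {q r : ℕ} (hq : 6 * r ≤ 2 ^ q) {S : Set (V × W)} (h : EF G H (q + 4) S)
    {x : V} {x' : W} (hx : (x, x') ∈ S) (c : ℕ → Prop) : Key G r c x ↔ Key H r c x' := by
  have hr : r ≤ 2 ^ q := by omega
  have hr' : 5 * r ≤ 2 ^ q := by omega
  refine h.ex_congr fun u u' h1 => h1.ex_congr fun w w' h2 =>
    and_congr ?_ (and_congr ?_ ?_)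
  · exact EF.checkChain_iff hr (h2.mono (by omega)) (Or.inr (Or.inl rfl)) (Or.inr (Or.inr hx)) c
  · exact EF.checkChain_iff hr' (h2.mono (by omega)) (Or.inr (Or.inr hx)) (Or.inl rfl) _
  · exact forall₂_congr fun e he => not_congr <|
      EF.wk_iff (k := q) (by omega) (h2.mono (by omega)) (Or.inr (Or.inl rfl)) (Or.inl rfl)

/-- `x` is the vertex at position `r` of a geodesic of length `6 * r`. -/
def Core (G : SimpleGraph V) (r : ℕ) (x : V) : Prop := ∃ c, Key G r c x

theorem EF.core_iff {q r : ℕ} (hq : 6 * r ≤ 2 ^ q) {S : Set (V × W)} (h : EF G H (q + 4) S)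
    {x : V} {x' : W} (hx : (x, x') ∈ S) : Core G r x ↔ Core H r x' :=
  exists_congr fun c => h.key_iff hq hx c

/-- There is a walk of length `d` from the core to `v`. -/
def CoreWk (G : SimpleGraph V) (r d : ℕ) (v : V) : Prop := ∃ z, Core G r z ∧ Wk G d z v

/-- The distance from the core to `v` is `d`. -/
def Lev (G : SimpleGraph V) (r d : ℕ) (v : V) : Prop :=
  CoreWk G r d v ∧ ∀ e < d, ¬ CoreWk G r e v

theorem EF.coreWk_iff {q r d : ℕ} (hq : 6 * r ≤ 2 ^ q) (hd : d ≤ 2 ^ q) {S : Set (V × W)}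
    (h : EF G H (q + 5) S) {v : V} {v' : W} (hv : (v, v') ∈ S) :
    CoreWk G r d v ↔ CoreWk H r d v' :=
  h.ex_congr fun _ _ h1 => and_congr (h1.core_iff hq (Or.inl rfl))
    (EF.wk_iff hd (h1.mono (by omega)) (Or.inl rfl) (Or.inr hv))

theorem EF.lev_iff {q r d : ℕ} (hq : 6 * r ≤ 2 ^ q) (hd : d ≤ 2 ^ q) {S : Set (V × W)}
    (h : EF G H (q + 5) S) {v : V} {v' : W} (hv : (v, v') ∈ S) :
    Lev G r d v ↔ Lev H r d v' :=
  and_congr (h.coreWk_iff hq hd hv) <| forall₂_congr fun e he => not_congr <|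
    h.coreWk_iff hq (by omega) hv

theorem Lev.unique {r d e : ℕ} {v : V} (hd : Lev G r d v) (he : Lev G r e v) : d = e := by
  rcases lt_trichotomy d e with h | h | h
  · exact absurd hd.1 (he.2 d h)
  · exact h
  · exact absurd he.1 (hd.2 e h)

theorem CoreWk.exists_lev {r d : ℕ} {v : V} (h : CoreWk G r d v) : ∃ e ≤ d, Lev G r e v := by
  classical
  have h' : ∃ d, CoreWk G r d v := ⟨d, h⟩
  exact ⟨Nat.find h', Nat.find_min' h' h, Nat.find_spec h', fun e he => Nat.find_min h' he⟩

theorem CoreWk.add {r d e : ℕ} {u v : V} (h : CoreWk G r d u) (huv : Wk G e u v) :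
    CoreWk G r (d + e) v :=
  let ⟨z, hz, hzu⟩ := h
  ⟨z, hz, wk_add.2 ⟨u, hzu, huv⟩⟩

theorem Lev.le_add {r d d' e : ℕ} {u v : V} (hu : Lev G r d u) (hv : Lev G r d' v)
    (huv : Wk G e u v) : d' ≤ d + e := by
  by_contra hlt
  exact hv.2 _ (not_le.1 hlt) (hu.1.add huv)

theorem lev_zero_iff {r : ℕ} {v : V} : Lev G r 0 v ↔ Core G r v := by
  constructor
  · rintro ⟨⟨z, hz, h⟩, -⟩
    rwa [← wk_zero.1 h]
  · intro h
    exact ⟨⟨v, h, wk_zero.2 rfl⟩, by simp⟩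

theorem Lev.exists_parent {r d : ℕ} {v : V} (h : Lev G r (d + 1) v) :
    ∃ u, G.Adj u v ∧ Lev G r d u := by
  obtain ⟨⟨z, hz, hzv⟩, hmin⟩ := h
  obtain ⟨u, hzu, huv⟩ := wk_add.1 hzv
  refine ⟨u, wk_one.1 huv, ⟨z, hz, hzu⟩, fun e he hu => hmin (e + 1) (by omega) (hu.add huv)⟩

/-- The core vertices of `G` are determined by their keys, and the other vertices form rooted
trees of height at most `r` attached to the core. -/
structure Layered (G : SimpleGraph V) (r : ℕ) : Prop where
  key_inj : ∀ c x y, Key G r c x → Key G r c y → x = y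
  exists_lev : ∀ v, ∃ d ≤ r, Lev G r d v
  parent_unique : ∀ d < r, ∀ v u u', Lev G r (d + 1) v → G.Adj v u → G.Adj v u' →
    Lev G r d u → Lev G r d u' → u = u'
  not_adj : ∀ d < r, ∀ v u, G.Adj v u → Lev G r (d + 1) v → ¬ Lev G r (d + 1) u

theorem Layered.transfer {q r : ℕ} (hG : Layered G r) (hq : 6 * r ≤ 2 ^ q)
    (h : EF G H (q + 8) ∅) : Layered H r where
  key_inj c := by
    refine (EF.fa_congr h fun v v' h1 => EF.fa_congr h1 fun u u' h2 => ?_).1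
      (hG.key_inj c)
    exact imp_congr ((h2.mono (by omega)).key_iff hq (Or.inr (Or.inl rfl)) c) <|
      imp_congr ((h2.mono (by omega)).key_iff hq (Or.inl rfl) c)
        (h2.eq_iff (Or.inr (Or.inl rfl)) (Or.inl rfl))
  exists_lev := by
    refine (EF.fa_congr (P := fun v => ∃ d ≤ r, Lev G r d v) (Q := fun v => ∃ d ≤ r, Lev H r d v)
      h fun v v' h1 => exists_congr fun d => and_congr_right fun hd => ?_).1 hG.exists_lev
    exact (h1.mono (by omega)).lev_iff hq (by omega) (Or.inl rfl)
  parent_unique d hd := by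
    refine (EF.fa_congr h fun v v' h1 => EF.fa_congr h1 fun u u' h2 =>
      EF.fa_congr h2 fun w w' h3 => ?_).1 (hG.parent_unique d hd)
    have hv : (v, v') ∈ insert (w, w') (insert (u, u') (insert (v, v') (∅ : Set (V × W)))) :=
      Or.inr (Or.inr (Or.inl rfl))
    have hu : (u, u') ∈ insert (w, w') (insert (u, u') (insert (v, v') (∅ : Set (V × W)))) :=
      Or.inr (Or.inl rfl)
    have hw : (w, w') ∈ insert (w, w') (insert (u, u') (insert (v, v') (∅ : Set (V × W)))) :=
      Or.inl rfl
    exact imp_congr (h3.lev_iff hq (by omega) hv) <| imp_congr (h3.adj_iff hv hu) <|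
      imp_congr (h3.adj_iff hv hw) <| imp_congr (h3.lev_iff hq (by omega) hu) <|
      imp_congr (h3.lev_iff hq (by omega) hw) (h3.eq_iff hu hw)
  not_adj d hd := by
    refine (EF.fa_congr h fun v v' h1 => EF.fa_congr h1 fun u u' h2 => ?_).1
      (hG.not_adj d hd)
    exact imp_congr (h2.adj_iff (Or.inr (Or.inl rfl)) (Or.inl rfl)) <|
      imp_congr ((h2.mono (by omega)).lev_iff hq (by omega) (Or.inr (Or.inl rfl))) <|
      not_congr ((h2.mono (by omega)).lev_iff hq (by omega) (Or.inl rfl))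

/-- `u` is a descendant of `v`, `e` levels further from the core. -/
def Desc (G : SimpleGraph V) (r e : ℕ) (v u : V) : Prop :=
  ∃ d, d + e ≤ r ∧ Lev G r d v ∧ Lev G r (d + e) u ∧ Wk G e v u

theorem EF.desc_iff {q r e : ℕ} (hq : 6 * r ≤ 2 ^ q) {S : Set (V × W)}
    (h : EF G H (q + 5) S) {v u : V} {v' u' : W} (hv : (v, v') ∈ S) (hu : (u, u') ∈ S) :
    Desc G r e v u ↔ Desc H r e v' u' :=
  exists_congr fun d => and_congr_right fun hd =>
    and_congr (h.lev_iff hq (by omega) hv) <| and_congr (h.lev_iff hq (by omega) hu) <|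
    EF.wk_iff (k := q) (by omega) (h.mono (by omega)) hv hu

theorem Desc.adj {r : ℕ} {v u : V} (h : Desc G r 1 v u) : G.Adj v u :=
  let ⟨_, _, _, _, h⟩ := h
  wk_one.1 h

theorem Desc.eq {r : ℕ} {v u : V} (h : Desc G r 0 v u) : v = u :=
  let ⟨_, _, _, _, h⟩ := h
  wk_zero.1 h

theorem Desc.trans {r a b : ℕ} {u v w : V} (h1 : Desc G r a u v) (h2 : Desc G r b v w) :
    Desc G r (a + b) u w := by
  obtain ⟨d, hd, hu, hv, huv⟩ := h1
  obtain ⟨d', hd', hv', hw, hvw⟩ := h2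
  obtain rfl := hv.unique hv'
  refine ⟨d, by omega, hu, ?_, wk_add.2 ⟨v, huv, hvw⟩⟩
  rwa [← add_assoc]

theorem Layered.desc_add (hG : Layered G r) {a b : ℕ} {u w : V} (h : Desc G r (a + b) u w) :
    ∃ v, Desc G r a u v ∧ Desc G r b v w := by
  obtain ⟨d, hd, hu, hw, huw⟩ := h
  obtain ⟨v, huv, hvw⟩ := wk_add.1 huw
  obtain ⟨d', hd', hv⟩ := hG.exists_lev v
  have h1 := hu.le_add hv huv
  have h2 := hv.le_add hw hvw
  obtain rfl : d' = d + a := by omega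
  refine ⟨v, ⟨d, by omega, hu, hv, huv⟩, d + a, by omega, hv, ?_, hvw⟩
  rwa [add_assoc]

theorem Layered.desc_refl (hG : Layered G r) (v : V) : Desc G r 0 v v := by
  obtain ⟨d, hd, hv⟩ := hG.exists_lev v
  exact ⟨d, hd, hv, hv, wk_zero.2 rfl⟩

theorem Layered.child_unique (hG : Layered G r) {u v w : V} (hu : Desc G r 1 u w)
    (hv : Desc G r 1 v w) : u = v := by
  have hu' := hu.adj
  have hv' := hv.adj
  obtain ⟨d, hd, hu, hw, -⟩ := hu
  obtain ⟨d', hd', hv, hw', -⟩ := hv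
  obtain rfl : d = d' := by have := hw.unique hw'; omega
  exact hG.parent_unique d (by omega) w u v hw hu'.symm hv'.symm hu hv

theorem Layered.desc_unique (hG : Layered G r) {a : ℕ} {u v w : V} (hu : Desc G r a u w)
    (hv : Desc G r a v w) : u = v := by
  induction a generalizing w with
  | zero => rw [hu.eq, hv.eq]
  | succ a ih =>
    obtain ⟨x, hux, hxw⟩ := hG.desc_add hu
    obtain ⟨y, hvy, hyw⟩ := hG.desc_add hv
    obtain rfl := hG.child_unique hxw hyw
    exact ih hux hvy

theorem Layered.not_wk_lev (hG : Layered G r) {d : ℕ} {u v : V} (hu : Lev G r d u)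
    (hv : Lev G r d v) (huv : G.Adj u v) : d = 0 := by
  obtain ⟨d', hd', hu'⟩ := hG.exists_lev u
  obtain rfl := hu.unique hu'
  cases d with
  | zero => rfl
  | succ d => exact absurd hv (hG.not_adj d (by omega) u v huv hu)

theorem Layered.adj_cases (hG : Layered G r) {u v : V} (h : G.Adj u v) :
    (Core G r u ∧ Core G r v) ∨ Desc G r 1 u v ∨ Desc G r 1 v u := by
  obtain ⟨d, hd, hu⟩ := hG.exists_lev u
  obtain ⟨e, he, hv⟩ := hG.exists_lev v
  have h1 := hu.le_add hv (wk_one.2 h)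
  have h2 := hv.le_add hu (wk_one.2 h.symm)
  have h3 : e = d ∨ e = d + 1 ∨ d = e + 1 := by omega
  rcases h3 with rfl | rfl | rfl
  · obtain rfl := hG.not_wk_lev hu hv h
    exact Or.inl ⟨lev_zero_iff.1 hu, lev_zero_iff.1 hv⟩
  · exact Or.inr (Or.inl ⟨d, he, hu, hv, wk_one.2 h⟩)
  · exact Or.inr (Or.inr ⟨e, hd, hv, hu, wk_one.2 h.symm⟩)

end Definable

section Isom

variable {V W : Type} {G : SimpleGraph V} {H : SimpleGraph W} {r q : ℕ}

/-- The trees of descendants of `v` in `G` and of `v'` in `H` are isomorphic. -/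
inductive Isom (G : SimpleGraph V) (H : SimpleGraph W) (r : ℕ) : V → W → Prop
  | intro (v : V) (w : W) (g : V → W) (mapsTo : ∀ c, Desc G r 1 v c → Desc H r 1 w (g c))
      (injOn : ∀ c d, Desc G r 1 v c → Desc G r 1 v d → g c = g d → c = d)
      (surjOn : ∀ c', Desc H r 1 w c' → ∃ c, Desc G r 1 v c ∧ g c = c')
      (isom : ∀ c, Desc G r 1 v c → Isom G H r c (g c)) : Isom G H r v w

/-- Duplicator's answers to the children of `v` give a bijection with the children of `v'`. -/
theorem EF.isom_of_children [Nonempty W] (hq : 6 * r ≤ 2 ^ q) {j : ℕ} (hj : q + 5 ≤ j)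
    {C : Finset V} {v : V} {v' : W} (hC : ∀ c, c ∈ C ↔ Desc G r 1 v c) {S : Set (V × W)}
    (h : EF G H (j + C.card + 1) S) (hv : (v, v') ∈ S)
    (hS : ∀ S', S ⊆ S' → EF G H j S' → ∀ c c', (c, c') ∈ S' → Desc G r 1 v c →
      Desc H r 1 v' c' → Isom G H r c c') : Isom G H r v v' := by
  rw [add_right_comm] at h
  obtain ⟨g, hg⟩ := h.pin
  have hv' := Set.mem_union_left {p : V × W | p.1 ∈ C ∧ p.2 = g p.1} hv
  have hc : ∀ c, Desc G r 1 v c → (c, g c) ∈ S ∪ {p : V × W | p.1 ∈ C ∧ p.2 = g p.1} :=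
    fun c hc => Or.inr ⟨(hC c).2 hc, rfl⟩
  have hm : ∀ c, Desc G r 1 v c → Desc H r 1 v' (g c) := fun c h1 =>
    (EF.desc_iff hq (hg.mono (by omega)) hv' (hc c h1)).1 h1
  refine ⟨v, v', g, hm, fun c d h1 h2 h3 => (hg.eq_iff (hc c h1) (hc d h2)).2 h3, ?_,
    fun c h1 => hS _ Set.subset_union_left hg.pred c (g c) (hc c h1) h1 (hm c h1)⟩
  intro c' hc'
  obtain ⟨c, h1⟩ := hg.2 c'
  have hvc := (EF.desc_iff hq (h1.mono (by omega)) (Or.inr hv') (Or.inl rfl)).2 hc'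
  exact ⟨c, hvc, (h1.eq_iff (Or.inr (hc c hvc)) (Or.inl rfl)).1 rfl⟩

/-- The number of descendants of `v`. -/
noncomputable def descCard (G : SimpleGraph V) (r : ℕ) (v : V) : ℕ :=
  {u | ∃ e, Desc G r e v u}.ncard

theorem descCard_pos [Finite V] (hG : Layered G r) (v : V) : 0 < descCard G r v :=
  (Set.ncard_pos (Set.toFinite _)).2 ⟨v, 0, hG.desc_refl v⟩

theorem Desc.descCard_le [Finite V] {e : ℕ} {v u : V} (h : Desc G r e v u) :
    descCard G r u ≤ descCard G r v :=
  Set.ncard_le_ncard (fun _ ⟨a, ha⟩ => ⟨e + a, h.trans ha⟩) (Set.toFinite _)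

theorem Layered.descCard_add_le [Finite V] (hG : Layered G r) {v c d : V}
    (hc : Desc G r 1 v c) (hd : Desc G r 1 v d) (hcd : c ≠ d) :
    descCard G r c + descCard G r d ≤ descCard G r v := by
  rw [descCard, descCard, ← Set.ncard_union_eq _ (Set.toFinite _) (Set.toFinite _)]
  · refine Set.ncard_le_ncard ?_ (Set.toFinite _)
    rintro u (⟨a, ha⟩ | ⟨a, ha⟩)
    · exact ⟨1 + a, hc.trans ha⟩
    · exact ⟨1 + a, hd.trans ha⟩
  · rw [Set.disjoint_left]
    rintro u ⟨a, ha⟩ ⟨b, hb⟩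
    apply hcd
    have hab : a = b := by
      obtain ⟨k, -, hk1, hk2, -⟩ := hc.trans ha
      obtain ⟨l, -, hl1, hl2, -⟩ := hd.trans hb
      have := hk1.unique hl1
      have := hk2.unique hl2
      omega
    subst hab
    exact hG.desc_unique ha hb

/-- If the high-degree vertices in `X` are pebbled and each of them below `v` already has the
same tree of descendants as its partner, then few more rounds suffice for `v`. -/
theorem EF.isom_of_low_degree [Finite V] [Nonempty W] (hG : Layered G r) (hH : Layered H r)
    (hq : 6 * r ≤ 2 ^ q) {X : Finset V} {π : V → W} {S₀ : Set (V × W)}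
    (hX : ∀ x ∈ X, (x, π x) ∈ S₀) {z : V} {D₀ : ℕ}
    (hD : ∀ v e, Desc G r e z v → v ∉ X → {c | Desc G r 1 v c}.ncard ≤ D₀)
    (s : ℕ) {S : Set (V × W)} (hS : S₀ ⊆ S) {v : V} {v' : W} (hv : (v, v') ∈ S)
    (h : EF G H (s * (D₀ + 3) + q + 10) S) {e : ℕ} (hz : Desc G r e z v)
    (hs : descCard G r v < 2 ^ s)
    (hi : ∀ x ∈ X, ∀ e' ≥ e, Desc G r e' z x → Isom G H r x (π x)) : Isom G H r v v' := by
  induction s generalizing S v v' e with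
  | zero => exact absurd (descCard_pos hG v) (by simpa using hs)
  | succ s ih =>
    rcases lt_or_ge (descCard G r v) (2 ^ s) with hvs | hvs
    · exact ih hS hv (h.mono (by rw [Nat.succ_mul]; omega)) hz hvs hi
    have hK : (s + 1) * (D₀ + 3) + q + 10 = (s * (D₀ + 3) + q + 10) + D₀ + 1 + 1 + 1 := by ring
    rw [hK] at h
    set j := s * (D₀ + 3) + q + 10 with hj
    obtain ⟨i₀, ⟨u, hvu, hu⟩, hmax⟩ : ∃ i₀, (∃ u, Desc G r i₀ v u ∧ 2 ^ s ≤ descCard G r u) ∧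
        ∀ i > i₀, ¬ ∃ u, Desc G r i v u ∧ 2 ^ s ≤ descCard G r u := by
      classical
      have hb : ∃ i ≤ r, ∃ u, Desc G r i v u ∧ 2 ^ s ≤ descCard G r u :=
        ⟨0, Nat.zero_le r, v, hG.desc_refl v, hvs⟩
      obtain ⟨i, hir, hi⟩ := hb
      refine ⟨Nat.findGreatest (fun i => ∃ u, Desc G r i v u ∧ 2 ^ s ≤ descCard G r u) r,
        Nat.findGreatest_spec (P := fun i => ∃ u, Desc G r i v u ∧ 2 ^ s ≤ descCard G r u)
          hir hi, fun i hi' hex => ?_⟩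
      have hir' : i ≤ r := by
        obtain ⟨u, ⟨d, hd, -⟩, -⟩ := hex
        omega
      exact Nat.findGreatest_is_greatest hi' hir' hex
    obtain ⟨u', hu'⟩ := h.1 u
    have hvu' := (EF.desc_iff hq (hu'.mono (by omega)) (Or.inr hv) (Or.inl rfl)).1 hvu
    have descend : ∀ i w w', Desc G r i w u → (∃ a, Desc G r a v w) → Desc H r i w' u' →
        (∀ c, Desc G r 1 w c → descCard G r c < 2 ^ s ∨
          ∃ i', Desc G r i' c u ∧ ∀ c', Desc H r i' c' u' → Isom G H r c c') →
        Isom G H r w w' := by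
      rintro i w w' hwu ⟨a, hvw⟩ hwu' hch
      obtain ⟨w'', hw⟩ := hu'.1 w
      have hu₂ : (u, u') ∈ insert (w, w'') (insert (u, u') S) := Or.inr (Or.inl rfl)
      have hS₂ : S₀ ⊆ insert (w, w'') (insert (u, u') S) := fun p hp => Or.inr (Or.inr (hS hp))
      obtain rfl : w'' = w' := hH.desc_unique
        ((EF.desc_iff hq (hw.mono (by omega)) (Or.inl rfl) hu₂).1 hwu) hwu'
      by_cases hwX : w ∈ X
      · obtain rfl := (hw.eq_iff (hS₂ (hX w hwX)) (Or.inl rfl)).1 rfl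
        exact hi w hwX (e + a) (by omega) (hz.trans hvw)
      · have hfin : {c | Desc G r 1 w c}.Finite := Set.toFinite _
        have hcard : hfin.toFinset.card ≤ D₀ := by
          rw [← Set.ncard_eq_toFinset_card]
          exact hD w (e + a) (hz.trans hvw) hwX
        refine EF.isom_of_children hq (j := j) (by omega) (C := hfin.toFinset) (by simp)
          (hw.mono (by omega)) (Or.inl rfl) fun S' hS' h' c c' hcc' hwc _ => ?_
        rcases hch c hwc with hlt | ⟨i', hcu, hc⟩
        · exact ih (hS₂.trans hS') hcc' h' (hz.trans (hvw.trans hwc)) hlt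
            fun x hx e' he' => hi x hx e' (by omega)
        · exact hc c' ((EF.desc_iff hq (h'.mono (by omega)) hcc' (hS' hu₂)).1 hcu)
    have claim : ∀ i w w', Desc G r i w u → (∃ a, Desc G r a v w) → Desc H r i w' u' →
        Isom G H r w w' := by
      intro i
      induction i with
      | zero =>
        rintro w w' hwu ⟨a, hvw⟩ hwu'
        refine descend 0 w w' hwu ⟨a, hvw⟩ hwu' fun c hwc => Or.inl ?_
        obtain rfl := hwu.eq
        by_contra hlt
        exact hmax (i₀ + 1) (Nat.lt_succ_self _) ⟨c, hvu.trans hwc, not_lt.1 hlt⟩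
      | succ i ihi =>
        rintro w w' hwu ⟨a, hvw⟩ hwu'
        refine descend (i + 1) w w' hwu ⟨a, hvw⟩ hwu' fun c hwc => ?_
        rw [add_comm] at hwu
        obtain ⟨y, hwy, hyu⟩ := hG.desc_add hwu
        rcases eq_or_ne c y with rfl | hcy
        · exact Or.inr ⟨i, hyu, fun c' hc' => ihi c c' hyu ⟨a + 1, hvw.trans hwc⟩ hc'⟩
        · left
          have h1 := hG.descCard_add_le hwc hwy hcy
          have h2 := hyu.descCard_le
          have h3 := hvw.descCard_le
          rw [pow_succ] at hs
          omega
    exact claim i₀ v v' hvu ⟨0, hG.desc_refl v⟩ hvu'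

theorem EF.isom_of_pebbled [Finite V] [Nonempty W] (hG : Layered G r) (hH : Layered H r)
    (hq : 6 * r ≤ 2 ^ q) {X : Finset V} {π : V → W} {S₀ : Set (V × W)}
    (hX : ∀ x ∈ X, (x, π x) ∈ S₀) {z : V} {D₀ D₁ s : ℕ}
    (hD : ∀ v e, Desc G r e z v → v ∉ X → {c | Desc G r 1 v c}.ncard ≤ D₀)
    (hD₁ : ∀ v, {c | Desc G r 1 v c}.ncard ≤ D₁) (hs : descCard G r z < 2 ^ s)
    (h : EF G H (s * (D₀ + 3) + q + 10 + D₁ + 1) S₀) :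
    ∀ x ∈ X, ∀ e, Desc G r e z x → Isom G H r x (π x) := by
  suffices ∀ k, ∀ x ∈ X, ∀ e, r - e ≤ k → Desc G r e z x → Isom G H r x (π x) from
    fun x hx e => this (r - e) x hx e le_rfl
  intro k
  induction k using Nat.strong_induction_on with
  | _ k ih =>
    intro x hx e hk hzx
    have hfin : {c | Desc G r 1 x c}.Finite := Set.toFinite _
    have hcard : hfin.toFinset.card ≤ D₁ := by
      rw [← Set.ncard_eq_toFinset_card]
      exact hD₁ x
    refine EF.isom_of_children hq (j := s * (D₀ + 3) + q + 10) (by omega) (C := hfin.toFinset)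
      (by simp) (h.mono (by omega)) (hX x hx) fun S' hS' h' c c' hcc' hwc _ => ?_
    have hzc := hzx.trans hwc
    refine EF.isom_of_low_degree hG hH hq hX hD s hS' hcc' h' hzc
      (hzc.descCard_le.trans_lt hs) fun y hy e' he' hzy => ?_
    have : e' ≤ r := by
      obtain ⟨d, hd, -⟩ := hzy
      omega
    exact ih (r - e') (by omega) y hy e' le_rfl hzy

end Isom

section Glue

variable {V W : Type} {G : SimpleGraph V} {H : SimpleGraph W} {r q : ℕ}

theorem Layered.exists_child (hG : Layered G r) {d : ℕ} {v : V} (h : Lev G r (d + 1) v) :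
    ∃ u, Desc G r 1 u v ∧ Lev G r d u := by
  obtain ⟨e, he, hv⟩ := hG.exists_lev v
  obtain rfl := h.unique hv
  obtain ⟨u, huv, hu⟩ := h.exists_parent
  exact ⟨u, ⟨d, he, hu, h, wk_one.2 huv⟩, hu⟩

theorem Desc.lev {d : ℕ} {u v : V} (h : Desc G r 1 u v) (hu : Lev G r d u) :
    Lev G r (d + 1) v := by
  obtain ⟨e, -, hue, hv, -⟩ := h
  rwa [hu.unique hue]

/-- An isomorphism of the cores extends to an isomorphism of the graphs if the attached trees
are isomorphic. -/
theorem nonempty_iso_of_core (hG : Layered G r) (hH : Layered H r) {f : V → W}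
    (hf : ∀ z, Core G r z → Core H r (f z))
    (hinj : ∀ x y, Core G r x → Core G r y → f x = f y → x = y)
    (hsurj : ∀ z', Core H r z' → ∃ z, Core G r z ∧ f z = z')
    (hadj : ∀ x y, Core G r x → Core G r y → (G.Adj x y ↔ H.Adj (f x) (f y)))
    (hisom : ∀ z, Core G r z → Isom G H r z (f z)) : Nonempty (G ≃g H) := by
  classical
  have hex : ∀ v v', ∃ g : V → W, Isom G H r v v' →
      (∀ c, Desc G r 1 v c → Desc H r 1 v' (g c)) ∧
      (∀ c d, Desc G r 1 v c → Desc G r 1 v d → g c = g d → c = d) ∧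
      (∀ c', Desc H r 1 v' c' → ∃ c, Desc G r 1 v c ∧ g c = c') ∧
      ∀ c, Desc G r 1 v c → Isom G H r c (g c) := by
    intro v v'
    by_cases h : Isom G H r v v'
    · obtain ⟨_, _, g, h1, h2, h3, h4⟩ := h
      exact ⟨g, fun _ => ⟨h1, h2, h3, h4⟩⟩
    · exact ⟨fun _ => v', fun h' => absurd h' h⟩
  choose g hg using hex
  choose lev hlev_le hlev using hG.exists_lev
  have hpar : ∀ v, ∃ u, ∀ d, Lev G r (d + 1) v → Desc G r 1 u v ∧ Lev G r d u := by
    intro v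
    rcases Nat.eq_zero_or_pos (lev v) with h0 | h0
    · exact ⟨v, fun d hd => absurd (hd.unique (hlev v)) (by omega)⟩
    · obtain ⟨d, hd⟩ := Nat.exists_eq_succ_of_ne_zero h0.ne'
      obtain ⟨u, hu⟩ := hG.exists_child (hd ▸ hlev v)
      refine ⟨u, fun d' hd' => ?_⟩
      obtain rfl : d' = d := by have := hd'.unique (hlev v); omega
      exact hu
  choose par hpar using hpar
  let φ : ℕ → V → W := fun d => Nat.rec f (fun _ φ v => g (par v) (φ (par v)) v) d
  have hφ : ∀ d v, φ (d + 1) v = g (par v) (φ d (par v)) v := fun d v => rfl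
  have hφ_isom : ∀ d v, Lev G r d v → Lev H r d (φ d v) ∧ Isom G H r v (φ d v) := by
    intro d
    induction d with
    | zero => exact fun v hv => ⟨lev_zero_iff.2 (hf v (lev_zero_iff.1 hv)),
        hisom v (lev_zero_iff.1 hv)⟩
    | succ d ih =>
      intro v hv
      obtain ⟨h1, h2⟩ := hpar v d hv
      obtain ⟨h3, h4⟩ := ih _ h2
      obtain ⟨g1, -, -, g4⟩ := hg _ _ h4
      exact ⟨(g1 v h1).lev h3, g4 v h1⟩
  have hφ_child : ∀ d u v, Lev G r d u → Desc G r 1 u v →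
      φ (d + 1) v = g u (φ d u) v := by
    intro d u v hu huv
    rw [hφ, hG.child_unique (hpar v d (huv.lev hu)).1 huv]
  have hφ_inj : ∀ d v w, Lev G r d v → Lev G r d w → φ d v = φ d w → v = w := by
    intro d
    induction d with
    | zero => exact fun v w hv hw h => hinj v w (lev_zero_iff.1 hv) (lev_zero_iff.1 hw) h
    | succ d ih =>
      intro v w hv hw h
      obtain ⟨hv1, hv2⟩ := hpar v d hv
      obtain ⟨hw1, hw2⟩ := hpar w d hw
      obtain ⟨gv1, gv2, -, -⟩ := hg _ _ (hφ_isom d _ hv2).2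
      obtain ⟨gw1, -, -, -⟩ := hg _ _ (hφ_isom d _ hw2).2
      have h1 := gv1 v hv1
      have h2 := gw1 w hw1
      rw [← hφ, h] at h1
      rw [← hφ] at h2
      have hp := ih _ _ hv2 hw2 (hH.child_unique h1 h2)
      rw [hφ, hφ, ← hp] at h
      exact gv2 v w hv1 (hp ▸ hw1) h
  have hφ_surj : ∀ d v', Lev H r d v' → ∃ v, Lev G r d v ∧ φ d v = v' := by
    intro d
    induction d with
    | zero =>
      intro v' hv'
      obtain ⟨v, hv, rfl⟩ := hsurj v' (lev_zero_iff.1 hv')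
      exact ⟨v, lev_zero_iff.2 hv, rfl⟩
    | succ d ih =>
      intro v' hv'
      obtain ⟨u', huv', hu'⟩ := hH.exists_child hv'
      obtain ⟨u, hu, rfl⟩ := ih u' hu'
      obtain ⟨-, -, g3, -⟩ := hg _ _ (hφ_isom d u hu).2
      obtain ⟨v, huv, rfl⟩ := g3 v' huv'
      exact ⟨v, huv.lev hu, hφ_child d u v hu huv⟩
  let Φ : V → W := fun v => φ (lev v) v
  have hΦ : ∀ d v, Lev G r d v → Φ v = φ d v := fun d v hv => by
    rw [hv.unique (hlev v)]
  have hΦ_lev : ∀ d v, Lev G r d v ↔ Lev H r d (Φ v) := by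
    have h1 : ∀ v, Lev H r (lev v) (Φ v) := fun v => (hφ_isom _ v (hlev v)).1
    refine fun d v => ⟨fun h => ?_, fun h => ?_⟩
    · rw [h.unique (hlev v)]
      exact h1 v
    · rw [h.unique (h1 v)]
      exact hlev v
  have hΦ_inj : Function.Injective Φ := by
    intro v w h
    have h1 := (hΦ_lev (lev v) w).2 (h ▸ (hΦ_lev _ v).1 (hlev v))
    refine hφ_inj _ v w (hlev v) h1 ?_
    rw [← hΦ _ _ h1]
    exact h
  have hΦ_surj : Function.Surjective Φ := by
    intro v'
    obtain ⟨d, -, hd⟩ := hH.exists_lev v'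
    obtain ⟨v, hv, rfl⟩ := hφ_surj d v' hd
    exact ⟨v, hΦ d v hv⟩
  have hΦ_child : ∀ u v, Desc G r 1 u v ↔ Desc H r 1 (Φ u) (Φ v) := by
    intro u v
    obtain ⟨g1, -, g3, -⟩ := hg _ _ (hφ_isom _ u (hlev u)).2
    refine ⟨fun h => ?_, fun h => ?_⟩
    · have := g1 v h
      rwa [← hφ_child _ u v (hlev u) h, ← hΦ _ v (h.lev (hlev u))] at this
    · obtain ⟨w, hw, hwv⟩ := g3 _ h
      rw [← hφ_child _ u w (hlev u) hw, ← hΦ _ w (hw.lev (hlev u))] at hwv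
      rwa [← hΦ_inj hwv]
  have hΦ_core : ∀ u, Core G r u → Φ u = f u := fun u hu => hΦ 0 u (lev_zero_iff.2 hu)
  refine ⟨⟨Equiv.ofBijective Φ ⟨hΦ_inj, hΦ_surj⟩, ?_⟩⟩
  intro u v
  change H.Adj (Φ u) (Φ v) ↔ G.Adj u v
  constructor
  · intro h
    rcases hH.adj_cases h with ⟨hu, hv⟩ | h1 | h1
    · rw [← lev_zero_iff, ← hΦ_lev, lev_zero_iff] at hu hv
      rw [hΦ_core u hu, hΦ_core v hv] at h
      exact (hadj u v hu hv).2 h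
    · exact ((hΦ_child u v).2 h1).adj
    · exact ((hΦ_child v u).2 h1).adj.symm
  · intro h
    rcases hG.adj_cases h with ⟨hu, hv⟩ | h1 | h1
    · rw [hΦ_core u hu, hΦ_core v hv]
      exact (hadj u v hu hv).1 h
    · exact ((hΦ_child u v).1 h1).adj
    · exact ((hΦ_child v u).1 h1).adj.symm

/-- The game criterion for graphs whose vertices are determined by keys up to small trees with
few vertices of high degree. -/
theorem EF.nonempty_iso [Finite V] (hG : Layered G r) (hq : 6 * r ≤ 2 ^ q)
    {X : V → Finset V} {D₀ D₁ M s : ℕ} (hX : ∀ z, z ∈ X z ∧ (X z).card ≤ M)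
    (hD : ∀ z v e, Desc G r e z v → v ∉ X z → {c | Desc G r 1 v c}.ncard ≤ D₀)
    (hD₁ : ∀ v, {c | Desc G r 1 v c}.ncard ≤ D₁) (hs : ∀ z, descCard G r z < 2 ^ s)
    (h : EF G H (s * (D₀ + 3) + q + 10 + D₁ + 1 + M + 1) ∅) : Nonempty (G ≃g H) := by
  have hH : Layered H r := hG.transfer hq (h.mono (by omega))
  choose f hf using h.1
  have hcore : ∀ z, Core G r z ↔ Core H r (f z) := fun z =>
    ((hf z).mono (by omega)).core_iff hq (Or.inl rfl)
  have hkey : ∀ z c, Key G r c z ↔ Key H r c (f z) := fun z c =>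
    ((hf z).mono (by omega)).key_iff hq (Or.inl rfl) c
  refine nonempty_iso_of_core (f := f) hG hH (fun z hz => (hcore z).1 hz) ?_ ?_ ?_ ?_
  · rintro x y ⟨c, hc⟩ - hxy
    exact hG.key_inj c x y hc ((hkey y c).2 (hxy ▸ (hkey x c).1 hc))
  · rintro z' ⟨c, hc⟩
    obtain ⟨z, hz⟩ := h.2 z'
    have h1 := ((hz.mono (by omega)).key_iff hq (Or.inl rfl) c).2 hc
    exact ⟨z, ⟨c, h1⟩, hH.key_inj c _ _ ((hkey z c).1 h1) hc⟩
  · rintro x y ⟨c, hc⟩ ⟨d, hd⟩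
    have h1 : (∃ x y, Key G r c x ∧ Key G r d y ∧ G.Adj x y) ↔
        ∃ x y, Key H r c x ∧ Key H r d y ∧ H.Adj x y := by
      refine (h.mono (l := q + 4 + 1 + 1) (by omega)).ex_congr fun x x' h1 =>
        h1.ex_congr fun y y' h2 => ?_
      exact and_congr (h2.key_iff hq (Or.inr (Or.inl rfl)) c) <|
        and_congr (h2.key_iff hq (Or.inl rfl) d) (h2.adj_iff (Or.inr (Or.inl rfl)) (Or.inl rfl))
    constructor
    · intro hxy
      obtain ⟨x', y', hx', hy', hxy'⟩ := h1.1 ⟨x, y, hc, hd, hxy⟩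
      rwa [hH.key_inj c _ _ ((hkey x c).1 hc) hx', hH.key_inj d _ _ ((hkey y d).1 hd) hy']
    · intro hxy
      obtain ⟨x', y', hx', hy', hxy'⟩ := h1.2 ⟨f x, f y, (hkey x c).1 hc, (hkey y d).1 hd, hxy⟩
      rwa [hG.key_inj c _ _ hc hx', hG.key_inj d _ _ hd hy']
  · intro z _
    have : Nonempty W := ⟨f z⟩
    obtain ⟨π, hπ⟩ := ((hf z).mono (l := s * (D₀ + 3) + q + 10 + D₁ + 1 + (X z).card)
      (by have := (hX z).2; omega)).pin
    have h1 := EF.isom_of_pebbled hG hH hq (X := X z) (π := π) (fun x hx => Or.inr ⟨hx, rfl⟩)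
      (hD z) hD₁ (hs z) hπ z (hX z).1 0 (hG.desc_refl z)
    have h2 : f z = π z := (hπ.eq_iff (a := z) (b := z) (a' := f z) (b' := π z)
      (Or.inl (Or.inl rfl)) (Or.inr ⟨(hX z).1, rfl⟩)).1 rfl
    rwa [← h2] at h1

end Glue

section TreeMetric

variable {V : Type} {T : SimpleGraph V}

theorem dist_le_of_adj {p : ℕ → V} {d : ℕ} (hT : T.Connected)
    (hp : ∀ i < d, T.Adj (p i) (p (i + 1))) {i : ℕ} (k : ℕ) (hk : i + k ≤ d) :
    T.dist (p i) (p (i + k)) ≤ k := by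
  induction k with
  | zero => simp
  | succ k ih =>
    have h1 := hT.dist_triangle (u := p i) (v := p (i + k)) (w := p (i + (k + 1)))
    have h2 := SimpleGraph.dist_eq_one_iff_adj.2 (hp (i + k) (by omega))
    have h3 := ih (by omega)
    rw [add_assoc] at h2
    omega

theorem Wk.dist_le {d : ℕ} {x y : V} (hT : T.Connected) (h : Wk T d x y) : T.dist x y ≤ d := by
  obtain ⟨p, rfl, rfl, h, -⟩ := h
  simpa using dist_le_of_adj hT h (i := 0) d (by omega)

theorem wk_dist (hT : T.Connected) (x y : V) : Wk T (T.dist x y) x y := by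
  obtain ⟨p, hp⟩ := hT.exists_walk_length_eq_dist x y
  exact ⟨p.getVert, p.getVert_zero, by rw [← hp, p.getVert_length],
    fun i hi => p.adj_getVert_succ (by omega), fun _ _ => trivial⟩

theorem exists_dist_eq (hT : T.Connected) {x y : V} {i j : ℕ} (h : T.dist x y = i + j) :
    ∃ z, T.dist x z = i ∧ T.dist z y = j := by
  obtain ⟨z, hxz, hzy⟩ := wk_add.1 (h ▸ wk_dist hT x y)
  have h1 := hxz.dist_le hT
  have h2 := hzy.dist_le hT
  have h3 := hT.dist_triangle (u := x) (v := z) (w := y)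
  exact ⟨z, by omega, by omega⟩

/-- In a tree, each vertex has at most one neighbour closer to `z`. -/
theorem eq_of_adj_of_dist (hT : T.IsTree) {z v u u' : V} (hu : T.Adj u v) (hu' : T.Adj u' v)
    (h : T.dist z v = T.dist z u + 1) (h' : T.dist z v = T.dist z u' + 1) : u = u' := by
  obtain ⟨p, hp⟩ := hT.connected.exists_walk_length_eq_dist z u
  obtain ⟨p', hp'⟩ := hT.connected.exists_walk_length_eq_dist z u'
  have h1 : (p.concat hu).IsPath :=
    SimpleGraph.Walk.isPath_of_length_eq_dist _ (by rw [SimpleGraph.Walk.length_concat, hp, h])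
  have h2 : (p'.concat hu').IsPath :=
    SimpleGraph.Walk.isPath_of_length_eq_dist _ (by rw [SimpleGraph.Walk.length_concat, hp', h'])
  have h3 := congrArg Subtype.val ((hT.isAcyclic.subsingleton_path z v).elim ⟨_, h1⟩ ⟨_, h2⟩)
  have h4 := congrArg SimpleGraph.Walk.penultimate h3
  simpa using h4

/-- The two sides of the edge `u v` of a tree are separated by it. -/
theorem dist_eq_of_adj (hT : T.IsTree) {u v w z : V} (h : T.Adj u v)
    (hw : T.dist w v = T.dist w u + 1) (hz : T.dist z u = T.dist z v + 1) :
    T.dist z w = T.dist z v + 1 + T.dist u w := by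
  obtain ⟨k, hk⟩ : ∃ k, T.dist z v = k := ⟨_, rfl⟩
  induction k generalizing z with
  | zero =>
    obtain rfl := hT.connected.dist_eq_zero_iff.1 hk
    rw [hk, T.dist_comm (u := z) (v := w), hw, T.dist_comm (u := w) (v := u)]
    omega
  | succ k ih =>
    obtain ⟨z', hzz', hz'v⟩ := exists_dist_eq hT.connected (i := 1) (j := k) (by rw [hk]; omega)
    have h1 := hT.connected.dist_triangle (u := z) (v := z') (w := u)
    have h2 := hT.connected.dist_triangle (u := z') (v := v) (w := u)
    have h3 := SimpleGraph.dist_eq_one_iff_adj.2 h.symm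
    have hz'u : T.dist z' u = k + 1 := by omega
    have h4 := ih (z := z') (by omega) hz'v
    obtain ⟨y, hz'y, hyu⟩ := exists_dist_eq hT.connected (i := 1) (j := k)
      (by rw [hz'u, add_comm])
    have h5 := hT.connected.dist_triangle (u := y) (v := u) (w := w)
    have h6 := hT.connected.dist_triangle (u := z') (v := y) (w := w)
    have h7 := SimpleGraph.dist_eq_one_iff_adj.1 hzz'
    rcases hT.dist_eq_dist_add_one_of_adj w h7 with h8 | h8
    · rw [T.dist_comm (u := w) (v := z), T.dist_comm (u := w) (v := z')] at h8
      omega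
    · have h9 : z = y := by
        refine eq_of_adj_of_dist hT h7 (SimpleGraph.dist_eq_one_iff_adj.1 hz'y).symm h8 ?_
        rw [T.dist_comm (u := w) (v := z'), T.dist_comm (u := w) (v := y)]
        omega
      subst h9
      omega

/-- A vertex of the geodesic from `u` to `w` lies on the geodesic from any `z` to `u` or `w`. -/
theorem between_or (hT : T.IsTree) {u x w : V} (h : T.dist u w = T.dist u x + T.dist x w) (z : V) :
    T.dist u z = T.dist u x + T.dist x z ∨ T.dist w z = T.dist w x + T.dist x z := by
  rcases Nat.eq_zero_or_pos (T.dist x z) with h0 | h0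
  · obtain rfl := hT.connected.dist_eq_zero_iff.1 h0
    simp
  · obtain ⟨x', hxx', hx'z⟩ := exists_dist_eq hT.connected (i := 1) (j := T.dist x z - 1)
      (x := x) (y := z) (by omega)
    have hadj := SimpleGraph.dist_eq_one_iff_adj.1 hxx'
    have h1 : ∀ a, T.dist a x' = T.dist a x + 1 → T.dist a z = T.dist a x + T.dist x z := by
      intro a ha
      have := dist_eq_of_adj hT hadj.symm (w := z) (z := a)
        (by rw [T.dist_comm (u := z) (v := x), T.dist_comm (u := z) (v := x')]; omega) ha
      omega
    rcases hT.dist_eq_dist_add_one_of_adj u hadj with h2 | h2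
    · rcases hT.dist_eq_dist_add_one_of_adj w hadj with h3 | h3
      · have := hT.connected.dist_triangle (u := u) (v := x') (w := w)
        rw [T.dist_comm (u := w) (v := x), T.dist_comm (u := w) (v := x')] at h3
        omega
      · exact Or.inr (h1 w h3)
    · exact Or.inl (h1 u h2)

theorem between_unique (hT : T.IsTree) {u x y w : V} (hx : T.dist u w = T.dist u x + T.dist x w)
    (hy : T.dist u w = T.dist u y + T.dist y w) (hxy : T.dist u x = T.dist u y) : x = y := by
  rw [← hT.connected.dist_eq_zero_iff]
  rcases between_or hT hx y with h | h
  · omega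
  · rw [T.dist_comm (u := w) (v := y), T.dist_comm (u := w) (v := x)] at h
    omega

end TreeMetric

section TreeCore

variable {V : Type} {T : SimpleGraph V} {r : ℕ}

theorem core_of_between (hT : T.Connected) {a z g : V} (h : T.dist a g = T.dist a z + T.dist z g)
    (ha : r ≤ T.dist a z) (hg : 5 * r ≤ T.dist z g) : Core T r z := by
  obtain ⟨u, hau, huz⟩ := exists_dist_eq hT (x := a) (y := z) (i := T.dist a z - r) (j := r)
    (by omega)
  obtain ⟨w, hzw, hwg⟩ := exists_dist_eq hT (x := z) (y := g) (i := 5 * r)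
    (j := T.dist z g - 5 * r) (by omega)
  have h1 := hT.dist_triangle (u := a) (v := u) (w := g)
  have h2 := hT.dist_triangle (u := u) (v := w) (w := g)
  obtain ⟨p, rfl, hpr, hp, -⟩ := huz ▸ wk_dist hT u z
  obtain ⟨p', hp0, rfl, hp', -⟩ := hzw ▸ wk_dist hT z w
  refine ⟨fun i => NearLeaf T (if i ≤ r then p i else p' (i - r)), p 0, p' (5 * r),
    ⟨p, rfl, hpr, hp, fun i hi => by simp [hi]⟩, ⟨p', hp0, rfl, hp', fun i hi => ?_⟩,
    fun e he hwk => ?_⟩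
  · rcases Nat.eq_zero_or_pos i with rfl | hi
    · simp [hp0, hpr]
    · simp [hi.ne']
  · have := hwk.dist_le hT
    omega

theorem Key.exists_geodesic (hT : T.Connected) {c : ℕ → Prop} {x : V} (h : Key T r c x) :
    ∃ p : ℕ → V, p r = x ∧ (∀ i k, i + k ≤ 6 * r → T.dist (p i) (p (i + k)) = k) ∧
      ∀ i ≤ 6 * r, (NearLeaf T (p i) ↔ c i) := by
  obtain ⟨u, w, ⟨p, hp0, hpr, hp, hpc⟩, ⟨p', hp'0, hp'r, hp', hp'c⟩, hmin⟩ := h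
  have h1 : Chain T (fun i v => (NearLeaf T v ↔ c i) ∧ (i = r → v = x)) (r + 5 * r) u w :=
    chain_add.2 ⟨x, ⟨p, hp0, hpr, hp, fun i hi => ⟨hpc i hi, fun h => h ▸ hpr⟩⟩,
      ⟨p', hp'0, hp'r, hp', fun i hi => ⟨hp'c i hi, fun h => by
        obtain rfl : i = 0 := by omega
        exact hp'0⟩⟩⟩
  obtain ⟨g, rfl, rfl, hg, hgc⟩ := h1
  refine ⟨g, (hgc r (by omega)).2 rfl, fun i k hik => ?_, fun i hi => (hgc i (by omega)).1⟩
  have h2 := dist_le_of_adj hT hg (i := 0) i (by omega)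
  have h3 := dist_le_of_adj hT hg (i := i) k (by omega)
  have h4 := dist_le_of_adj hT hg (i := i + k) (6 * r - (i + k)) (by omega)
  have h5 : 6 * r ≤ T.dist (g 0) (g (r + 5 * r)) := by
    by_contra h
    exact hmin _ (not_le.1 h) (wk_dist hT _ _)
  have h6 := hT.dist_triangle (u := g 0) (v := g i) (w := g (r + 5 * r))
  have h7 := hT.dist_triangle (u := g i) (v := g (i + k)) (w := g (r + 5 * r))
  rw [show i + k + (6 * r - (i + k)) = r + 5 * r by omega] at h4
  rw [zero_add] at h2
  omega

theorem Core.exists_far (hT : T.IsTree) {x : V} (h : Core T r x) (z : V) :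
    ∃ a, r ≤ T.dist a x ∧ T.dist a z = T.dist a x + T.dist x z := by
  obtain ⟨c, hc⟩ := h
  obtain ⟨p, rfl, hp, -⟩ := hc.exists_geodesic hT.connected
  have h1 := hp 0 r (by omega)
  have h2 := hp r (5 * r) (by omega)
  have h3 := hp 0 (r + 5 * r) (by omega)
  simp only [zero_add] at h1 h3
  rcases between_or hT (u := p 0) (x := p r) (w := p (r + 5 * r)) (by omega) z with h | h
  · exact ⟨p 0, by omega, h⟩
  · refine ⟨p (r + 5 * r), ?_, h⟩
    rw [T.dist_comm]
    omega

theorem Core.convex (hT : T.IsTree) (hfar : ∀ v, ∃ u, 6 * r ≤ T.dist v u) {x y z : V}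
    (hx : Core T r x) (hy : Core T r y) (h : T.dist x y = T.dist x z + T.dist z y) :
    Core T r z := by
  rcases Nat.eq_zero_or_pos (T.dist x z) with h0 | hxz
  · rwa [← hT.connected.dist_eq_zero_iff.1 h0]
  rcases Nat.eq_zero_or_pos (T.dist z y) with h0 | hzy
  · rwa [hT.connected.dist_eq_zero_iff.1 h0]
  obtain ⟨a, hax, haz⟩ := hx.exists_far hT z
  obtain ⟨b, hby, hbz⟩ := hy.exists_far hT z
  have h1 : T.dist y a = T.dist y z + T.dist z a := by
    refine (between_or hT h a).resolve_left fun h1 => ?_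
    rw [T.dist_comm (u := x) (v := a), T.dist_comm (u := z) (v := a)] at h1
    omega
  have h2 : T.dist a b = T.dist a z + T.dist z b := by
    refine (between_or hT h1 b).resolve_left fun h2 => ?_
    rw [T.dist_comm (u := y) (v := b), T.dist_comm (u := z) (v := b)] at h2
    rw [T.dist_comm (u := z) (v := y)] at hzy
    omega
  obtain ⟨g, hg⟩ := hfar z
  rcases between_or hT h2 g with h3 | h3
  · exact core_of_between hT.connected h3 (by omega) (by omega)
  · exact core_of_between hT.connected h3 (by omega) (by omega)

theorem exists_coreWk (hT : T.Connected) (hfar : ∀ v, ∃ u, 6 * r ≤ T.dist v u) (v : V) :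
    CoreWk T r r v := by
  obtain ⟨g, hg⟩ := hfar v
  obtain ⟨z, hvz, hzg⟩ := exists_dist_eq hT (x := v) (y := g) (i := r) (j := T.dist v g - r)
    (by omega)
  refine ⟨z, core_of_between hT (a := v) (g := g) (by omega) (by omega) (by omega), ?_⟩
  rw [← hvz, T.dist_comm]
  exact wk_dist hT z v

/-- The vertices off the core attach to it at a single vertex. -/
theorem Lev.exists_gate (hT : T.IsTree) (hfar : ∀ v, ∃ u, 6 * r ≤ T.dist v u) {d : ℕ} {v : V}
    (h : Lev T r d v) : ∃ z, Core T r z ∧ T.dist z v = d ∧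
      ∀ w, Core T r w → T.dist w v = T.dist w z + d := by
  have hmin : ∀ w, Core T r w → d ≤ T.dist w v := fun w hw => by
    by_contra hlt
    exact h.2 _ (not_le.1 hlt) ⟨w, hw, wk_dist hT.connected w v⟩
  obtain ⟨z, hz, hzv⟩ := h.1
  have hd : T.dist z v = d := le_antisymm (hzv.dist_le hT.connected) (hmin z hz)
  refine ⟨z, hz, hd, fun w hw => ?_⟩
  rcases Nat.eq_zero_or_pos d with rfl | h0
  · rw [hT.connected.dist_eq_zero_iff.1 hd, add_zero]
  obtain ⟨y, hzy, hyv⟩ := exists_dist_eq hT.connected (x := z) (y := v) (i := 1) (j := d - 1)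
    (by omega)
  have hadj := SimpleGraph.dist_eq_one_iff_adj.1 hzy
  rcases hT.dist_eq_dist_add_one_of_adj w hadj with h1 | h1
  · have h2 : Core T r y := hw.convex hT hfar hz (by rw [T.dist_comm (u := y) (v := z)]; omega)
    have := hmin y h2
    omega
  · have := dist_eq_of_adj hT hadj (w := w) (z := v) h1
      (by rw [T.dist_comm (u := v) (v := z), T.dist_comm (u := v) (v := y)]; omega)
    rw [T.dist_comm (u := w) (v := v), this, T.dist_comm (u := v) (v := y),
      T.dist_comm (u := z) (v := w)]
    omega

theorem layered_of_far (hT : T.IsTree) (hfar : ∀ v, ∃ u, 6 * r ≤ T.dist v u)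
    (hkey : ∀ c x y, Key T r c x → Key T r c y → x = y) : Layered T r where
  key_inj := hkey
  exists_lev v := (exists_coreWk hT.connected hfar v).exists_lev
  parent_unique d _ v u u' hv hu hu' hlu hlu' := by
    obtain ⟨z, hz, hzv, hgate⟩ := hv.exists_gate hT hfar
    have h1 : ∀ u, T.Adj v u → Lev T r d u → T.dist z u = d := by
      intro u hu hlu
      obtain ⟨y, hy, hyu, -⟩ := hlu.exists_gate hT hfar
      have h2 := hgate y hy
      have h3 := hT.connected.dist_triangle (u := y) (v := u) (w := v)
      have h4 := SimpleGraph.dist_eq_one_iff_adj.2 hu.symm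
      rwa [← hT.connected.dist_eq_zero_iff.1 (show T.dist y z = 0 by omega)]
    refine eq_of_adj_of_dist hT hu.symm hu'.symm (z := z) ?_ ?_
    · rw [hzv, h1 u hu hlu]
    · rw [hzv, h1 u' hu' hlu']
  not_adj d _ v u hadj hv hu := by
    obtain ⟨z, hz, hzv, hgate⟩ := hv.exists_gate hT hfar
    obtain ⟨y, hy, hyu, hgate'⟩ := hu.exists_gate hT hfar
    have h1 := hgate y hy
    have h2 := hgate' z hz
    have h3 := T.dist_comm (u := z) (v := y)
    have h4 := hT.connected.dist_triangle (u := y) (v := u) (w := v)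
    have h5 := SimpleGraph.dist_eq_one_iff_adj.2 hadj.symm
    have h6 := hT.dist_ne_of_adj y hadj
    have h7 := dist_eq_of_adj hT hadj.symm (w := y) (z := z) (by omega) (by omega)
    rw [T.dist_comm (u := u) (v := y)] at h7
    omega

end TreeCore

section Windows

variable {V : Type} {T : SimpleGraph V}

theorem exists_walk_of_adj {p : ℕ → V} {d : ℕ} (h : ∀ i < d, T.Adj (p i) (p (i + 1))) :
    ∃ w : T.Walk (p 0) (p d), w.length = d ∧ w.support = (List.range (d + 1)).map p := by
  induction d with
  | zero => exact ⟨.nil, rfl, by simp⟩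
  | succ d ih =>
    obtain ⟨w, hw, hs⟩ := ih fun i hi => h i (by omega)
    refine ⟨w.concat (h d (by omega)), by rw [SimpleGraph.Walk.length_concat, hw], ?_⟩
    rw [SimpleGraph.Walk.support_concat, hs, List.range_succ (n := d + 1), List.map_append]
    simp

theorem nearLeaf_iff_adjToLeaf {x : V} : NearLeaf T x ↔ adjToLeaf T x := by
  refine exists_congr fun w => and_congr_right fun hxw => ?_
  rw [deg, Nat.card_eq_one_iff_unique]
  constructor
  · intro h
    exact ⟨⟨fun a b => Subtype.ext ((h a a.2).trans (h b b.2).symm)⟩, ⟨⟨x, hxw.symm⟩⟩⟩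
  · rintro ⟨h, -⟩ u hu
    exact congrArg Subtype.val (h.elim ⟨u, hu⟩ ⟨x, hxw.symm⟩)

/-- Paths of length `r` with the same check have two vertices in common. -/
def DistinctChecks (T : SimpleGraph V) (r : ℕ) : Prop :=
  ∀ p p' : ℕ → V, (∀ i < r, T.Adj (p i) (p (i + 1))) → (∀ i < r, T.Adj (p' i) (p' (i + 1))) →
    (∀ i ≤ r, ∀ j ≤ r, p i = p j → i = j) → (∀ i ≤ r, ∀ j ≤ r, p' i = p' j → i = j) →
    (∀ i ≤ r, NearLeaf T (p i) ↔ NearLeaf T (p' i)) →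
    ∃ i ≤ r, ∃ j ≤ r, i ≠ j ∧ (∃ i' ≤ r, p i = p' i') ∧ ∃ j' ≤ r, p' j' = p j

/-- The sequence `p` runs along a geodesic up to time `L`. -/
def Geodesic (T : SimpleGraph V) (L : ℕ) (p : ℕ → V) : Prop :=
  ∀ i k, i + k ≤ L → T.dist (p i) (p (i + k)) = k

theorem Geodesic.adj {L : ℕ} {p : ℕ → V} (h : Geodesic T L p) {i : ℕ} (hi : i < L) :
    T.Adj (p i) (p (i + 1)) :=
  SimpleGraph.dist_eq_one_iff_adj.1 (h i 1 hi)

theorem Geodesic.inj {L : ℕ} {p : ℕ → V} (h : Geodesic T L p) {i j : ℕ} (hi : i ≤ L) (hj : j ≤ L)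
    (hij : p i = p j) : i = j := by
  rcases le_total i j with h1 | h1
  · obtain ⟨k, rfl⟩ := Nat.exists_eq_add_of_le h1
    have := h i k hj
    rw [hij, SimpleGraph.dist_self] at this
    omega
  · obtain ⟨k, rfl⟩ := Nat.exists_eq_add_of_le h1
    have := h j k hi
    rw [hij, SimpleGraph.dist_self] at this
    omega

theorem DistinctChecks.of_geodesic {r L : ℕ} (hT : DistinctChecks T r) {p p' : ℕ → V}
    (hp : Geodesic T L p) (hp' : Geodesic T L p') {a a' : ℕ} (ha : a + r ≤ L) (ha' : a' + r ≤ L)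
    (h : ∀ i ≤ r, NearLeaf T (p (a + i)) ↔ NearLeaf T (p' (a' + i))) :
    ∃ i ≤ r, ∃ j ≤ r, i ≠ j ∧ (∃ i' ≤ r, p (a + i) = p' (a' + i')) ∧
      ∃ j' ≤ r, p' (a' + j') = p (a + j) :=
  hT (fun i => p (a + i)) (fun i => p' (a' + i)) (fun i hi => hp.adj (by omega))
    (fun i hi => hp'.adj (by omega))
    (fun i hi j hj hij => by have := hp.inj (by omega) (by omega) hij; omega)
    (fun i hi j hj hij => by have := hp'.inj (by omega) (by omega) hij; omega) h

theorem DistinctChecks.geodesic_eq {r : ℕ} (hr : 0 < r) (hT : T.IsTree) (hd : DistinctChecks T r)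
    {p p' : ℕ → V} (hp : Geodesic T (6 * r) p) (hp' : Geodesic T (6 * r) p')
    (h : ∀ i ≤ 6 * r, NearLeaf T (p i) ↔ NearLeaf T (p' i)) : p r = p' r := by
  obtain ⟨a, ha, -, -, -, ⟨a', ha', haa'⟩, -⟩ := hd.of_geodesic hp hp' (a := 0) (a' := 0)
    (by omega) (by omega) (fun i hi => h _ (by omega))
  obtain ⟨b, hb, -, -, -, ⟨b', hb', hbb'⟩, -⟩ := hd.of_geodesic hp hp' (a := 5 * r) (a' := 5 * r)
    (by omega) (by omega) (fun i hi => h _ (by omega))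
  simp only [zero_add] at haa'
  wlog hle : a ≤ a' generalizing p p' a a' b b'
  · exact (this hp' hp (fun i hi => (h i hi).symm) a' ha' a ha b' hb' b hb hbb'.symm haa'.symm
      (by omega)).symm
  obtain ⟨s, rfl⟩ := Nat.exists_eq_add_of_le hle
  have h1 := hp a (5 * r + b - a) (by omega)
  have h2 := hp' (a + s) (5 * r + b' - (a + s)) (by omega)
  rw [show a + (5 * r + b - a) = 5 * r + b by omega] at h1
  rw [show a + s + (5 * r + b' - (a + s)) = 5 * r + b' by omega, ← haa', ← hbb'] at h2
  have hs : ∀ j, j + a ≤ 5 * r → p (a + j) = p' (a + j + s) := by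
    intro j hj
    refine between_unique hT (u := p a) (w := p (5 * r + b)) ?_ ?_ ?_
    · have h3 := hp a j (by omega)
      have h4 := hp (a + j) (5 * r + b - (a + j)) (by omega)
      rw [show a + j + (5 * r + b - (a + j)) = 5 * r + b by omega] at h4
      omega
    · have h3 := hp' (a + s) j (by omega)
      have h4 := hp' (a + s + j) (5 * r + b' - (a + s + j)) (by omega)
      rw [show a + s + j + (5 * r + b' - (a + s + j)) = 5 * r + b' by omega] at h4
      rw [haa', hbb', show a + j + s = a + s + j by omega, h3, h4, ← haa', ← hbb']
      omega
    · have h3 := hp a j (by omega)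
      have h4 := hp' (a + s) j (by omega)
      rw [h3, haa', show a + j + s = a + s + j by omega, h4]
  rcases Nat.eq_zero_or_pos s with rfl | hs0
  · simpa [show a + (r - a) = r by omega] using hs (r - a) (by omega)
  · exfalso
    have hper : ∀ m j, j + m * s + a ≤ 5 * r →
        (NearLeaf T (p (a + j)) ↔ NearLeaf T (p (a + j + m * s))) := by
      intro m
      induction m with
      | zero => simp
      | succ m ih =>
        intro j hj
        rw [Nat.succ_mul] at hj ⊢
        rw [ih j (by omega), add_assoc, hs _ (by omega), ← h _ (by omega),
          show a + (j + m * s) + s = a + j + (m * s + s) by omega]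
    obtain ⟨m, hm1, hm2⟩ : ∃ m, r ≤ m * s ∧ m * s ≤ 2 * r := by
      refine ⟨r / s + 1, ?_, ?_⟩
      · have := Nat.lt_div_mul_add (a := r) hs0
        rw [Nat.succ_mul]
        omega
      · have := Nat.div_mul_le_self r s
        rw [Nat.succ_mul]
        omega
    obtain ⟨i, hi, j, hj, hij, ⟨i', hi', hii'⟩, ⟨j', hj', hjj'⟩⟩ :=
      hd.of_geodesic hp hp (a := a) (a' := a + m * s) (by omega) (by omega)
        (fun i hi => by
          rw [hper m i (by omega), show a + i + m * s = a + m * s + i by omega])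
    have h3 := hp.inj (by omega) (by omega) hii'
    have h4 := hp.inj (by omega) (by omega) hjj'
    omega

theorem DistinctChecks.key_inj {r : ℕ} (hr : 0 < r) (hT : T.IsTree) (hd : DistinctChecks T r)
    {c : ℕ → Prop} {x y : V} (hx : Key T r c x) (hy : Key T r c y) : x = y := by
  obtain ⟨p, rfl, hp, hpc⟩ := hx.exists_geodesic hT.connected
  obtain ⟨p', rfl, hp', hpc'⟩ := hy.exists_geodesic hT.connected
  exact hd.geodesic_eq hr hT hp hp' fun i hi => (hpc i hi).trans (hpc' i hi).symm

theorem Typical.distinctChecks {n : ℕ} {T : SimpleGraph (Fin n)} (hT : Typical n T) :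
    DistinctChecks T (r0 n) := by
  intro p p' hp hp' hi hi' hc
  obtain ⟨w, hw, hs⟩ := exists_walk_of_adj hp
  obtain ⟨w', hw', hs'⟩ := exists_walk_of_adj hp'
  have hpath : ∀ {q : ℕ → Fin n}, (∀ i ≤ r0 n, ∀ j ≤ r0 n, q i = q j → i = j) →
      ((List.range (r0 n + 1)).map q).Nodup := fun {q} hq =>
    List.Nodup.map_on (fun i hi j hj hij =>
      hq i (by simp at hi; omega) j (by simp at hj; omega) hij)
      List.nodup_range
  have h1 : ¬ (w.support.toFinset ∩ w'.support.toFinset).card ≤ 1 := by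
    intro h
    refine hT.1 _ _ _ _ w w' ((SimpleGraph.Walk.isPath_def _).2 (hs ▸ hpath hi))
      ((SimpleGraph.Walk.isPath_def _).2 (hs' ▸ hpath hi')) hw hw' h ?_
    rw [check, check, hs, hs', List.map_map, List.map_map]
    refine List.map_congr_left fun i hi => ?_
    have := hc i (by simp at hi; omega)
    rw [nearLeaf_iff_adjToLeaf, nearLeaf_iff_adjToLeaf] at this
    exact propext this
  obtain ⟨x, hx, y, hy, hxy⟩ := Finset.one_lt_card.1 (not_le.1 h1)
  simp only [hs, hs', Finset.mem_inter, List.mem_toFinset, List.mem_map, List.mem_range] at hx hy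
  obtain ⟨⟨i, hi, rfl⟩, i', hi', hii'⟩ := hx
  obtain ⟨⟨j, hj, rfl⟩, j', hj', hjj'⟩ := hy
  exact ⟨i, by omega, j, by omega, fun h => hxy (h ▸ rfl), ⟨i', by omega, hii'.symm⟩,
    j', by omega, hjj'⟩

end Windows

section Balls

/-- Iterating a bound for balls of radius `r`. -/
theorem ncard_ball_le {V : Type} [Finite V] {T : SimpleGraph V} (hT : T.Connected) {r B : ℕ}
    (hB : ∀ v, {w | T.dist v w ≤ r}.ncard ≤ B) (m : ℕ) (v : V) :
    {w | T.dist v w ≤ m * r}.ncard ≤ B ^ m := by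
  induction m with
  | zero =>
    have : {w | T.dist v w ≤ 0 * r} = {v} := by
      ext w
      rw [Set.mem_ofPred_eq, zero_mul, Nat.le_zero, hT.dist_eq_zero_iff, Set.mem_singleton_iff,
        eq_comm]
    rw [this, Set.ncard_singleton, pow_zero]
  | succ m ih =>
    have h1 : {w | T.dist v w ≤ (m + 1) * r} ⊆
        ⋃ u ∈ (Set.toFinite {w | T.dist v w ≤ m * r}).toFinset, {w | T.dist u w ≤ r} := by
      intro w hw
      simp only [Set.mem_ofPred_eq, Nat.succ_mul] at hw
      simp only [Set.Finite.mem_toFinset, Set.mem_ofPred_eq, Set.mem_iUnion, exists_prop]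
      rcases le_total (T.dist v w) (m * r) with h | h
      · exact ⟨w, h, by simp⟩
      · obtain ⟨u, hvu, huw⟩ := exists_dist_eq hT (x := v) (y := w) (i := m * r)
          (j := T.dist v w - m * r) (by omega)
        exact ⟨u, by omega, by omega⟩
    refine (Set.ncard_le_ncard h1 (Set.toFinite _)).trans ?_
    refine (Finset.set_ncard_biUnion_le _ _).trans ?_
    refine (Finset.sum_le_card_nsmul _ _ B fun u _ => hB u).trans ?_
    rw [← Set.ncard_eq_toFinset_card, smul_eq_mul, pow_succ]
    exact Nat.mul_le_mul_right _ ih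

theorem exists_far_of_ball {V : Type} [Finite V] {T : SimpleGraph V} (hT : T.Connected) {r B : ℕ}
    (hB : ∀ v, {w | T.dist v w ≤ r}.ncard ≤ B) {m : ℕ} (hm : B ^ m < Nat.card V) (v : V) :
    ∃ u, m * r ≤ T.dist v u := by
  by_contra! h
  have h1 := ncard_ball_le hT hB m v
  rw [show {w | T.dist v w ≤ m * r} = Set.univ from Set.eq_univ_of_forall fun u => (h u).le,
    Set.ncard_univ] at h1
  omega

end Balls

section Final

theorem ncard_desc_le_deg {V : Type} [Finite V] {G : SimpleGraph V} {r : ℕ} (v : V) :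
    {c | Desc G r 1 v c}.ncard ≤ deg G v := by
  have h : {c | Desc G r 1 v c} ⊆ {c | G.Adj v c} := fun c hc => Desc.adj hc
  exact Set.ncard_le_ncard h (Set.toFinite _)

theorem Desc.dist_le {V : Type} {G : SimpleGraph V} (hG : G.Connected) {r e : ℕ} {u v : V}
    (h : Desc G r e u v) : G.dist u v ≤ r :=
  let ⟨_, hd, _, _, h⟩ := h
  (h.dist_le hG).trans (by omega)

theorem Typical.D_le {n : ℕ} {T : SimpleGraph (Fin n)} (hT : T.IsTree) (hTy : Typical n T)
    {q : ℕ} (hr : 0 < r0 n) (hq : 6 * r0 n ≤ 2 ^ q)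
    (hqB : ⌊10 ^ 8 * Real.log n ^ 4⌋₊ < 2 ^ q) (hB : ⌊10 ^ 8 * Real.log n ^ 4⌋₊ ^ 6 < n) :
    D T ≤ q * (⌊Real.log (Real.log n) ^ 5⌋₊ + 3) + q + 10 + maxDeg T + 1 +
      (⌊Real.log n / Real.log (Real.log n) ^ 2⌋₊ + 1) + 1 := by
  classical
  have hball : ∀ v, {w | T.dist v w ≤ r0 n}.ncard ≤ ⌊10 ^ 8 * Real.log n ^ 4⌋₊ :=
    fun v => Nat.le_floor (hTy.2.2.1 v)
  have hG : Layered T (r0 n) := by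
    refine layered_of_far hT (exists_far_of_ball hT.connected hball ?_)
      fun c x y => hTy.distinctChecks.key_inj hr hT
    rwa [Nat.card_fin]
  refine D_le_of_ef T (by omega) fun m H h => EF.nonempty_iso hG hq
    (X := fun z => insert z (Finset.univ.filter fun w =>
      T.dist z w ≤ r0 n ∧ Real.log (Real.log n) ^ 5 < (deg T w : ℝ))) (fun z => ⟨?_, ?_⟩)
    (fun z v e hv hvX => ?_) (fun v => ?_) (fun z => ?_) h
  · exact Finset.mem_insert_self _ _
  · refine (Finset.card_insert_le _ _).trans (Nat.succ_le_succ (Nat.le_floor ?_))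
    refine le_trans (le_of_eq ?_) (hTy.2.2.2 z)
    rw [Nat.card_eq_fintype_card, Fintype.card_subtype]
  · refine (ncard_desc_le_deg v).trans (Nat.le_floor ?_)
    by_contra hlt
    exact hvX (Finset.mem_insert_of_mem
      (Finset.mem_filter.2 ⟨Finset.mem_univ _, hv.dist_le hT.connected, not_le.1 hlt⟩))
  · exact (ncard_desc_le_deg v).trans (Finset.le_sup (f := fun v => deg T v) (Finset.mem_univ v))
  · refine lt_of_le_of_lt ((Set.ncard_le_ncard ?_ (Set.toFinite _)).trans (hball z)) hqB
    rintro u ⟨e, he⟩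
    exact he.dist_le hT.connected

open Filter in
theorem eventually_mul_pow_lt_exp (C : ℝ) (k : ℕ) :
    ∀ᶠ x : ℝ in atTop, C * x ^ k < Real.exp x := by
  filter_upwards [(Real.tendsto_exp_div_pow_atTop k).eventually_gt_atTop C,
    eventually_gt_atTop 0] with x hx h0
  exact (lt_div_iff₀ (by positivity)).1 hx

theorem depth_bound {ε y x Δ : ℝ} (hε : 0 < ε) (hy : 1 ≤ y) (hεy : 4 / ε ≤ y) (hx : 0 < x)
    (hxy : 272 / ε * y ^ 7 < x) (hΔ : x / (2 * y) ≤ Δ) {q : ℕ} (hq : q ≤ 10 * y + 1) :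
    q * ((⌊y ^ 5⌋₊ : ℝ) + 3) + q + 10 + Δ + 1 + (⌊x / y ^ 2⌋₊ + 1) + 1 ≤ (1 + ε) * Δ := by
  have hy0 : 0 < y := by linarith
  have h1 : (⌊y ^ 5⌋₊ : ℝ) ≤ y ^ 5 := Nat.floor_le (by positivity)
  have h2 : (⌊x / y ^ 2⌋₊ : ℝ) ≤ x / y ^ 2 := Nat.floor_le (by positivity)
  have h3 : x / y ^ 2 ≤ ε * (x / (4 * y)) := by
    rw [div_le_iff₀ hε] at hεy
    rw [← mul_div_assoc, div_le_div_iff₀ (by positivity) (by positivity)]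
    nlinarith [mul_le_mul_of_nonneg_left hεy (mul_pos hx hy0).le]
  have h4 : 68 * y ^ 6 ≤ ε * (x / (4 * y)) := by
    rw [div_mul_eq_mul_div, div_lt_iff₀ hε] at hxy
    rw [← mul_div_assoc, le_div_iff₀ (by positivity)]
    nlinarith
  have h5 : (q : ℝ) * ((⌊y ^ 5⌋₊ : ℝ) + 4) ≤ (11 * y) * (5 * y ^ 5) := by
    refine mul_le_mul (by linarith) ?_ (by positivity) (by positivity)
    linarith [one_le_pow₀ (n := 5) hy]
  have h6 := one_le_pow₀ (n := 6) hy
  have h7 : ε * (x / (4 * y)) + ε * (x / (4 * y)) ≤ ε * Δ := by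
    calc _ = ε * (x / (2 * y)) := by field_simp; norm_num
      _ ≤ _ := mul_le_mul_of_nonneg_left hΔ hε.le
  nlinarith

end Final

end FODef

theorem statement5 (ε : ℝ) (hε : 0 < ε) :
    ∃ n₀ : ℕ, ∀ n : ℕ, n₀ ≤ n → ∀ T : SimpleGraph (Fin n),
      T.Connected → T.IsAcyclic → Typical n T →
      (D T : ℝ) ≤ (1 + ε) * (maxDeg T : ℝ) := by
  have hx : Filter.Tendsto (fun n : ℕ => Real.log n) Filter.atTop Filter.atTop :=
    Real.tendsto_log_atTop.comp tendsto_natCast_atTop_atTop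
  have hy : Filter.Tendsto (fun n : ℕ => Real.log (Real.log n)) Filter.atTop Filter.atTop :=
    Real.tendsto_log_atTop.comp hx
  rw [← Filter.eventually_atTop]
  filter_upwards [hx.eventually_gt_atTop (10 ^ 4),
    hx.eventually (eventually_mul_pow_lt_exp (10 ^ 48) 24),
    hy.eventually_ge_atTop 1, hy.eventually_ge_atTop (4 / ε),
    hy.eventually (eventually_mul_pow_lt_exp (272 / ε) 7), Filter.eventually_gt_atTop 0]
    with n hx hxn hy hyε hxy hn T hconn hacyc hT
  have hx0 : 0 < Real.log n := by linarith
  rw [Real.exp_log (by exact_mod_cast hn)] at hxn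
  rw [Real.exp_log hx0] at hxy
  have hq : Real.log n ^ 6 ≤ 2 ^ ⌈10 * Real.log (Real.log n)⌉₊ := by
    rw [← Real.log_le_log_iff (by positivity) (by positivity), Real.log_pow, Real.log_pow]
    have h1 := Nat.le_ceil (10 * Real.log (Real.log n))
    have h2 := Real.log_two_gt_d9
    push_cast
    nlinarith
  have hr : (r0 n : ℝ) < 7 * Real.log n + 1 := Nat.ceil_lt_add_one (by positivity)
  have hx2 : 10 ^ 8 < Real.log n ^ 2 := by nlinarith
  have hx4 : 1 ≤ Real.log n ^ 3 := one_le_pow₀ (by linarith)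
  have hfloor := Nat.floor_le (show 0 ≤ 10 ^ 8 * Real.log n ^ 4 by positivity)
  have h := hT.D_le ⟨hconn, hacyc⟩ (q := ⌈10 * Real.log (Real.log n)⌉₊)
    (Nat.ceil_pos.2 (by positivity))
    (by
      have : (6 * r0 n : ℝ) ≤ 2 ^ ⌈10 * Real.log (Real.log n)⌉₊ := by
        refine le_trans ?_ hq
        nlinarith [mul_le_mul hx2.le hx4 (by positivity) (by positivity)]
      exact_mod_cast this)
    (by
      have : (⌊10 ^ 8 * Real.log n ^ 4⌋₊ : ℝ) < 2 ^ ⌈10 * Real.log (Real.log n)⌉₊ := by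
        refine lt_of_lt_of_le (lt_of_le_of_lt hfloor ?_) hq
        rw [show Real.log n ^ 6 = Real.log n ^ 2 * Real.log n ^ 4 by ring]
        exact mul_lt_mul_of_pos_right hx2 (by positivity)
      exact_mod_cast this)
    (by
      have : (⌊10 ^ 8 * Real.log n ^ 4⌋₊ : ℝ) ^ 6 < n := by
        refine lt_of_le_of_lt (pow_le_pow_left₀ (by positivity) hfloor 6) ?_
        rw [mul_pow, ← pow_mul, ← pow_mul]
        exact hxn
      exact_mod_cast this)
  refine le_trans (Nat.cast_le.2 h) ?_
  push_cast
  exact depth_bound hε hy hyε hx0 hxy hT.2.1.1 (Nat.ceil_lt_add_one (by positivity)).le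
end

section
/- Let T be a tree chosen uniformly at random from the n^{n−2} labeled trees on vertex set {1,…,n} and let r₀ = ⌈7 ln n⌉. With high probability, for every pair of paths P_{vw} (from v to w) and P_{v'w'} (from v' to w') of length r₀ in T which share at most one vertex, the checks Ch(v;P_{vw}) and Ch(v';P_{v'w'}) are different. -/
namespace FODef

open Classical in
/-- The probability of the event `E` for a tree chosen uniformly at random among all
labeled trees on the vertex set `Fin n`. -/
noncomputable def treeProb (n : ℕ) (E : Set (SimpleGraph (Fin n))) : ℝ :=
  ((Finset.univ.filter
      (fun T : SimpleGraph (Fin n) => T.Connected ∧ T.IsAcyclic ∧ T ∈ E)).card : ℝ) /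
  ((Finset.univ.filter
      (fun T : SimpleGraph (Fin n) => T.Connected ∧ T.IsAcyclic)).card : ℝ)

end FODef

open Filter FODef

section RootedForests

variable {V : Type*}

/-- A self-map `f`, viewed as a parent function, is a rooted forest if some depth function
strictly decreases along `f` away from the fixed points, which are the roots. -/
def IsRootedForest (f : V → V) : Prop :=
  ∃ d : V → ℕ, ∀ v, f v = v ∨ d (f v) < d v

/-- The graph whose edges join each vertex to its parent. -/
def parentGraph (f : V → V) : SimpleGraph V where
  Adj a b := a ≠ b ∧ (f a = b ∨ f b = a)
  symm := ⟨fun _ _ h => ⟨h.1.symm, h.2.symm⟩⟩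
  loopless := ⟨fun _ h => h.1 rfl⟩

theorem IsRootedForest.exists_root [Finite V] {f : V → V} (hf : IsRootedForest f) :
    ∃ ρ : V → V, (∀ v, f (ρ v) = ρ v) ∧ (∀ v, ρ (f v) = ρ v) ∧ ∀ v, f v = v → ρ v = v := by
  classical
  have := Fintype.ofFinite V
  obtain ⟨d, hd⟩ := hf
  have key : ∀ N v, d v ≤ N → f (f^[N] v) = f^[N] v := by
    intro N
    induction N with
    | zero =>
      intro v hv
      rcases hd v with h | h
      · simpa using h
      · omega
    | succ N ih =>
      intro v hv
      rcases hd v with h | h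
      · rw [Function.iterate_fixed h, h]
      · rw [Function.iterate_succ_apply]
        exact ih _ (by omega)
  set N := ∑ v, d v with hN
  have hle : ∀ v, d v ≤ N := fun v =>
    Finset.single_le_sum (f := d) (fun _ _ => Nat.zero_le _) (Finset.mem_univ v)
  refine ⟨f^[N], fun v => key N v (hle v), fun v => ?_, fun v hv => Function.iterate_fixed hv N⟩
  rw [← Function.iterate_succ_apply, Function.iterate_succ_apply']
  exact key N v (hle v)

theorem IsRootedForest.update [DecidableEq V] {f ρ : V → V} {u y : V}
    (hf : IsRootedForest f) (hρ : ∀ v, ρ (f v) = ρ v) (hu : ρ u = u) (hy : ρ y ≠ u) :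
    IsRootedForest (Function.update f u y) := by
  obtain ⟨d, hd⟩ := hf
  refine ⟨fun v => if ρ v = u then d v + d y + 1 else d v, fun v => ?_⟩
  by_cases hv : v = u
  · subst hv
    right
    simp only [Function.update_self, hu, hy, if_true, if_false]
    omega
  · rw [Function.update_of_ne hv]
    rcases hd v with h | h
    · exact Or.inl h
    · right
      simp only [hρ]
      split_ifs <;> omega

theorem IsRootedForest.parentGraph_isTree [Fintype V] {f : V → V}
    (hf : IsRootedForest f) {u : V} (hu : ∀ v, f v = v ↔ v = u) :
    (parentGraph f).IsTree := by
  classical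
  obtain ⟨d, hd⟩ := hf
  have hreach : ∀ N v, d v ≤ N → (parentGraph f).Reachable v u := by
    intro N
    induction N with
    | zero =>
      intro v hv
      rcases hd v with h | h
      · rw [(hu v).1 h]
      · omega
    | succ N ih =>
      intro v hv
      rcases hd v with h | h
      · rw [(hu v).1 h]
      · have hadj : (parentGraph f).Adj v (f v) :=
          ⟨fun h' => by rw [← h'] at h; exact lt_irrefl _ h, Or.inl rfl⟩
        exact hadj.reachable.trans (ih _ (by omega))
  have hconn : (parentGraph f).Connected := by
    have : Nonempty V := ⟨u⟩
    exact ⟨fun a b => (hreach _ a le_rfl).trans (hreach _ b le_rfl).symm⟩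
  rw [SimpleGraph.isTree_iff_connected_and_card]
  refine ⟨hconn, le_antisymm ?_ hconn.card_vert_le_card_edgeSet_add_one⟩
  have hsub : (parentGraph f).edgeSet ⊆
      ((Finset.univ.erase u).image fun v => s(v, f v) : Finset (Sym2 V)) := by
    intro e
    induction e with
    | _ a b =>
      rintro ⟨hab, h | h⟩
      · simp only [Finset.coe_image, Set.mem_image, Finset.mem_coe, Finset.mem_erase]
        exact ⟨a, ⟨fun ha => hab (((hu a).2 ha).symm.trans h), Finset.mem_univ _⟩, by rw [h]⟩
      · simp only [Finset.coe_image, Set.mem_image, Finset.mem_coe, Finset.mem_erase]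
        exact ⟨b, ⟨fun hb => hab (h.symm.trans ((hu b).2 hb)), Finset.mem_univ _⟩,
          by rw [h, Sym2.eq_swap]⟩
  have h1 : Nat.card (parentGraph f).edgeSet ≤ (Finset.univ.erase u).card := by
    refine le_trans ?_ (Finset.card_image_le (f := fun v => s(v, f v)))
    rw [← Set.ncard_coe_finset, ← Nat.card_coe_set_eq]
    exact Nat.card_mono (Finset.finite_toSet _) hsub
  have h2 : 0 < Fintype.card V := Fintype.card_pos_iff.2 ⟨u⟩
  rw [Finset.card_erase_of_mem (Finset.mem_univ _), Finset.card_univ] at h1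
  rw [Nat.card_eq_fintype_card (α := V)]
  omega

theorem IsRootedForest.eq_of_parentGraph_eq {f g : V → V} {u : V}
    (hf : IsRootedForest f) (hfu : ∀ v, f v = v ↔ v = u) (hgu : ∀ v, g v = v ↔ v = u)
    (h : parentGraph f = parentGraph g) : f = g := by
  obtain ⟨d, hd⟩ := hf
  have key : ∀ N v, d v < N → f v = g v := by
    intro N
    induction N with
    | zero => intro v hv; omega
    | succ N ih =>
      intro v hv
      by_cases hvu : v = u
      · rw [(hfu v).2 hvu, (hgu v).2 hvu]
      · have hne : f v ≠ v := fun h' => hvu ((hfu v).1 h')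
        have hadj : (parentGraph g).Adj v (f v) := h ▸ ⟨hne.symm, Or.inl rfl⟩
        rcases hadj.2 with h1 | h1
        · exact h1.symm
        · have hlt := (hd v).resolve_left hne
          have h2 := ih (f v) (by omega)
          rw [h1] at h2
          have h3 := (hd (f v)).resolve_left (by rw [h2]; exact hne.symm)
          rw [h2] at h3
          omega
  exact funext fun v => key _ v (Nat.lt_succ_self _)

open Classical in
/-- The number of rooted forests on `V` with exactly `k` roots. -/
noncomputable def numRootedForests (V : Type*) [Fintype V] (k : ℕ) : ℕ :=
  (Finset.univ.filter fun f : V → V =>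
    IsRootedForest f ∧ (Finset.univ.filter fun v => f v = v).card = k).card

theorem numRootedForests_mul_le [Fintype V] (k : ℕ) :
    numRootedForests V (k + 1) * (k * Fintype.card V) ≤
      numRootedForests V k * (Fintype.card V - k) := by
  classical
  set F : ℕ → Finset (V → V) := fun k => Finset.univ.filter fun f : V → V =>
    IsRootedForest f ∧ (Finset.univ.filter fun v => f v = v).card = k with hF
  have hroot : ∀ f : V → V, ∃ ρ : V → V, IsRootedForest f →
      (∀ v, f (ρ v) = ρ v) ∧ (∀ v, ρ (f v) = ρ v) ∧ ∀ v, f v = v → ρ v = v := by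
    intro f
    by_cases hf : IsRootedForest f
    · obtain ⟨ρ, h⟩ := hf.exists_root
      exact ⟨ρ, fun _ => h⟩
    · exact ⟨id, fun h => absurd h hf⟩
  choose ρ hρ using hroot
  set A : Finset (Σ _ : V → V, V × V) := (F (k + 1)).sigma fun f =>
    ((Finset.univ.filter fun v => f v = v) ×ˢ Finset.univ).filter fun p => ρ f p.2 ≠ p.1 with hA
  set B : Finset (Σ _ : V → V, V) := (F k).sigma fun f =>
    Finset.univ.filter fun v => ¬ f v = v with hB
  have hcardB : B.card = numRootedForests V k * (Fintype.card V - k) := by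
    rw [hB, Finset.card_sigma, Finset.sum_const_nat (m := Fintype.card V - k)]
    · rfl
    · intro f hf
      have h1 := (Finset.mem_filter.1 hf).2.2
      have h2 := Finset.card_filter_add_card_filter_not (s := (Finset.univ : Finset V))
        (fun v => f v = v)
      rw [Finset.card_univ] at h2
      omega
  have hcardA : A.card = numRootedForests V (k + 1) * (k * Fintype.card V) := by
    rw [hA, Finset.card_sigma, Finset.sum_const_nat (m := k * Fintype.card V)]
    · rfl
    · intro f hf
      have hf2 := (Finset.mem_filter.1 hf).2
      obtain ⟨hr1, -, hr3⟩ := hρ f hf2.1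
      have h2 := Finset.card_filter_add_card_filter_not
        (s := (Finset.univ.filter fun v => f v = v) ×ˢ (Finset.univ : Finset V))
        (fun p => ρ f p.2 = p.1)
      have h3 : (((Finset.univ.filter fun v => f v = v) ×ˢ (Finset.univ : Finset V)).filter
          fun p => ρ f p.2 = p.1) = Finset.univ.image fun y => (ρ f y, y) := by
        ext ⟨a, b⟩
        simp only [Finset.mem_filter, Finset.mem_product, Finset.mem_univ, true_and, and_true,
          Finset.mem_image, Prod.mk.injEq]
        constructor
        · rintro ⟨-, h⟩
          exact ⟨b, h, rfl⟩
        · rintro ⟨y, h, rfl⟩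
          exact ⟨h ▸ hr1 y, h⟩
      rw [h3, Finset.card_image_of_injective _ (fun a b h => (Prod.mk.inj h).2),
        Finset.card_product, hf2.2, Finset.card_univ] at h2
      have h4 : (k + 1) * Fintype.card V = k * Fintype.card V + Fintype.card V := by ring
      simp only [ne_eq]
      omega
  rw [← hcardA, ← hcardB]
  refine Finset.card_le_card_of_injOn
    (fun t => ⟨Function.update t.1 t.2.1 t.2.2, t.2.1⟩) ?_ ?_
  · rintro ⟨f, u, y⟩ ht
    simp only [hA, Finset.coe_sigma, Set.mem_sigma_iff, Finset.mem_coe, Finset.mem_filter,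
      Finset.mem_product, Finset.mem_univ, true_and, and_true, hF] at ht
    obtain ⟨⟨hf, hk⟩, hu, hy⟩ := ht
    obtain ⟨hr1, hr2, hr3⟩ := hρ f hf
    have hyu : y ≠ u := fun h => hy (by rw [h, hr3 u hu])
    simp only [hB, Finset.coe_sigma, Set.mem_sigma_iff, Finset.mem_coe, Finset.mem_filter,
      Finset.mem_univ, true_and, hF]
    refine ⟨⟨hf.update hr2 (hr3 u hu) hy, ?_⟩, by simpa using hyu⟩
    have : (Finset.univ.filter fun v => Function.update f u y v = v) =
        (Finset.univ.filter fun v => f v = v).erase u := by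
      ext v
      by_cases hv : v = u
      · subst hv; simp [hyu]
      · simp [hv]
    rw [this, Finset.card_erase_of_mem (by simpa using hu), hk, Nat.add_sub_cancel]
  · rintro ⟨f, u, y⟩ ht ⟨f', u', y'⟩ ht' h
    simp only [hA, Finset.coe_sigma, Set.mem_sigma_iff, Finset.mem_coe, Finset.mem_filter,
      Finset.mem_product, Finset.mem_univ, true_and, and_true] at ht ht'
    simp only [Sigma.mk.injEq, heq_eq_eq] at h
    obtain ⟨h1, rfl⟩ := h
    have hy : y = y' := by simpa using congrFun h1 u
    have hff : f = f' := by
      funext v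
      by_cases hv : v = u
      · rw [hv, ht.2.1, ht'.2.1]
      · simpa [hv] using congrFun h1 v
    rw [hy, hff]

theorem choose_mul_pow_le_numRootedForests [Fintype V] (j k : ℕ)
    (hjk : k + 1 + j = Fintype.card V) :
    (Fintype.card V - 1).choose k * Fintype.card V ^ j ≤ numRootedForests V (k + 1) := by
  classical
  induction j generalizing k with
  | zero =>
    have hk : k = Fintype.card V - 1 := by omega
    rw [← hk, Nat.choose_self, pow_zero, mul_one, Nat.one_le_iff_ne_zero, numRootedForests,
      Finset.card_ne_zero]
    refine ⟨id, ?_⟩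
    simp only [id, Finset.filter_true, Finset.mem_filter, Finset.mem_univ, true_and,
      Finset.card_univ]
    exact ⟨⟨fun _ => 0, fun v => Or.inl rfl⟩, by omega⟩
  | succ j ih =>
    have h1 := ih (k + 1) (by omega)
    have h2 := numRootedForests_mul_le (V := V) (k + 1)
    have h3 := Nat.choose_succ_right_eq (Fintype.card V - 1) k
    have h4 : Fintype.card V - 1 - k = Fintype.card V - (k + 1) := by omega
    rw [h4] at h3
    refine Nat.le_of_mul_le_mul_right (c := Fintype.card V - (k + 1)) ?_ (by omega)
    refine le_trans ?_ h2
    calc (Fintype.card V - 1).choose k * Fintype.card V ^ (j + 1) * (Fintype.card V - (k + 1))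
        = ((Fintype.card V - 1).choose k * (Fintype.card V - (k + 1))) *
            Fintype.card V ^ (j + 1) := by ring
      _ = ((Fintype.card V - 1).choose (k + 1) * Fintype.card V ^ j) *
            ((k + 1) * Fintype.card V) := by rw [← h3]; ring
      _ ≤ _ := Nat.mul_le_mul_right _ h1

open Classical in
/-- The lower bound in Cayley's formula. -/
theorem pow_le_card_trees [Fintype V] (hV : 2 ≤ Fintype.card V) :
    Fintype.card V ^ (Fintype.card V - 2) ≤
      (Finset.univ.filter fun T : SimpleGraph V => T.Connected ∧ T.IsAcyclic).card := by
  have h0 := choose_mul_pow_le_numRootedForests (V := V) (Fintype.card V - 1) 0 (by omega)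
  rw [Nat.choose_zero_right, one_mul] at h0
  refine Nat.le_of_mul_le_mul_right (c := Fintype.card V) ?_ (by omega)
  rw [← pow_succ, show Fintype.card V - 2 + 1 = Fintype.card V - 1 by omega]
  refine h0.trans ?_
  rw [← Finset.card_univ (α := V), ← Finset.card_product]
  have : Nonempty V := Fintype.card_pos_iff.1 (by omega)
  have hroot : ∀ f : V → V, ∃ u : V,
      (Finset.univ.filter fun v => f v = v).card = 0 + 1 → ∀ v, f v = v ↔ v = u := by
    intro f
    by_cases h : (Finset.univ.filter fun v => f v = v).card = 0 + 1
    · obtain ⟨u, hu⟩ := Finset.card_eq_one.1 h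
      refine ⟨u, fun _ v => ?_⟩
      simpa using Finset.ext_iff.1 hu v
    · exact ⟨Classical.arbitrary V, fun h' => absurd h' h⟩
  choose u hu using hroot
  refine Finset.card_le_card_of_injOn (fun f => (parentGraph f, u f)) ?_ ?_
  · intro f hf
    obtain ⟨hf1, hf2⟩ := (Finset.mem_filter.1 hf).2
    have ht := hf1.parentGraph_isTree (hu f hf2)
    simp only [Finset.coe_product, Set.mem_prod, Finset.mem_coe, Finset.mem_filter,
      Finset.mem_univ, true_and, and_true]
    exact ⟨ht.1, ht.2⟩
  · intro f hf g hg h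
    obtain ⟨hf1, hf2⟩ := (Finset.mem_filter.1 hf).2
    obtain ⟨hg1, hg2⟩ := (Finset.mem_filter.1 hg).2
    obtain ⟨h1, h2⟩ := Prod.mk.inj h
    exact hf1.eq_of_parentGraph_eq (hu f hf2) (h2 ▸ hu g hg2) h1

end RootedForests

section Counting

open Finset

theorem card_filter_forall_exists_fin_le {τ : Type*} [Fintype τ] [DecidableEq τ] [Nonempty τ]
    (m : ℕ) (B : Finset τ) :
    ((univ.filter fun h : Fin m → τ => ∀ b ∈ B, ∃ r, h r = b).card : ℝ) ≤
      (Fintype.card τ : ℝ) ^ m * (1 - (1 - 1 / (Fintype.card τ : ℝ)) ^ m) ^ B.card := by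
  have hN : (1 : ℝ) ≤ Fintype.card τ := by exact_mod_cast Fintype.card_pos
  set N : ℝ := (Fintype.card τ : ℝ) with hNdef
  have hN0 : 0 < N := by linarith
  have hx0 : 0 ≤ 1 - 1 / N := by
    rw [sub_nonneg, div_le_one hN0]; exact hN
  have hx1 : 1 - 1 / N ≤ 1 := by
    have : 0 ≤ 1 / N := by positivity
    linarith
  induction m generalizing B with
  | zero =>
    rcases B.eq_empty_or_nonempty with rfl | ⟨b, hb⟩
    · simp
    · rw [filter_false_of_mem (fun h _ hh => (hh b hb).elim fun r _ => r.elim0)]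
      simp [ne_empty_of_mem hb]
  | succ m ih =>
    set q := 1 - (1 - 1 / N) ^ m with hq
    have hq0 : 0 ≤ q := sub_nonneg.2 (pow_le_one₀ hx0 hx1)
    have hq1 : q ≤ 1 := by
      have := pow_nonneg hx0 m
      linarith
    have hstep : ((univ.filter fun h : Fin (m + 1) → τ => ∀ b ∈ B, ∃ r, h r = b).card : ℝ) ≤
        ∑ x : τ, ((univ.filter fun h : Fin m → τ => ∀ b ∈ B.erase x, ∃ r, h r = b).card : ℝ) := by
      rw [← Nat.cast_sum, ← card_sigma]
      refine Nat.cast_le.2 (card_le_card_of_injOn (fun h => ⟨h 0, Fin.tail h⟩) ?_ ?_)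
      · intro h hh
        have hh := (mem_filter.1 hh).2
        simp only [coe_sigma, Set.mem_sigma_iff, mem_coe, mem_univ, mem_filter, true_and,
          mem_erase]
        rintro b ⟨hb0, hb⟩
        obtain ⟨r, hr⟩ := hh b hb
        induction r using Fin.cases with
        | zero => exact absurd hr.symm hb0
        | succ r => exact ⟨r, hr⟩
      · intro h _ h' _ e
        simp only [Sigma.mk.injEq, heq_eq_eq] at e
        rw [← Fin.cons_self_tail h, ← Fin.cons_self_tail h', e.1, e.2]
    refine hstep.trans ?_
    have hb : ∀ x : τ, ((univ.filter fun h : Fin m → τ =>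
        ∀ b ∈ B.erase x, ∃ r, h r = b).card : ℝ) ≤
        if x ∈ B then N ^ m * q ^ (B.card - 1) else N ^ m * q ^ B.card := by
      intro x
      split_ifs with hx
      · simpa [card_erase_of_mem hx] using ih (B.erase x)
      · simpa [erase_eq_of_notMem hx] using ih B
    refine (sum_le_sum fun x _ => hb x).trans ?_
    rw [sum_ite, sum_const, sum_const, nsmul_eq_mul, nsmul_eq_mul]
    have hc1 : univ.filter (fun x => x ∈ B) = B := by simp
    have hc2 : ((univ.filter fun x => x ∉ B).card : ℝ) = N - B.card := by
      have h2 := card_filter_add_card_filter_not (s := (univ : Finset τ)) (fun x => x ∈ B)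
      rw [hc1, card_univ] at h2
      rw [hNdef, ← h2]
      push_cast
      ring
    rw [hc1, hc2]
    have hq' : 1 - (1 - 1 / N) ^ (m + 1) = q + (1 - q) / N := by
      rw [hq, pow_succ]
      ring
    rw [hq', pow_succ]
    rcases Nat.eq_zero_or_pos B.card with h0 | hpos
    · simp [h0, mul_comm]
    · obtain ⟨b, hb⟩ := Nat.exists_eq_succ_of_ne_zero hpos.ne'
      have hbern : q ^ B.card + B.card * q ^ (B.card - 1) * ((1 - q) / N) ≤
          (q + (1 - q) / N) ^ B.card := by
        have hy : 0 ≤ (1 - q) / N := div_nonneg (by linarith) hN0.le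
        exact pow_add_mul_le_add_pow hq0 (by linarith) _
      have hfin : N ^ m * N * (q ^ B.card + B.card * q ^ (B.card - 1) * ((1 - q) / N)) ≤
          N ^ m * N * (q + (1 - q) / N) ^ B.card :=
        mul_le_mul_of_nonneg_left hbern (by positivity)
      refine le_trans (le_of_eq ?_) hfin
      rw [hb]
      simp only [Nat.succ_eq_add_one, Nat.add_sub_cancel, pow_succ q b]
      field_simp
      ring

theorem card_filter_forall_exists_le {ρ τ : Type*} [Fintype ρ] [DecidableEq ρ] [Fintype τ]
    [DecidableEq τ] [Nonempty τ] (B : Finset τ) :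
    ((univ.filter fun h : ρ → τ => ∀ b ∈ B, ∃ r, h r = b).card : ℝ) ≤
      (Fintype.card τ : ℝ) ^ Fintype.card ρ *
        (1 - (1 - 1 / (Fintype.card τ : ℝ)) ^ Fintype.card ρ) ^ B.card := by
  refine le_trans (Nat.cast_le.2 ?_) (card_filter_forall_exists_fin_le _ B)
  refine card_le_card_of_injOn (fun h => h ∘ (Fintype.equivFin ρ).symm) ?_ ?_
  · intro h hh
    have hh := (mem_filter.1 hh).2
    simp only [mem_coe, mem_filter, mem_univ, true_and]
    intro b hb
    obtain ⟨r, hr⟩ := hh b hb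
    exact ⟨Fintype.equivFin ρ r, by simpa using hr⟩
  · intro h _ h' _ e
    exact (Fintype.equivFin ρ).symm.surjective.injective_comp_right e

theorem exp_neg_one_le_one_sub_inv_pow {M m : ℕ} (h : m + 1 ≤ M) :
    Real.exp (-1) ≤ (1 - 1 / (M : ℝ)) ^ m := by
  rcases Nat.eq_zero_or_pos m with rfl | hm
  · simp
  obtain ⟨k, rfl⟩ : ∃ k, M = k + 1 := ⟨M - 1, by omega⟩
  have hk : (0 : ℝ) < k := by exact_mod_cast (by omega : 0 < k)
  have hx0 : (0 : ℝ) ≤ 1 - 1 / ((k + 1 : ℕ) : ℝ) := by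
    rw [sub_nonneg, div_le_one (by positivity)]
    push_cast
    linarith
  have hx1 : (1 : ℝ) - 1 / ((k + 1 : ℕ) : ℝ) ≤ 1 := by
    have : (0 : ℝ) ≤ 1 / ((k + 1 : ℕ) : ℝ) := by positivity
    linarith
  refine le_trans ?_ (pow_le_pow_of_le_one hx0 hx1 (by omega : m ≤ k))
  have h1 : (1 : ℝ) - 1 / ((k + 1 : ℕ) : ℝ) = (1 + 1 / (k : ℝ))⁻¹ := by
    push_cast
    field_simp
    ring
  rw [h1, inv_pow, Real.exp_neg]
  refine inv_anti₀ (by positivity) ?_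
  have h2 : 1 + 1 / (k : ℝ) ≤ Real.exp (1 / k) := by
    linarith [Real.add_one_le_exp (1 / (k : ℝ))]
  calc (1 + 1 / (k : ℝ)) ^ k ≤ Real.exp (1 / k) ^ k := by gcongr
    _ = Real.exp 1 := by rw [← Real.exp_nat_mul]; field_simp

/-- Maps `h : ρ → τ` in which every element sent to `S`, with at most one exception, is itself
hit by `h`. -/
theorem card_filter_hit_le {ρ τ : Type*} [Fintype ρ] [DecidableEq ρ] [Fintype τ]
    [DecidableEq τ] (j : ρ → τ) (hj : Function.Injective j) (S : Finset τ) (hjS : ∀ r, j r ∉ S)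
    (E : Finset ρ) (hE : E.card ≤ 1) (M : ℕ) (hM : Fintype.card τ = M + S.card)
    (hρ : Fintype.card ρ + 1 ≤ M) :
    ((univ.filter fun h : ρ → τ => ∀ r, h r ∈ S → r ∈ E ∨ ∃ r', h r' = j r).card : ℝ) ≤
      (1 - Real.exp (-1))⁻¹ * (M + S.card * (1 - Real.exp (-1))) ^ Fintype.card ρ := by
  set θ : ℝ := 1 - Real.exp (-1) with hθ
  have hθ0 : 0 < θ := by
    have : Real.exp (-1) < 1 := by simp
    linarith
  have hθ1 : θ ≤ 1 := by
    have := (Real.exp_pos (-1)).le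
    linarith
  have hfib : ∀ B : Finset ρ, ((univ.filter fun h : ρ → τ => (∀ r, h r ∈ S → r ∈ E ∨ ∃ r', h r' = j r) ∧
      univ.filter (fun r => h r ∈ S) = B).card : ℝ) ≤
      (S.card * θ) ^ B.card * (M : ℝ) ^ (Fintype.card ρ - B.card) * θ⁻¹ := by
    intro B
    have hcompl : Fintype.card {t // t ∉ S} = M := by
      rw [Fintype.card_subtype_compl, Fintype.card_coe, hM, Nat.add_sub_cancel]
    have hne : Nonempty {t // t ∉ S} := Fintype.card_pos_iff.1 (by omega)
    have hcardB : Fintype.card {r // r ∉ B} = Fintype.card ρ - B.card := by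
      rw [Fintype.card_subtype_compl, Fintype.card_coe]
    set B' : Finset {t // t ∉ S} := (B \ E).image fun r => ⟨j r, hjS r⟩ with hB'
    have hB'card : B'.card = (B \ E).card :=
      card_image_of_injective _ fun a b h => hj (Subtype.mk.inj h)
    have hcount : (univ.filter fun h : ρ → τ => (∀ r, h r ∈ S → r ∈ E ∨ ∃ r', h r' = j r) ∧
        univ.filter (fun r => h r ∈ S) = B).card ≤
        ((univ : Finset (B → S)) ×ˢ
          (univ.filter fun h : {r // r ∉ B} → {t // t ∉ S} => ∀ b ∈ B', ∃ r, h r = b)).card := by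
      refine (card_le_card (t := image (fun p : (B → S) × ({r // r ∉ B} → {t // t ∉ S}) =>
        fun r => if hr : r ∈ B then (p.1 ⟨r, hr⟩ : τ) else p.2 ⟨r, hr⟩) _) ?_).trans card_image_le
      intro h hh
      obtain ⟨hh1, hh2⟩ := (mem_filter.1 hh).2
      have hm : ∀ r, r ∈ B ↔ h r ∈ S := fun r => by rw [← hh2]; simp
      refine mem_image.2 ⟨(fun r => ⟨h r, (hm r).1 r.2⟩,
        fun r => ⟨h r, fun hr => r.2 ((hm r).2 hr)⟩), ?_, ?_⟩
      · simp only [mem_product, mem_univ, mem_filter, true_and]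
        intro b hb
        obtain ⟨r, hr, rfl⟩ := mem_image.1 hb
        rw [Finset.mem_sdiff] at hr
        obtain ⟨r', hr'⟩ := (hh1 r ((hm r).1 hr.1)).resolve_left hr.2
        exact ⟨⟨r', fun hB => hjS r (hr' ▸ (hm r').1 hB)⟩, Subtype.ext hr'⟩
      · funext r
        by_cases hr : r ∈ B <;> simp [hr]
    refine (Nat.cast_le.2 hcount).trans ?_
    rw [card_product, card_univ, Fintype.card_fun, Fintype.card_coe, Fintype.card_coe]
    push_cast
    have h1 := card_filter_forall_exists_le (ρ := {r // r ∉ B}) B'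
    rw [hcompl, hcardB, hB'card] at h1
    have h2 : (1 : ℝ) - (1 - 1 / (M : ℝ)) ^ (Fintype.card ρ - B.card) ≤ θ := by
      have := exp_neg_one_le_one_sub_inv_pow (M := M) (m := Fintype.card ρ - B.card) (by omega)
      linarith
    have hM1 : (1 : ℝ) ≤ M := by exact_mod_cast (by omega : 1 ≤ M)
    have hx0 : (0 : ℝ) ≤ 1 - 1 / (M : ℝ) := by
      rw [sub_nonneg, div_le_one (by linarith)]; exact hM1
    have hx1 : (1 : ℝ) - 1 / (M : ℝ) ≤ 1 := by
      have : (0 : ℝ) ≤ 1 / (M : ℝ) := by positivity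
      linarith
    have h3 : (0 : ℝ) ≤ 1 - (1 - 1 / (M : ℝ)) ^ (Fintype.card ρ - B.card) :=
      sub_nonneg.2 (pow_le_one₀ hx0 hx1)
    have h4 : (1 - (1 - 1 / (M : ℝ)) ^ (Fintype.card ρ - B.card)) ^ (B \ E).card ≤
        θ ^ B.card * θ⁻¹ := by
      refine (pow_le_pow_left₀ h3 h2 _).trans ?_
      rw [← div_eq_mul_inv, le_div_iff₀ hθ0, ← pow_succ]
      refine pow_le_pow_of_le_one hθ0.le hθ1 ?_
      have := le_card_sdiff E B
      omega
    calc (S.card : ℝ) ^ B.card * _ ≤ (S.card : ℝ) ^ B.card *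
          ((M : ℝ) ^ (Fintype.card ρ - B.card) * (θ ^ B.card * θ⁻¹)) := by
          refine mul_le_mul_of_nonneg_left (h1.trans ?_) (by positivity)
          exact mul_le_mul_of_nonneg_left h4 (by positivity)
      _ = _ := by rw [mul_pow]; ring
  have hsum : ((univ.filter fun h : ρ → τ => ∀ r, h r ∈ S → r ∈ E ∨ ∃ r', h r' = j r).card : ℝ) =
      ∑ B : Finset ρ, ((univ.filter fun h : ρ → τ =>
        (∀ r, h r ∈ S → r ∈ E ∨ ∃ r', h r' = j r) ∧
        univ.filter (fun r => h r ∈ S) = B).card : ℝ) := by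
    rw [← Nat.cast_sum, card_eq_sum_card_fiberwise (f := fun h => univ.filter fun r => h r ∈ S)
      (t := univ) (fun _ _ => mem_coe.2 (mem_univ _))]
    simp only [filter_filter]
  rw [hsum]
  refine (sum_le_sum fun B _ => hfib B).trans (le_of_eq ?_)
  rw [← sum_mul, Fintype.sum_pow_mul_eq_add_pow]
  ring

/-- The elements `a` outside `E` which `f` sends to `p` and whose copy `j a` is not hit by `f`. -/
def leafChildren {α V : Type*} [Fintype α] [DecidableEq α] [DecidableEq V]
    (j : α → V) (E : Finset α) (f : α → V) (p : V) : Finset α :=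
  univ.filter fun a => f a = p ∧ a ∉ E ∧ ∀ a', f a' ≠ j a

theorem card_filter_leafChildren_eq_le {α V κ : Type*} [Fintype α] [DecidableEq α] [Fintype V]
    [DecidableEq V] [Fintype κ] {j : α → V} (hj : Function.Injective j) {z : κ → V}
    (hz : Function.Injective z) (hzj : ∀ k a, j a ≠ z k) {E : Finset α} (hE : E.card ≤ 1)
    (hcard : Fintype.card α + 1 + Fintype.card κ ≤ Fintype.card V) (A : κ → Finset α)
    (hA : (univ.filter fun f => ∀ k, leafChildren j E f (z k) = A k).Nonempty) :
    ∑ k, (A k).card ≤ Fintype.card α ∧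
    ((univ.filter fun f => ∀ k, leafChildren j E f (z k) = A k).card : ℝ) ≤
      (1 - Real.exp (-1))⁻¹ * (Fintype.card V - (∑ k, (A k).card : ℕ) -
        Fintype.card κ * Real.exp (-1)) ^ (Fintype.card α - ∑ k, (A k).card) := by
  classical
  obtain ⟨f₀, hf₀⟩ := hA
  have hmem : ∀ f ∈ univ.filter (fun f => ∀ k, leafChildren j E f (z k) = A k), ∀ k a,
      a ∈ A k ↔ f a = z k ∧ a ∉ E ∧ ∀ a', f a' ≠ j a := by
    intro f hf k a
    rw [← (mem_filter.1 hf).2 k]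
    simp [leafChildren]
  set Y := univ.biUnion A with hY
  have hYcard : Y.card = ∑ k, (A k).card := by
    refine card_biUnion fun k _ k' _ hkk => disjoint_left.2 fun a ha ha' => hkk (hz ?_)
    rw [← ((hmem f₀ hf₀ k a).1 ha).1, ((hmem f₀ hf₀ k' a).1 ha').1]
  have hmY : ∀ a, a ∈ Y ↔ ∃ k, a ∈ A k := fun a => by simp [hY]
  have hYle : Y.card ≤ Fintype.card α := card_le_univ _
  refine ⟨hYcard ▸ hYle, ?_⟩
  have hR : Fintype.card {a // a ∉ Y} = Fintype.card α - Y.card := by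
    rw [Fintype.card_subtype_compl, Fintype.card_coe]
  have hτ : Fintype.card {v // v ∉ Y.image j} = Fintype.card V - Y.card := by
    rw [Fintype.card_subtype_compl, Fintype.card_coe, card_image_of_injective _ hj]
  have hzY : ∀ k, z k ∉ Y.image j := fun k h => by
    obtain ⟨a, -, ha⟩ := mem_image.1 h
    exact hzj k a ha
  have hjY : ∀ a : {a // a ∉ Y}, j a ∉ Y.image j := fun a h => by
    obtain ⟨b, hb, hba⟩ := mem_image.1 h
    exact a.2 (hj hba ▸ hb)
  set S : Finset {v // v ∉ Y.image j} := univ.image fun k => ⟨z k, hzY k⟩ with hS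
  have hScard : S.card = Fintype.card κ := by
    rw [hS, card_image_of_injective _ fun a b h => hz (Subtype.mk.inj h), card_univ]
  have hmS : ∀ t, t ∈ S ↔ ∃ k, z k = t := fun t => by simp [hS, Subtype.ext_iff]
  have hbound := card_filter_hit_le (ρ := {a // a ∉ Y}) (τ := {v // v ∉ Y.image j})
    (fun a => ⟨j a, hjY a⟩) (fun a b h => Subtype.ext (hj (Subtype.mk.inj h))) S
    (fun a h => by obtain ⟨k, hk⟩ := (hmS _).1 h; exact hzj k a hk.symm)
    (E.subtype fun a => a ∉ Y)
    ((card_subtype _ _).trans_le ((card_filter_le _ _).trans hE))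
    (Fintype.card V - Y.card - Fintype.card κ) (by rw [hτ, hScard]; omega) (by rw [hR]; omega)
  rw [hR, hScard, hYcard] at hbound
  have hcast : ((Fintype.card V - ∑ k, (A k).card - Fintype.card κ : ℕ) : ℝ) +
      Fintype.card κ * (1 - Real.exp (-1)) =
      Fintype.card V - (∑ k, (A k).card : ℕ) - Fintype.card κ * Real.exp (-1) := by
    rw [← hYcard, Nat.cast_sub (by omega), Nat.cast_sub (by omega)]
    ring
  rw [hcast] at hbound
  refine le_trans (Nat.cast_le.2 ?_) hbound
  refine (card_le_card (t := image (fun (h : {a // a ∉ Y} → {v // v ∉ Y.image j}) a =>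
    if ha : a ∈ Y then f₀ a else (h ⟨a, ha⟩ : V)) _) ?_).trans card_image_le
  intro f hf
  refine mem_image.2 ⟨fun a => ⟨f a, fun h => ?_⟩, ?_, ?_⟩
  · obtain ⟨b, hb, hba⟩ := mem_image.1 h
    obtain ⟨k, hk⟩ := (hmY b).1 hb
    exact ((hmem f hf k b).1 hk).2.2 a hba.symm
  · simp only [mem_filter, mem_univ, true_and, mem_subtype]
    intro r hr
    obtain ⟨k, hk⟩ := (hmS _).1 hr
    by_contra! hcon
    refine r.2 ((hmY _).2 ⟨k, (hmem f hf k r).2 ⟨hk.symm, hcon.1, fun a' ha' => ?_⟩⟩)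
    by_cases haY : a' ∈ Y
    · obtain ⟨k', hk'⟩ := (hmY _).1 haY
      exact hzj k' r (((hmem f hf k' a').1 hk').1 ▸ ha').symm
    · exact hcon.2 ⟨a', haY⟩ (Subtype.ext ha')
  · funext a
    by_cases ha : a ∈ Y
    · obtain ⟨k, hk⟩ := (hmY _).1 ha
      simp only [ha, dif_pos]
      rw [((hmem f hf k a).1 hk).1, ((hmem f₀ hf₀ k a).1 hk).1]
    · simp [ha]

theorem sub_pow_le_of_mul_le {n m a : ℕ} {u K : ℝ} (ha : a ≤ m) (hn : 0 < n)
    (hu0 : 0 ≤ u) (hu : u + m ≤ n) (hK : (K + u) * (n - m + K) ≤ n) :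
    ((n : ℝ) - a - u) ^ (m - a) ≤ (n : ℝ) ^ m *
      (Real.exp 1 * Real.exp (-u) * (Real.exp (-1) / n) ^ a +
        Real.exp (-K) * (Real.exp 1 / n) ^ a) := by
  have hn' : (0 : ℝ) < n := by exact_mod_cast hn
  have ha' : (a : ℝ) ≤ m := by exact_mod_cast ha
  have ha0 : (0 : ℝ) ≤ a := a.cast_nonneg
  have hbase : (0 : ℝ) ≤ n - a - u := by linarith
  have hpow : (n : ℝ) ^ m = n ^ (m - a) * n ^ a := by rw [← pow_add]; congr 1; omega
  have hexp : ∀ t : ℝ, Real.exp t ^ a = Real.exp (a * t) := fun t => (Real.exp_nat_mul t a).symm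
  have hrhs : (n : ℝ) ^ m * (Real.exp 1 * Real.exp (-u) * (Real.exp (-1) / n) ^ a +
        Real.exp (-K) * (Real.exp 1 / n) ^ a) =
      (n : ℝ) ^ (m - a) * (Real.exp (1 - u - a) + Real.exp (a - K)) := by
    rw [hpow, div_pow, div_pow, hexp, hexp]
    have h1 : Real.exp (1 - u - a) = Real.exp 1 * Real.exp (-u) * Real.exp (a * -1) := by
      rw [← Real.exp_add, ← Real.exp_add]; ring_nf
    have h2 : Real.exp (a - K) = Real.exp (-K) * Real.exp (a * 1) := by
      rw [← Real.exp_add]; ring_nf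
    rw [h1, h2]
    field_simp
  rw [hrhs]
  rcases le_or_gt (a : ℝ) K with hc | hc
  · refine le_trans ?_ (mul_le_mul_of_nonneg_left
      (le_add_of_nonneg_right (Real.exp_pos _).le) (by positivity))
    have h1 : (n : ℝ) - a - u ≤ n * Real.exp (-((a + u) / n)) := by
      have := Real.add_one_le_exp (-((a + u) / (n : ℝ)))
      calc (n : ℝ) - a - u = n * (-((a + u) / n) + 1) := by field_simp; ring
        _ ≤ _ := by gcongr
    refine (pow_le_pow_left₀ hbase h1 _).trans ?_
    rw [mul_pow, ← Real.exp_nat_mul, Nat.cast_sub ha]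
    gcongr
    have h2 : (a + u) * (n - m + a) ≤ (n : ℝ) := by
      have hKu : 0 ≤ K + u := by linarith
      refine le_trans ?_ hK
      refine mul_le_mul (by linarith) (by linarith) (by linarith) hKu
    have h3 : ((m : ℝ) - a) * -((a + u) / n) = (a + u) * (n - m + a) / n - u - a := by
      field_simp
      ring
    have h4 : (a + u) * (n - m + a) / (n : ℝ) ≤ 1 := (div_le_one hn').2 h2
    rw [h3]
    linarith
  · refine le_trans (pow_le_pow_left₀ hbase (by linarith : (n : ℝ) - a - u ≤ n) _) ?_
    refine le_mul_of_one_le_right (by positivity) ?_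
    have h1 : 1 ≤ Real.exp (a - K) := Real.one_le_exp (by linarith)
    linarith [Real.exp_pos (1 - u - (a : ℝ))]

theorem sum_pow_card_pair_of_nonempty_iff {α : Type*} [Fintype α] [DecidableEq α] (w : ℝ) :
    (∑ p : Finset α × Finset α,
      if (p.1.Nonempty ↔ p.2.Nonempty) then w ^ p.1.card * w ^ p.2.card else 0) =
      ((1 + w) ^ Fintype.card α - 1) ^ 2 + 1 := by
  have htot : ∑ A : Finset α, w ^ A.card = (1 + w) ^ Fintype.card α := by
    have := Fintype.sum_pow_mul_eq_add_pow α w 1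
    simpa [add_comm] using this
  have hne : ∑ A : Finset α, (if A.Nonempty then w ^ A.card else 0) =
      (1 + w) ^ Fintype.card α - 1 := by
    rw [← htot, eq_sub_iff_add_eq]
    have : (1 : ℝ) = ∑ A : Finset α, if A = ∅ then w ^ A.card else 0 := by simp
    rw [this, ← sum_add_distrib]
    refine sum_congr rfl fun A _ => ?_
    rcases A.eq_empty_or_nonempty with rfl | h
    · simp
    · simp [h, h.ne_empty]
  have hsplit : ∀ p : Finset α × Finset α,
      (if (p.1.Nonempty ↔ p.2.Nonempty) then w ^ p.1.card * w ^ p.2.card else 0) =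
      (if p.1.Nonempty then w ^ p.1.card else 0) * (if p.2.Nonempty then w ^ p.2.card else 0) +
      (if p = (∅, ∅) then 1 else 0) := by
    rintro ⟨A, B⟩
    rcases A.eq_empty_or_nonempty with rfl | hA <;> rcases B.eq_empty_or_nonempty with rfl | hB
    · simp
    · simp [hB, hB.ne_empty]
    · simp [hA, hA.ne_empty]
    · simp [hA, hB, hB.ne_empty]
  simp only [hsplit, sum_add_distrib, sum_ite_eq', mem_univ, if_true]
  have hprod := sum_mul_sum univ univ (fun A : Finset α => if A.Nonempty then w ^ A.card else 0)
    (fun A : Finset α => if A.Nonempty then w ^ A.card else 0)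
  rw [hne] at hprod
  rw [Fintype.sum_prod_type, sq, hprod]

theorem exp_neg_mul_sq_add_one_le {X : ℝ} (h1 : 1 ≤ X) (hX : X ≤ Real.exp (Real.exp (-1))) :
    Real.exp (-(2 * Real.exp (-1))) * ((X - 1) ^ 2 + 1) ≤ Real.exp (-(1 / 2)) := by
  set t := Real.exp (-1) with ht
  set q := Real.exp (-t) with hq
  have ht1 : t < 0.3679 := by
    rw [ht, Real.exp_neg, inv_lt_comm₀ (Real.exp_pos 1) (by norm_num)]
    have := Real.exp_one_gt_d9
    norm_num at this ⊢
    linarith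
  have ht2 : 0.3678 < t := by
    rw [ht, Real.exp_neg, lt_inv_comm₀ (by norm_num) (Real.exp_pos 1)]
    have := Real.exp_one_lt_d9
    norm_num at this ⊢
    linarith
  have hqX : Real.exp (-(2 * t)) * ((Real.exp t - 1) ^ 2 + 1) = (1 - q) ^ 2 + q ^ 2 := by
    have h2 : Real.exp (-(2 * t)) = q ^ 2 := by rw [hq, ← Real.exp_nat_mul]; ring_nf
    have h3 : q * Real.exp t = 1 := by rw [hq, ← Real.exp_add]; simp
    rw [h2]
    linear_combination (q * Real.exp t + 1 - 2 * q) * h3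
  have hmono : Real.exp (-(2 * t)) * ((X - 1) ^ 2 + 1) ≤
      Real.exp (-(2 * t)) * ((Real.exp t - 1) ^ 2 + 1) := by
    gcongr
  refine hmono.trans (hqX.trans_le ?_)
  have hq1 : q ≤ 0.7 := by
    rw [hq, Real.exp_neg]
    refine inv_le_of_inv_le₀ (by norm_num) ?_
    have := Real.quadratic_le_exp_of_nonneg (by linarith : 0 ≤ t)
    refine le_trans ?_ this
    norm_num
    nlinarith
  have hq2 : 0.6 ≤ q := by
    have := Real.add_one_le_exp (-t)
    linarith
  have hhalf : (0.58 : ℝ) ≤ Real.exp (-(1 / 2)) := by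
    rw [Real.exp_neg]
    refine le_inv_of_le_inv₀ (Real.exp_pos _) ?_
    have h4 : Real.exp (1 / 2) ^ 2 = Real.exp 1 := by
      rw [← Real.exp_nat_mul]; norm_num
    have h5 : Real.exp (1 / 2) ≤ 1.7 := by
      refine le_of_sq_le_sq ?_ (by norm_num)
      rw [h4]
      have := Real.exp_one_lt_d9
      norm_num at this ⊢
      linarith
    refine h5.trans (by norm_num)
  nlinarith

theorem card_filter_leafChildren_nonempty_iff_le {α V ι : Type*} [Fintype α] [DecidableEq α]
    [Fintype V] [DecidableEq V] [Fintype ι] [DecidableEq ι] {j : α → V}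
    (hj : Function.Injective j) {x y : ι → V} (hxy : Function.Injective (Sum.elim x y))
    (hxj : ∀ i a, j a ≠ x i) (hyj : ∀ i a, j a ≠ y i) {E : Finset α} (hE : E.card ≤ 1)
    (hcard : Fintype.card α + 1 + 2 * Fintype.card ι ≤ Fintype.card V) {K : ℝ} (hK0 : 0 ≤ K)
    (hK : (K + 2 * Fintype.card ι) * (Fintype.card V - Fintype.card α + K) ≤ Fintype.card V) :
    ((univ.filter fun f : α → V => ∀ i,
      (leafChildren j E f (x i)).Nonempty ↔ (leafChildren j E f (y i)).Nonempty).card : ℝ) ≤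
      (1 - Real.exp (-1))⁻¹ * ((Fintype.card V : ℝ) ^ Fintype.card α *
        (Real.exp 1 * Real.exp (-(Fintype.card ι / 2)) +
          Real.exp (6 * Fintype.card ι - K))) := by
  set n := Fintype.card V with hn
  set m := Fintype.card α with hm
  set s := Fintype.card ι with hs
  have hs0 : (0 : ℝ) ≤ s := s.cast_nonneg
  have hn0 : 0 < n := by omega
  have hn' : (0 : ℝ) < n := by exact_mod_cast hn0
  have hmn : (m : ℝ) + 1 + 2 * s ≤ n := by exact_mod_cast hcard
  have hθ0 : (0 : ℝ) < 1 - Real.exp (-1) := by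
    have : Real.exp (-1) < 1 := by simp
    linarith
  set t := Real.exp (-1) with ht
  have ht0 : 0 < t := Real.exp_pos _
  have ht1 : t ≤ 1 := by linarith
  set u : ℝ := 2 * s * t with hu
  have hu0 : 0 ≤ u := by positivity
  have hu2 : u ≤ 2 * s := by
    rw [hu]
    exact mul_le_of_le_one_right (by positivity) ht1
  set P : (ι → Finset α × Finset α) → Prop := fun A => ∀ i, (A i).1.Nonempty ↔ (A i).2.Nonempty
    with hP
  set L : (α → V) → ι → Finset α × Finset α :=
    fun f i => (leafChildren j E f (x i), leafChildren j E f (y i)) with hL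
  set w : ℝ → (ι → Finset α × Finset α) → ℝ := fun v A =>
    ∏ i, if ((A i).1.Nonempty ↔ (A i).2.Nonempty) then v ^ (A i).1.card * v ^ (A i).2.card else 0
    with hw
  have hwnn : ∀ v A, 0 ≤ v → 0 ≤ w v A := fun v A hv => prod_nonneg fun i _ => by
    split_ifs <;> positivity
  have hwP : ∀ v A, P A → w v A = v ^ (∑ i, (A i).1.card + ∑ i, (A i).2.card) := by
    intro v A hA
    rw [pow_add, ← prod_pow_eq_pow_sum, ← prod_pow_eq_pow_sum, ← prod_mul_distrib]
    exact prod_congr rfl fun i _ => if_pos (hA i)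
  have hwsum : ∀ v, ∑ A, w v A = (((1 + v) ^ m - 1) ^ 2 + 1) ^ s := by
    intro v
    rw [← sum_pow_card_pair_of_nonempty_iff, ← Fintype.piFinset_univ, hw]
    rw [← prod_univ_sum (fun _ => univ) (fun (_ : ι) (p : Finset α × Finset α) =>
      if (p.1.Nonempty ↔ p.2.Nonempty) then v ^ p.1.card * v ^ p.2.card else 0)]
    rw [prod_const, card_univ]
  have hfib : ∀ A, ((univ.filter fun f : α → V => P (L f) ∧ L f = A).card : ℝ) ≤
      (1 - t)⁻¹ * ((n : ℝ) ^ m * (Real.exp 1 * Real.exp (-u) * w (t / n) A +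
        Real.exp (-K) * w (Real.exp 1 / n) A)) := by
    intro A
    have hw1 := hwnn (t / n) A (by positivity)
    have hw2 := hwnn (Real.exp 1 / n) A (by positivity)
    rcases (univ.filter fun f : α → V => P (L f) ∧ L f = A).eq_empty_or_nonempty with h0 | hne
    · rw [h0, card_empty, Nat.cast_zero]
      positivity
    · have hPA : P A := by
        obtain ⟨f, hf⟩ := hne
        obtain ⟨h1, h2⟩ := (mem_filter.1 hf).2
        exact h2 ▸ h1
      have hsub : (univ.filter fun f : α → V => P (L f) ∧ L f = A) ⊆
          univ.filter fun f => ∀ k, leafChildren j E f (Sum.elim x y k) =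
            Sum.elim (fun i => (A i).1) (fun i => (A i).2) k := by
        intro f hf
        have h2 := (mem_filter.1 hf).2.2
        refine mem_filter.2 ⟨mem_univ _, ?_⟩
        rintro (i | i) <;> simp [← h2, hL]
      obtain ⟨hle, hb⟩ := card_filter_leafChildren_eq_le hj hxy
        (by rintro (i | i) a; exacts [hxj i a, hyj i a]) hE
        (by rw [Fintype.card_sum]; omega) _ (hne.mono hsub)
      rw [Fintype.sum_sum_type] at hle hb
      simp only [Sum.elim_inl, Sum.elim_inr] at hle hb
      refine (Nat.cast_le.2 (card_le_card hsub)).trans (hb.trans ?_)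
      refine mul_le_mul_of_nonneg_left ?_ (inv_pos.2 hθ0).le
      rw [hwP _ _ hPA, hwP _ _ hPA]
      have hcu : ((Fintype.card (ι ⊕ ι) : ℕ) : ℝ) * Real.exp (-1) = u := by
        rw [Fintype.card_sum, hu]
        push_cast
        ring
      rw [hcu]
      refine sub_pow_le_of_mul_le hle hn0 hu0 (by linarith) (le_trans ?_ hK)
      gcongr
      linarith
  have hsum : ((univ.filter fun f : α → V => P (L f)).card : ℝ) =
      ∑ A, ((univ.filter fun f : α → V => P (L f) ∧ L f = A).card : ℝ) := by
    rw [← Nat.cast_sum, card_eq_sum_card_fiberwise (f := L)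
      (t := univ) (fun _ _ => mem_coe.2 (mem_univ _))]
    simp only [filter_filter]
  have hX : ∀ v : ℝ, 0 ≤ v → 1 ≤ (1 + v / n) ^ m ∧ (1 + v / n) ^ m ≤ Real.exp v := by
    intro v hv
    have hvn : 0 ≤ v / n := by positivity
    refine ⟨one_le_pow₀ (by linarith), ?_⟩
    have h1 : 1 + v / n ≤ Real.exp (v / n) := by linarith [Real.add_one_le_exp (v / (n : ℝ))]
    refine (pow_le_pow_left₀ (by positivity) h1 m).trans ?_
    rw [← Real.exp_nat_mul]
    gcongr
    rw [mul_div_assoc', div_le_iff₀ hn', mul_comm]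
    gcongr
    linarith
  change ((univ.filter fun f : α → V => P (L f)).card : ℝ) ≤ _
  rw [hsum]
  refine (sum_le_sum fun A _ => hfib A).trans ?_
  rw [← mul_sum, ← mul_sum, sum_add_distrib, ← mul_sum, ← mul_sum, hwsum, hwsum]
  have hinv : 0 ≤ (1 - t)⁻¹ := (inv_pos.2 hθ0).le
  gcongr ?_ * (?_ * (?_ + ?_))
  · rw [mul_assoc]
    gcongr
    obtain ⟨hX1, hX2⟩ := hX t ht0.le
    have h1 := exp_neg_mul_sq_add_one_le hX1 hX2
    have h2 := pow_le_pow_left₀ (by positivity) h1 s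
    rw [mul_pow, ← Real.exp_nat_mul, ← Real.exp_nat_mul] at h2
    convert h2 using 2
    · rw [hu, ← ht]; ring_nf
    · ring_nf
  · obtain ⟨hX1, hX2⟩ := hX (Real.exp 1) (Real.exp_pos _).le
    have h1 : ((1 + Real.exp 1 / (n : ℝ)) ^ m - 1) ^ 2 + 1 ≤ Real.exp 6 := by
      have h3 : Real.exp (Real.exp 1) ≤ Real.exp 3 := by
        gcongr
        exact Real.exp_one_lt_three.le
      have h4 : Real.exp 6 = Real.exp 3 ^ 2 := by rw [← Real.exp_nat_mul]; norm_num
      rw [h4]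
      nlinarith
    have h5 : Real.exp (6 * s - K) = Real.exp (-K) * Real.exp (6 * s) := by
      rw [← Real.exp_add]; ring_nf
    rw [h5]
    gcongr
    refine (pow_le_pow_left₀ (by positivity) h1 s).trans (le_of_eq ?_)
    rw [← Real.exp_nat_mul]
    ring_nf

end Counting

section ParentPaths

open Finset

/-- Some child of `v` under the parent function `φ` has no children itself. -/
def HasLeafChild {V : Type*} (φ : V → V) (v : V) : Prop :=
  ∃ w, φ w = v ∧ ∀ u, φ u ≠ w

theorem card_filter_eqOn_le {V ι : Type*} [Fintype V] [DecidableEq V] [Fintype ι]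
    [DecidableEq ι] {D : Finset V} {g : V → V} {c : V} (hg : ∀ v ∈ D, g v ∈ D ∨ g v = c)
    {x y : ι → V} (hxy : Function.Injective (Sum.elim x y)) (hx : ∀ i, x i ∈ D)
    (hy : ∀ i, y i ∈ D) (hcard : 2 * Fintype.card ι + 1 ≤ D.card) {K : ℝ} (hK0 : 0 ≤ K)
    (hK : (K + 2 * Fintype.card ι) * (D.card + K) ≤ Fintype.card V) (S : Finset (V → V))
    (hS : ∀ φ ∈ S, (∀ v ∈ D, φ v = g v) ∧
      ∀ i, (∃ w, w ∉ D ∧ φ w = x i ∧ ∀ u, φ u ≠ w) ↔ (∃ w, w ∉ D ∧ φ w = y i ∧ ∀ u, φ u ≠ w)) :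
    (S.card : ℝ) ≤
      (1 - Real.exp (-1))⁻¹ * ((Fintype.card V : ℝ) ^ (Fintype.card V - D.card) *
        (Real.exp 1 * Real.exp (-(Fintype.card ι / 2)) +
          Real.exp (6 * Fintype.card ι - K))) := by
  classical
  have hα : Fintype.card {v // v ∉ D} = Fintype.card V - D.card := by
    rw [Fintype.card_subtype_compl, Fintype.card_coe]
  have hDV : D.card ≤ Fintype.card V := card_le_univ D
  set E : Finset {v // v ∉ D} := univ.filter fun a => ∃ v ∈ D, g v = a.1 with hE
  have hE1 : E.card ≤ 1 := by
    refine card_le_one.2 fun a ha b hb => ?_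
    have key : ∀ a ∈ E, a.1 = c := by
      intro a ha
      obtain ⟨v, hv, hva⟩ := (mem_filter.1 ha).2
      rcases hg v hv with h | h
      · exact absurd (hva ▸ h) a.2
      · rw [← hva, h]
    exact Subtype.ext ((key a ha).trans (key b hb).symm)
  have hmain := card_filter_leafChildren_nonempty_iff_le (j := (Subtype.val : {v // v ∉ D} → V))
    Subtype.val_injective hxy (fun i a h => a.2 (h ▸ hx i)) (fun i a h => a.2 (h ▸ hy i)) hE1
    (by omega) hK0 (by
      rw [hα, Nat.cast_sub hDV]
      simpa using hK)
  rw [hα] at hmain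
  refine le_trans (Nat.cast_le.2 ?_) hmain
  have hiff : ∀ φ ∈ S, ∀ p, (leafChildren Subtype.val E (fun a => φ a.1) p).Nonempty ↔
      ∃ w, w ∉ D ∧ φ w = p ∧ ∀ u, φ u ≠ w := by
    intro φ hφ p
    have hφD := (hS φ hφ).1
    constructor
    · rintro ⟨a, ha⟩
      obtain ⟨h1, h2, h3⟩ := (mem_filter.1 ha).2
      refine ⟨a.1, a.2, h1, fun u hu => ?_⟩
      by_cases huD : u ∈ D
      · exact h2 (mem_filter.2 ⟨mem_univ _, u, huD, (hφD u huD) ▸ hu⟩)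
      · exact h3 ⟨u, huD⟩ hu
    · rintro ⟨w, hw, h1, h2⟩
      refine ⟨⟨w, hw⟩, mem_filter.2 ⟨mem_univ _, h1, fun h => ?_, fun a => h2 a.1⟩⟩
      obtain ⟨v, hv, hvw⟩ := (mem_filter.1 h).2
      exact h2 v ((hφD v hv).trans hvw)
  refine card_le_card_of_injOn (fun φ a => φ a.1) ?_ ?_
  · intro φ hφ
    have hφ' : φ ∈ S := hφ
    refine mem_coe.2 (mem_filter.2 ⟨mem_univ _, fun i => ?_⟩)
    rw [hiff φ hφ', hiff φ hφ']
    exact (hS φ hφ').2 i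
  · intro φ hφ ψ hψ h
    funext v
    by_cases hv : v ∈ D
    · rw [(hS φ hφ).1 v hv, (hS ψ hψ).1 v hv]
    · exact congrFun h ⟨v, hv⟩

/-- The vertex sequences `p`, `q` of length `r` are injective, and only `q j` may lie on `p`. -/
structure IsCrossing {V : Type*} (r j : ℕ) (p q : ℕ → V) : Prop where
  le : j ≤ r
  inj_left : ∀ a ≤ r, ∀ b ≤ r, p a = p b → a = b
  inj_right : ∀ a ≤ r, ∀ b ≤ r, q a = q b → a = b
  ne : ∀ i ≤ r, i ≠ j → ∀ a ≤ r, q i ≠ p a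

/-- The parent function `φ` has root `p 0`, descends along `p`, ascends along `q` up to `q j` and
descends along `q` afterwards, and `p i`, `q i` simultaneously have a leaf child. -/
structure IsParentFor {V : Type*} (r j : ℕ) (p q : ℕ → V) (φ : V → V) : Prop where
  root : φ (p 0) = p 0
  left : ∀ i < r, φ (p (i + 1)) = p i
  right_up : ∀ i < j, φ (q i) = q (i + 1)
  right_down : ∀ i < r, j ≤ i → φ (q (i + 1)) = q i
  iff : ∀ i ≤ r, p i ≠ p 1 → q i ≠ p 1 → (HasLeafChild φ (p i) ↔ HasLeafChild φ (q i))

theorem card_isParentFor_le {V : Type*} [Fintype V] [DecidableEq V] {r j : ℕ} {p q : ℕ → V}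
    (h : IsCrossing r j p q) (hr : 12 * (r : ℝ) * (12 * r + 1) ≤ Fintype.card V)
    (S : Finset (V → V)) (hS : ∀ φ ∈ S, IsParentFor r j p q φ) :
    (S.card : ℝ) ≤ (1 - Real.exp (-1))⁻¹ * (Real.exp (7 / 2) + 1) *
      ((Fintype.card V : ℝ) ^ (Fintype.card V - (2 * r + 1)) * Real.exp (-(r / 2))) := by
  classical
  have hθ0 : (0 : ℝ) < 1 - Real.exp (-1) := by
    have : Real.exp (-1) < 1 := by simp
    linarith
  rcases S.eq_empty_or_nonempty with rfl | ⟨g, hgS⟩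
  · rw [card_empty, Nat.cast_zero]
    positivity
  have hg := hS g hgS
  set D : Finset V := (range (r + 1)).image p ∪ ((range (r + 1)).erase j).image q with hD
  have hmemD : ∀ v, v ∈ D ↔ (∃ a ≤ r, p a = v) ∨ ∃ a ≤ r, a ≠ j ∧ q a = v := by
    intro v
    simp only [hD, mem_union, mem_image, mem_erase, mem_range, Nat.lt_succ_iff]
    grind
  have hDcard : D.card = 2 * r + 1 := by
    rw [hD, card_union_of_disjoint, card_image_of_injOn, card_image_of_injOn, card_erase_of_mem,
      card_range]
    · omega
    · exact mem_range.2 (Nat.lt_succ_of_le h.le)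
    · intro a ha b hb hab
      simp only [coe_erase, coe_range, Set.mem_sdiff, Set.mem_Iio] at ha hb
      exact h.inj_right a (by omega) b (by omega) hab
    · intro a ha b hb hab
      simp only [coe_range, Set.mem_Iio] at ha hb
      exact h.inj_left a (by omega) b (by omega) hab
    · rw [disjoint_left]
      intro v hv hv'
      simp only [mem_image, mem_erase, mem_range, Nat.lt_succ_iff] at hv hv'
      obtain ⟨a, ha, rfl⟩ := hv
      obtain ⟨b, ⟨hb1, hb2⟩, hb⟩ := hv'
      exact h.ne b hb2 hb1 a ha hb
  set I : Finset ℕ := (Icc 2 (r - 2)).filter fun i => i ≠ j ∧ p i ≠ q j with hI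
  have hmemI : ∀ i, i ∈ I → 2 ≤ i ∧ i + 2 ≤ r ∧ i ≠ j ∧ p i ≠ q j := by
    intro i hi
    rw [hI, mem_filter, mem_Icc] at hi
    refine ⟨hi.1.1, by omega, hi.2⟩
  have hIle : I.card ≤ r := by
    refine (card_le_card (filter_subset _ _)).trans ?_
    rw [Nat.card_Icc]
    omega
  have hIge : r ≤ I.card + 5 := by
    have h1 : Icc 2 (r - 2) ⊆ I ∪ ({j} ∪ (Icc 2 (r - 2)).filter fun i => p i = q j) := by
      intro i hi
      simp only [hI, mem_union, mem_filter, mem_singleton]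
      tauto
    have h2 : ((Icc 2 (r - 2)).filter fun i => p i = q j).card ≤ 1 := by
      refine card_le_one.2 fun a ha b hb => ?_
      rw [mem_filter, mem_Icc] at ha hb
      exact h.inj_left a (by omega) b (by omega) (ha.2.trans hb.2.symm)
    have h3 := (card_le_card h1).trans (card_union_le _ _)
    have h4 := card_union_le {j} ((Icc 2 (r - 2)).filter fun i => p i = q j)
    rw [card_singleton] at h4
    rw [Nat.card_Icc] at h3
    omega
  have hgD : ∀ v ∈ D, g v ∈ D ∨ g v = q j := by
    intro v hv
    rcases (hmemD v).1 hv with ⟨a, ha, rfl⟩ | ⟨a, ha, haj, rfl⟩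
    · left
      rw [hmemD]
      left
      rcases a with _ | a
      · exact ⟨0, by omega, hg.root.symm⟩
      · exact ⟨a, by omega, (hg.left a (by omega)).symm⟩
    · have hq : ∀ b ≤ r, q b ∈ D ∨ q b = q j := by
        intro b hb
        by_cases hbj : b = j
        · right; rw [hbj]
        · left; exact (hmemD _).2 (Or.inr ⟨b, hb, hbj, rfl⟩)
      rcases lt_or_gt_of_ne haj with hlt | hlt
      · rw [hg.right_up a hlt]
        exact hq _ (by have := h.le; omega)
      · obtain ⟨b, rfl⟩ : ∃ b, a = b + 1 := ⟨a - 1, by omega⟩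
        rw [hg.right_down b (by omega) (by omega)]
        exact hq _ (by omega)
  have hφD : ∀ φ ∈ S, ∀ v ∈ D, φ v = g v := by
    intro φ hφ v hv
    have hf := hS φ hφ
    rcases (hmemD v).1 hv with ⟨a, ha, rfl⟩ | ⟨a, ha, haj, rfl⟩
    · rcases a with _ | a
      · rw [hf.root, hg.root]
      · rw [hf.left a (by omega), hg.left a (by omega)]
    · rcases lt_or_gt_of_ne haj with hlt | hlt
      · rw [hg.right_up a hlt, hf.right_up a hlt]
      · obtain ⟨b, rfl⟩ : ∃ b, a = b + 1 := ⟨a - 1, by omega⟩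
        rw [hg.right_down b (by omega) (by omega), hf.right_down b (by omega) (by omega)]
  have hpD : ∀ φ ∈ S, ∀ i ∈ I, ∀ w ∈ D, φ w = p i → ∃ u, φ u = w := by
    intro φ hφ i hi w hw hwi
    have hf := hS φ hφ
    obtain ⟨hi1, hi2, hij, hiq⟩ := hmemI i hi
    rcases (hmemD w).1 hw with ⟨a, ha, rfl⟩ | ⟨a, ha, haj, rfl⟩
    · rcases a with _ | a
      · exact ⟨_, hf.root⟩
      · rw [hf.left a (by omega)] at hwi
        obtain rfl := h.inj_left a (by omega) i (by omega) hwi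
        exact ⟨_, hf.left (a + 1) (by omega)⟩
    · exfalso
      have hq : ∀ b ≤ r, q b ≠ p i := by
        intro b hb hbi
        by_cases hbj : b = j
        · exact hiq (hbj ▸ hbi.symm)
        · exact h.ne b hb hbj i (by omega) hbi
      rcases lt_or_gt_of_ne haj with hlt | hlt
      · rw [hf.right_up a hlt] at hwi
        exact hq _ (by have := h.le; omega) hwi
      · obtain ⟨b, rfl⟩ : ∃ b, a = b + 1 := ⟨a - 1, by omega⟩
        rw [hf.right_down b (by omega) (by omega)] at hwi
        exact hq _ (by omega) hwi
  have hqD : ∀ φ ∈ S, ∀ i ∈ I, ∀ w ∈ D, φ w = q i → ∃ u, φ u = w := by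
    intro φ hφ i hi w hw hwi
    have hf := hS φ hφ
    obtain ⟨hi1, hi2, hij, hiq⟩ := hmemI i hi
    rcases (hmemD w).1 hw with ⟨a, ha, rfl⟩ | ⟨a, ha, haj, rfl⟩
    · rcases a with _ | a
      · exact ⟨_, hf.root⟩
      · rw [hf.left a (by omega)] at hwi
        exact absurd hwi.symm (h.ne i (by omega) hij a (by omega))
    · have hjr := h.le
      rcases lt_or_gt_of_ne haj with hlt | hlt
      · rw [hf.right_up a hlt] at hwi
        obtain rfl := h.inj_right (a + 1) (by omega) i (by omega) hwi
        obtain ⟨b, rfl⟩ : ∃ b, a = b + 1 := ⟨a - 1, by omega⟩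
        exact ⟨_, hf.right_up b (by omega)⟩
      · obtain ⟨b, rfl⟩ : ∃ b, a = b + 1 := ⟨a - 1, by omega⟩
        rw [hf.right_down b (by omega) (by omega)] at hwi
        obtain rfl := h.inj_right b (by omega) i (by omega) hwi
        exact ⟨_, hf.right_down (b + 1) (by omega) (by omega)⟩
  have hx : ∀ i : I, p i.1 ∈ D := fun i => (hmemD _).2
    (Or.inl ⟨i.1, by have := hmemI i.1 i.2; omega, rfl⟩)
  have hy : ∀ i : I, q i.1 ∈ D := fun i => (hmemD _).2
    (Or.inr ⟨i.1, by have := hmemI i.1 i.2; omega, (hmemI i.1 i.2).2.2.1, rfl⟩)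
  have hxy : Function.Injective (Sum.elim (fun i : I => p i.1) (fun i : I => q i.1)) := by
    refine Function.Injective.sumElim ?_ ?_ ?_
    · intro a b hab
      have ha := hmemI a.1 a.2
      have hb := hmemI b.1 b.2
      exact Subtype.ext (h.inj_left a.1 (by omega) b.1 (by omega) hab)
    · intro a b hab
      have ha := hmemI a.1 a.2
      have hb := hmemI b.1 b.2
      exact Subtype.ext (h.inj_right a.1 (by omega) b.1 (by omega) hab)
    · intro a b hab
      have ha := hmemI a.1 a.2
      have hb := hmemI b.1 b.2
      exact h.ne b.1 (by omega) hb.2.2.1 a.1 (by omega) hab.symm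
  have hIle' : (I.card : ℝ) ≤ r := by exact_mod_cast hIle
  have hIge' : (r : ℝ) ≤ I.card + 5 := by exact_mod_cast hIge
  have hr0 : (0 : ℝ) ≤ r := r.cast_nonneg
  have hmain := card_filter_eqOn_le (K := 10 * r) hgD hxy hx hy
    (by rw [Fintype.card_coe, hDcard]; omega) (by positivity)
    (by
      rw [Fintype.card_coe, hDcard]
      refine le_trans ?_ hr
      push_cast
      exact mul_le_mul (by linarith) (by linarith) (by positivity) (by positivity)) S (by
      intro φ hφ
      refine ⟨hφD φ hφ, fun i => ?_⟩
      have hi := hmemI i.1 i.2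
      have hiff := (hS φ hφ).iff i.1 (by omega)
        (fun hc => by have := h.inj_left _ (by omega) _ (by omega) hc; omega)
        (h.ne _ (by omega) hi.2.2.1 1 (by omega))
      have h1 : (∃ w, w ∉ D ∧ φ w = p i.1 ∧ ∀ u, φ u ≠ w) ↔ HasLeafChild φ (p i.1) := by
        refine ⟨fun ⟨w, _, hw⟩ => ⟨w, hw⟩, fun ⟨w, hw1, hw2⟩ => ⟨w, fun hwD => ?_, hw1, hw2⟩⟩
        obtain ⟨u, hu⟩ := hpD φ hφ i.1 i.2 w hwD hw1
        exact hw2 u hu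
      have h2 : (∃ w, w ∉ D ∧ φ w = q i.1 ∧ ∀ u, φ u ≠ w) ↔ HasLeafChild φ (q i.1) := by
        refine ⟨fun ⟨w, _, hw⟩ => ⟨w, hw⟩, fun ⟨w, hw1, hw2⟩ => ⟨w, fun hwD => ?_, hw1, hw2⟩⟩
        obtain ⟨u, hu⟩ := hqD φ hφ i.1 i.2 w hwD hw1
        exact hw2 u hu
      rw [h1, h2, hiff])
  rw [Fintype.card_coe, hDcard] at hmain
  refine hmain.trans ?_
  have h1 : Real.exp 1 * Real.exp (-((I.card : ℝ) / 2)) ≤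
      Real.exp (7 / 2) * Real.exp (-(r / 2)) := by
    rw [← Real.exp_add, ← Real.exp_add]
    exact Real.exp_le_exp.2 (by linarith)
  have h2 : Real.exp (6 * (I.card : ℝ) - 10 * r) ≤ Real.exp (-(r / 2)) :=
    Real.exp_le_exp.2 (by linarith)
  calc _ ≤ (1 - Real.exp (-1))⁻¹ * ((Fintype.card V : ℝ) ^ (Fintype.card V - (2 * r + 1)) *
        (Real.exp (7 / 2) * Real.exp (-(r / 2)) + Real.exp (-(r / 2)))) := by
        have := (inv_pos.2 hθ0).le
        gcongr
    _ = _ := by ring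

end ParentPaths

section TreeParents

open SimpleGraph

/-- `φ` sends every vertex of the tree `T` to its parent when `T` is rooted at `ρ`. -/
structure IsParentMap {V : Type*} (T : SimpleGraph V) (ρ : V) (φ : V → V) : Prop where
  root : φ ρ = ρ
  adj : ∀ v, v ≠ ρ → T.Adj v (φ v)
  adj_cases : ∀ u v, T.Adj u v → φ u = v ∨ φ v = u
  no_swap : ∀ v, v ≠ ρ → φ (φ v) ≠ v

theorem exists_isParentMap {V : Type*} {T : SimpleGraph V} (hc : T.Connected) (ha : T.IsAcyclic)
    (ρ : V) : ∃ φ, IsParentMap T ρ φ := by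
  have huniq : ∀ {v : V} (a b : T.Walk v ρ), a.IsPath → b.IsPath → a = b := fun a b h1 h2 =>
    congrArg Subtype.val ((ha.subsingleton_path _ _).elim ⟨a, h1⟩ ⟨b, h2⟩)
  choose π hπ using fun v => (hc.preconnected v ρ).exists_isPath
  have hnil : ∀ v, v ≠ ρ → ¬ (π v).Nil := fun v hv h => hv h.eq
  have hroot : π ρ = Walk.nil := huniq _ _ (hπ ρ) Walk.IsPath.nil
  refine ⟨fun v => (π v).snd, by rw [hroot]; rfl, fun v hv => (π v).adj_snd (hnil v hv),
    fun u v huv => ?_, fun v hv h => ?_⟩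
  · by_cases hv : v ∈ (π u).support
    · exact Or.inl (ha.eq_snd_of_adj_start (hπ u) huv hv).symm
    · right
      rw [huniq (π v) (Walk.cons huv.symm (π u)) (hπ v)
        ((Walk.cons_isPath_iff _ _).2 ⟨hπ u, hv⟩), Walk.snd_cons]
  · change (π (π v).snd).snd = v at h
    rw [huniq _ _ (hπ (π v).snd) (hπ v).tail] at h
    have hmem := (π v).tail.getVert_mem_support 1
    have hnodup := (hπ v).support_nodup
    rw [← Walk.cons_support_tail (hnil v hv), List.nodup_cons] at hnodup
    rw [show (π v).tail.getVert 1 = v from h] at hmem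
    exact hnodup.1 hmem

variable {V : Type} {T : SimpleGraph V} {ρ : V} {φ : V → V}

theorem IsParentMap.eq_parentGraph (h : IsParentMap T ρ φ) : parentGraph φ = T := by
  ext a b
  constructor
  · rintro ⟨hne, rfl | rfl⟩
    · exact h.adj a fun hc => hne (by rw [hc, h.root])
    · exact (h.adj b fun hc => hne (by rw [hc, h.root])).symm
  · exact fun hab => ⟨hab.ne, h.adj_cases a b hab⟩

theorem deg_eq_one_iff {w : V} : deg T w = 1 ↔ ∃ p, T.Adj w p ∧ ∀ x, T.Adj w x → x = p := by
  rw [deg, Nat.card_eq_one_iff_unique]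
  constructor
  · rintro ⟨h1, ⟨⟨p, hp⟩⟩⟩
    exact ⟨p, hp, fun x hx => congrArg Subtype.val (Subsingleton.elim (⟨x, hx⟩ : {w' // T.Adj w w'})
      ⟨p, hp⟩)⟩
  · rintro ⟨p, hp, hx⟩
    exact ⟨⟨fun a b => Subtype.ext ((hx _ a.2).trans (hx _ b.2).symm)⟩, ⟨⟨p, hp⟩⟩⟩

theorem IsParentMap.adjToLeaf_iff (h : IsParentMap T ρ φ) {c p : V} (hcρ : c ≠ ρ) (hc : φ c = ρ)
    (hp : p ≠ c) : adjToLeaf T p ↔ HasLeafChild φ p := by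
  constructor
  · rintro ⟨w, hpw, hw⟩
    obtain ⟨p', -, hp'⟩ := deg_eq_one_iff.1 hw
    obtain rfl := hp' p hpw.symm
    rcases h.adj_cases _ _ hpw with hφ | hφ
    · have hpρ : p ≠ ρ := by
        rintro rfl
        exact hpw.ne (h.root.symm.trans hφ)
      by_cases hwρ : w = ρ
      · subst hwρ
        exact absurd (hp' c (hc ▸ h.adj c hcρ).symm).symm hp
      · have := hp' _ (h.adj w hwρ)
        exact absurd (hφ ▸ this) (h.no_swap p hpρ)
    · refine ⟨w, hφ, fun u hu => ?_⟩
      have huρ : u ≠ ρ := by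
        rintro rfl
        rw [h.root] at hu
        subst hu
        exact hpw.ne (hφ.symm.trans h.root)
      have huw := h.adj u huρ
      rw [hu] at huw
      obtain rfl := hp' u huw.symm
      exact h.no_swap u huρ (by rw [hu, hφ])
  · rintro ⟨w, rfl, hw⟩
    have hwρ : w ≠ ρ := fun hc => hw ρ (h.root.trans hc.symm)
    refine ⟨w, (h.adj w hwρ).symm, deg_eq_one_iff.2 ⟨φ w, h.adj w hwρ, fun x hx => ?_⟩⟩
    rcases h.adj_cases _ _ hx with hx | hx
    · exact hx.symm
    · exact absurd hx (hw x)

theorem adjToLeaf_getVert_iff {v w v' w' : V} {P : T.Walk v w} {P' : T.Walk v' w'}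
    (h : check T P = check T P') {i : ℕ} (hi : i ≤ P.length) (hi' : i ≤ P'.length) :
    adjToLeaf T (P.getVert i) ↔ adjToLeaf T (P'.getVert i) := by
  have h1 := congrArg (fun l : List Prop => l[i]?) h
  simp only [check, List.getElem?_map, ← Walk.getVert_eq_support_getElem? _ hi,
    ← Walk.getVert_eq_support_getElem? _ hi', Option.map_some, Option.some.injEq] at h1
  exact h1 ▸ Iff.rfl

theorem exists_isCrossing_isParentFor (hc : T.Connected) (ha : T.IsAcyclic) {v w v' w' : V}
    {P : T.Walk v w} {P' : T.Walk v' w'} (hP : P.IsPath) (hP' : P'.IsPath) {r : ℕ} (hr : 1 ≤ r)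
    (hl : P.length = r) (hl' : P'.length = r)
    (hshare : ∀ x ∈ P.support, x ∈ P'.support → ∀ y ∈ P.support, y ∈ P'.support → x = y)
    (hcheck : check T P = check T P') :
    ∃ j φ, parentGraph φ = T ∧ IsCrossing r j P.getVert P'.getVert ∧
      IsParentFor r j P.getVert P'.getVert φ := by
  classical
  obtain ⟨φ, hφ⟩ := exists_isParentMap hc ha (P.getVert 0)
  set p := P.getVert with hp
  set q := P'.getVert with hq
  have hpinj : ∀ a ≤ r, ∀ b ≤ r, p a = p b → a = b := fun a ha b hb h =>
    hP.getVert_injOn (hl ▸ ha : a ≤ P.length) (hl ▸ hb : b ≤ P.length) h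
  have hqinj : ∀ a ≤ r, ∀ b ≤ r, q a = q b → a = b := fun a ha b hb h =>
    hP'.getVert_injOn (hl' ▸ ha : a ≤ P'.length) (hl' ▸ hb : b ≤ P'.length) h
  have hpadj : ∀ i < r, T.Adj (p i) (p (i + 1)) := fun i hi => P.adj_getVert_succ (by omega)
  have hqadj : ∀ i < r, T.Adj (q i) (q (i + 1)) := fun i hi => P'.adj_getVert_succ (by omega)
  have hleft : ∀ i < r, φ (p (i + 1)) = p i := by
    intro i
    induction i with
    | zero =>
      intro hi
      refine (hφ.adj_cases _ _ (hpadj 0 hi)).resolve_left fun h => ?_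
      rw [hφ.root] at h
      exact absurd (hpinj 0 (by omega) (0 + 1) (by omega) h) (by omega)
    | succ i ih =>
      intro hi
      refine (hφ.adj_cases _ _ (hpadj _ hi)).resolve_left fun h => ?_
      rw [ih (by omega)] at h
      exact absurd (hpinj i (by omega) (i + 1 + 1) (by omega) h) (by omega)
  obtain ⟨j, hjr, hup, hj⟩ : ∃ j ≤ r, (∀ i < j, φ (q i) = q (i + 1)) ∧
      (j < r → φ (q j) ≠ q (j + 1)) := by
    by_cases hex : ∃ j, j < r ∧ φ (q j) ≠ q (j + 1)
    · refine ⟨Nat.find hex, (Nat.find_spec hex).1.le, fun i hi => ?_, fun _ =>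
        (Nat.find_spec hex).2⟩
      have h1 := Nat.find_min hex hi
      have h2 := (Nat.find_spec hex).1
      by_contra h3
      exact h1 ⟨by omega, h3⟩
    · refine ⟨r, le_rfl, fun i hi => ?_, fun h => absurd h (lt_irrefl r)⟩
      by_contra h3
      exact hex ⟨i, hi, h3⟩
  have hdown : ∀ i < r, j ≤ i → φ (q (i + 1)) = q i := by
    intro i hi hji
    induction i, hji using Nat.le_induction with
    | base => exact (hφ.adj_cases _ _ (hqadj _ hi)).resolve_left (hj hi)
    | succ i hji ih =>
      refine (hφ.adj_cases _ _ (hqadj _ hi)).resolve_left fun h => ?_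
      rw [ih (by omega)] at h
      exact absurd (hqinj i (by omega) (i + 1 + 1) (by omega) h) (by omega)
  refine ⟨j, φ, hφ.eq_parentGraph, ⟨hjr, hpinj, hqinj, fun i hi hij a ha hqp => ?_⟩,
    ⟨hφ.root, hleft, hup, hdown, fun i hi h1 h2 => ?_⟩⟩
  · obtain ⟨b, hb, hbi, hφb⟩ : ∃ b ≤ r, b ≠ i ∧ φ (q i) = q b := by
      rcases lt_or_gt_of_ne hij with hlt | hlt
      · exact ⟨i + 1, by omega, by omega, hup i hlt⟩
      · obtain ⟨c, rfl⟩ : ∃ c, i = c + 1 := ⟨i - 1, by omega⟩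
        exact ⟨c, by omega, by omega, hdown c (by omega) (by omega)⟩
    rcases a with _ | a
    · rw [hqp, hφ.root, ← hqp] at hφb
      exact hbi (hqinj i hi b hb hφb).symm
    · rw [hqp, hleft a (by omega)] at hφb
      have := hshare (p (a + 1)) (P.getVert_mem_support _) (hqp ▸ P'.getVert_mem_support i)
        (p a) (P.getVert_mem_support _) (hφb ▸ P'.getVert_mem_support b)
      exact absurd (hpinj _ ha _ (by omega) this) (by omega)
  · have h10 : p 1 ≠ p 0 := fun h => absurd (hpinj 1 hr 0 (by omega) h) (by omega)
    rw [← hφ.adjToLeaf_iff h10 (hleft 0 (by omega)) h1,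
      ← hφ.adjToLeaf_iff h10 (hleft 0 (by omega)) h2]
    exact adjToLeaf_getVert_iff hcheck (by omega) (by omega)

end TreeParents

section UnionBound

open Finset

theorem card_le_of_forall_exists_isParentFor {V : Type*} [Fintype V] [DecidableEq V] {r : ℕ}
    (hr : 12 * (r : ℝ) * (12 * r + 1) ≤ Fintype.card V) (B : Finset (SimpleGraph V))
    (hB : ∀ T ∈ B, ∃ (p q : ℕ → V) (j : ℕ) (φ : V → V), (∀ i, r ≤ i → p i = p r) ∧
      (∀ i, r ≤ i → q i = q r) ∧ parentGraph φ = T ∧ IsCrossing r j p q ∧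
      IsParentFor r j p q φ) :
    (B.card : ℝ) ≤ (Fintype.card V : ℝ) ^ (2 * r + 2) * (r + 1) *
      ((1 - Real.exp (-1))⁻¹ * (Real.exp (7 / 2) + 1) *
        ((Fintype.card V : ℝ) ^ (Fintype.card V - (2 * r + 1)) * Real.exp (-(r / 2)))) := by
  classical
  have hθ0 : (0 : ℝ) < 1 - Real.exp (-1) := by
    have : Real.exp (-1) < 1 := by simp
    linarith
  set M : ℝ := (1 - Real.exp (-1))⁻¹ * (Real.exp (7 / 2) + 1) *
    ((Fintype.card V : ℝ) ^ (Fintype.card V - (2 * r + 1)) * Real.exp (-(r / 2))) with hM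
  have hM0 : 0 ≤ M := by positivity
  set ext : (Fin (r + 1) → V) → ℕ → V := fun f i => f ⟨min i r, by omega⟩ with hext
  set F : (Fin (r + 1) → V) × (Fin (r + 1) → V) × Fin (r + 1) → Finset (SimpleGraph V) :=
    fun t => if IsCrossing r t.2.2 (ext t.1) (ext t.2.1) then
      (univ.filter fun φ => IsParentFor r t.2.2 (ext t.1) (ext t.2.1) φ).image parentGraph else ∅
    with hF
  have hFM : ∀ t, ((F t).card : ℝ) ≤ M := by
    intro t
    rw [hF]
    dsimp only
    split_ifs with ht
    · exact (Nat.cast_le.2 card_image_le).trans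
        (card_isParentFor_le ht hr _ fun φ hφ => (mem_filter.1 hφ).2)
    · simpa using hM0
  have hext' : ∀ p : ℕ → V, (∀ i, r ≤ i → p i = p r) →
      ext (fun i : Fin (r + 1) => p i) = p := by
    intro p hp
    funext i
    rcases le_total i r with hi | hi
    · simp [hext, hi]
    · simp [hext, hi, hp i hi]
  have hsub : B ⊆ univ.biUnion F := by
    intro T hT
    obtain ⟨p, q, j, φ, hp, hq, hφT, hc, hφ⟩ := hB T hT
    refine mem_biUnion.2 ⟨(fun i => p i, fun i => q i, ⟨j, Nat.lt_succ_of_le hc.le⟩),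
      mem_univ _, ?_⟩
    rw [hF]
    dsimp only
    rw [hext' p hp, hext' q hq, if_pos hc]
    exact mem_image.2 ⟨φ, mem_filter.2 ⟨mem_univ _, hφ⟩, hφT⟩
  calc (B.card : ℝ) ≤ ((∑ t, (F t).card : ℕ) : ℝ) :=
        Nat.cast_le.2 ((card_le_card hsub).trans card_biUnion_le)
    _ = ∑ t, ((F t).card : ℝ) := by push_cast; rfl
    _ ≤ ∑ _t : (Fin (r + 1) → V) × (Fin (r + 1) → V) × Fin (r + 1), M :=
        sum_le_sum fun t _ => hFM t
    _ = _ := by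
        rw [sum_const, card_univ, nsmul_eq_mul, Fintype.card_prod, Fintype.card_prod,
          Fintype.card_fun, Fintype.card_fin]
        push_cast
        ring

theorem card_div_card_trees_le {V : Type*} [Fintype V] [DecidableEq V] {r N : ℕ}
    (hV : 2 ≤ Fintype.card V) (hr1 : 1 ≤ r) (hr : 12 * (r : ℝ) * (12 * r + 1) ≤ Fintype.card V)
    (hN : Fintype.card V ^ (Fintype.card V - 2) ≤ N) (B : Finset (SimpleGraph V))
    (hB : ∀ T ∈ B, ∃ (p q : ℕ → V) (j : ℕ) (φ : V → V), (∀ i, r ≤ i → p i = p r) ∧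
      (∀ i, r ≤ i → q i = q r) ∧ parentGraph φ = T ∧ IsCrossing r j p q ∧
      IsParentFor r j p q φ) :
    (B.card : ℝ) / N ≤ (1 - Real.exp (-1))⁻¹ * (Real.exp (7 / 2) + 1) *
      ((r + 1) * (Fintype.card V : ℝ) ^ 3 * Real.exp (-(r / 2))) := by
  have hθ0 : (0 : ℝ) < 1 - Real.exp (-1) := by
    have : Real.exp (-1) < 1 := by simp
    linarith
  have hmain := card_le_of_forall_exists_isParentFor hr B hB
  set n := Fintype.card V
  have hn0 : (0 : ℝ) < n := by
    have : 0 < n := by omega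
    exact_mod_cast this
  have hN' : (n : ℝ) ^ (n - 2) ≤ N := by exact_mod_cast hN
  have hrn : 2 * r + 1 ≤ n := by
    have h1 : (1 : ℝ) ≤ r := by exact_mod_cast hr1
    have h2 : (2 * r + 1 : ℝ) ≤ n := by nlinarith
    exact_mod_cast h2
  have hN0 : (0 : ℝ) < N := lt_of_lt_of_le (by positivity) hN'
  rw [div_le_iff₀ hN0]
  have hpow : (n : ℝ) ^ (2 * r + 2) * (n : ℝ) ^ (n - (2 * r + 1)) = (n : ℝ) ^ 3 * n ^ (n - 2) := by
    rw [← pow_add, ← pow_add]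
    congr 1
    omega
  calc (B.card : ℝ) ≤ _ := hmain
    _ = (1 - Real.exp (-1))⁻¹ * (Real.exp (7 / 2) + 1) * ((r + 1) * Real.exp (-(r / 2))) *
        ((n : ℝ) ^ (2 * r + 2) * (n : ℝ) ^ (n - (2 * r + 1))) := by ring
    _ = (1 - Real.exp (-1))⁻¹ * (Real.exp (7 / 2) + 1) *
        ((r + 1) * (n : ℝ) ^ 3 * Real.exp (-(r / 2))) * (n : ℝ) ^ (n - 2) := by rw [hpow]; ring
    _ ≤ _ := by gcongr

end UnionBound

section Asymptotics

theorem eventually_r0_mul_le :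
    ∀ᶠ n : ℕ in atTop, 12 * (r0 n : ℝ) * (12 * r0 n + 1) ≤ n := by
  have hlog : Tendsto (fun n : ℕ => Real.log n) atTop atTop :=
    Real.tendsto_log_atTop.comp tendsto_natCast_atTop_atTop
  have h2 := (Real.tendsto_pow_mul_exp_neg_atTop_nhds_zero 2).comp hlog
  filter_upwards [h2.eventually_lt_const (by norm_num : (0 : ℝ) < 1 / 9409),
    hlog.eventually_ge_atTop 1, eventually_gt_atTop 0] with n h3 h4 h5
  have hn : (0 : ℝ) < n := by exact_mod_cast h5
  simp only [Function.comp_apply, Real.exp_neg, Real.exp_log hn] at h3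
  rw [← div_eq_mul_inv, div_lt_iff₀ hn] at h3
  have h6 : (r0 n : ℝ) < 7 * Real.log n + 1 := Nat.ceil_lt_add_one (by linarith)
  have h7 : (0 : ℝ) ≤ r0 n := Nat.cast_nonneg _
  calc 12 * (r0 n : ℝ) * (12 * r0 n + 1) ≤ (97 * Real.log n) * (97 * Real.log n) :=
        mul_le_mul (by linarith) (by linarith) (by linarith) (by linarith)
    _ ≤ n := by nlinarith

theorem tendsto_r0_add_one_mul_pow_mul_exp (C : ℝ) :
    Tendsto (fun n : ℕ => C * (((r0 n : ℝ) + 1) * (n : ℝ) ^ 3 * Real.exp (-((r0 n : ℝ) / 2))))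
      atTop (nhds 0) := by
  have hlog : Tendsto (fun n : ℕ => Real.log n / 2) atTop atTop :=
    (Real.tendsto_log_atTop.comp tendsto_natCast_atTop_atTop).atTop_div_const (by norm_num)
  have h0 := (Real.tendsto_pow_mul_exp_neg_atTop_nhds_zero 0).comp hlog
  have h1 := (Real.tendsto_pow_mul_exp_neg_atTop_nhds_zero 1).comp hlog
  have h2 := (h1.const_mul 14).add (h0.const_mul 2)
  rw [mul_zero, mul_zero, add_zero] at h2
  have h3 : Tendsto (fun n : ℕ => ((r0 n : ℝ) + 1) * (n : ℝ) ^ 3 *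
      Real.exp (-((r0 n : ℝ) / 2))) atTop (nhds 0) := by
    refine squeeze_zero' (Eventually.of_forall fun n => by positivity) ?_ h2
    filter_upwards [eventually_gt_atTop 0] with n hn
    have hn' : (0 : ℝ) < n := by exact_mod_cast hn
    have hl : 0 ≤ Real.log n := Real.log_nonneg (by exact_mod_cast hn)
    have h6 : (r0 n : ℝ) < 7 * Real.log n + 1 := Nat.ceil_lt_add_one (by linarith)
    have h7 : 7 * Real.log n ≤ (r0 n : ℝ) := Nat.le_ceil _
    have h8 : (n : ℝ) ^ 3 = Real.exp (3 * Real.log n) := by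
      rw [mul_comm, Real.exp_mul, Real.exp_log hn']
      norm_cast
    have h9 : (n : ℝ) ^ 3 * Real.exp (-((r0 n : ℝ) / 2)) ≤ Real.exp (-(Real.log n / 2)) := by
      rw [h8, ← Real.exp_add]
      exact Real.exp_le_exp.2 (by linarith)
    simp only [Function.comp_apply, pow_one, pow_zero, one_mul]
    calc _ = ((r0 n : ℝ) + 1) * ((n : ℝ) ^ 3 * Real.exp (-((r0 n : ℝ) / 2))) := by ring
      _ ≤ (7 * Real.log n + 2) * Real.exp (-(Real.log n / 2)) :=
          mul_le_mul (by linarith) h9 (by positivity) (by linarith)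
      _ = _ := by ring
  simpa using h3.const_mul C

end Asymptotics

theorem one_sub_le_treeProb {n : ℕ} (hn : 2 ≤ n) {E : Set (SimpleGraph (Fin n))} {x : ℝ}
    (h : ∀ (N : ℕ) (B : Finset (SimpleGraph (Fin n))), n ^ (n - 2) ≤ N →
      (∀ T ∈ B, T.Connected ∧ T.IsAcyclic ∧ T ∉ E) → (B.card : ℝ) / N ≤ x) :
    1 - x ≤ treeProb n E := by
  classical
  have hN : n ^ (n - 2) ≤ (Finset.univ.filter fun T : SimpleGraph (Fin n) =>
      T.Connected ∧ T.IsAcyclic).card := by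
    have := pow_le_card_trees (V := Fin n) (by simpa using hn)
    rw [Fintype.card_fin] at this
    convert this
  have h0 : 0 < n ^ (n - 2) := pow_pos (by omega) _
  have hx := h _ (Finset.univ.filter fun T : SimpleGraph (Fin n) =>
    T.Connected ∧ T.IsAcyclic ∧ T ∉ E) hN fun T hT => (Finset.mem_filter.1 hT).2
  have hsplit := Finset.card_filter_add_card_filter_not (s := Finset.univ.filter
    fun T : SimpleGraph (Fin n) => T.Connected ∧ T.IsAcyclic) (fun T => T ∈ E)
  rw [Finset.filter_filter, Finset.filter_filter] at hsplit
  simp only [and_assoc] at hsplit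
  have hpos : (0 : ℝ) < (Finset.univ.filter
      fun T : SimpleGraph (Fin n) => T.Connected ∧ T.IsAcyclic).card := by
    exact Nat.cast_pos.2 (h0.trans_le hN)
  rw [treeProb, le_div_iff₀ hpos, sub_mul, one_mul]
  rw [div_le_iff₀ hpos] at hx
  have hsplit' := congrArg (Nat.cast : ℕ → ℝ) hsplit
  rw [Nat.cast_add] at hsplit'
  linarith

theorem statement6 :
    Tendsto (fun n : ℕ => treeProb n
        {T | ∀ (v w v' w' : Fin n) (P : T.Walk v w) (P' : T.Walk v' w'),
          P.IsPath → P'.IsPath → P.length = r0 n → P'.length = r0 n →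
          (P.support.toFinset ∩ P'.support.toFinset).card ≤ 1 →
          check T P ≠ check T P'})
      atTop (nhds 1) := by
  classical
  have hlim := (tendsto_r0_add_one_mul_pow_mul_exp
    ((1 - Real.exp (-1))⁻¹ * (Real.exp (7 / 2) + 1))).const_sub 1
  rw [sub_zero] at hlim
  refine tendsto_of_tendsto_of_tendsto_of_le_of_le' hlim tendsto_const_nhds ?_
    (Eventually.of_forall fun n => ?_)
  · filter_upwards [eventually_r0_mul_le, eventually_ge_atTop 2] with n hr hn
    have hr1 : 1 ≤ r0 n := Nat.ceil_pos.2
      (mul_pos (by norm_num) (Real.log_pos (by exact_mod_cast hn)))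
    refine one_sub_le_treeProb hn fun N B hN hB => ?_
    refine (card_div_card_trees_le (V := Fin n) (by simpa using hn) hr1 (by simpa using hr)
      (by simpa using hN) _ (by
        intro T hT
        obtain ⟨hc, ha, hTE⟩ := hB T hT
        simp only [Set.mem_ofPred_eq] at hTE
        push Not at hTE
        obtain ⟨v, w, v', w', P, P', hP, hP', hl, hl', hcard, hcheck⟩ := hTE
        obtain ⟨j, φ, h1, h2, h3⟩ := exists_isCrossing_isParentFor hc ha hP hP' hr1 hl hl'
          (fun x hx hx' y hy hy' => Finset.card_le_one.1 hcard x (by simp [hx, hx'])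
            y (by simp [hy, hy'])) hcheck
        refine ⟨_, _, j, φ, fun i hi => ?_, fun i hi => ?_, h1, h2, h3⟩
        · rw [P.getVert_of_length_le (hl ▸ hi), P.getVert_of_length_le hl.le]
        · rw [P'.getVert_of_length_le (hl' ▸ hi), P'.getVert_of_length_le hl'.le])).trans_eq (by rw [Fintype.card_fin])
  · rw [treeProb]
    refine div_le_one_of_le₀ ?_ (Nat.cast_nonneg _)
    refine Nat.cast_le.2 (Finset.card_le_card fun T hT => ?_)
    simp only [Finset.mem_filter] at hT ⊢
    exact ⟨hT.1, hT.2.1, hT.2.2.1⟩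
end
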